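/- arXiv:1209.3627 — 2 statements merged into one kernel-verified Lean document; each statement's English description precedes it below -/
import Mathlib

section
/- For every ε > 0 there exists a bound P such that for every prime p > P, the lower asymptotic density δ̲_p := liminf_{x→∞} #{primes q with p < q ≤ x such that there exists a prime r > q with A(pqr) > (p+1)/2} / π(x) satisfies δ̲_p ≥ 1/16 − ε, where π(x) denotes the number of primes up to x; that is, liminf_{p→∞} δ̲_p ≥ 1/16. -/
/-- The height `A(n)` of the `n`-th cyclotomic polynomial. -/
noncomputable def cycHeight (n : ℕ) : ℕ :=
  (Finset.range ((Polynomial.cyclotomic n ℤ).natDegree + 1)).sup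
    fun k => ((Polynomial.cyclotomic n ℤ).coeff k).natAbs

/-- The number of primes `q` with `p < q ≤ x` for which some prime `r > q`
has `A(pqr) > (p+1)/2`. -/
noncomputable def beiterCount (p x : ℕ) : ℕ :=
  ({q : ℕ | p < q ∧ q ≤ x ∧ q.Prime ∧ ∃ r : ℕ, r.Prime ∧ q < r ∧
    ((p : ℝ) + 1) / 2 < (cycHeight (p * q * r) : ℝ)}).ncard

/-- The lower density `δ̲_p` of primes `q > p` admitting a prime `r > q`
with `A(pqr) > (p+1)/2`. -/
noncomputable def lowerDelta (p : ℕ) : ℝ :=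
  Filter.liminf
    (fun x : ℕ => (beiterCount p x : ℝ) / (Nat.primeCounting x : ℝ))
    Filter.atTop

open Polynomial Finset

lemma cyclotomic_mul_prime_mul {p q : ℕ} (hp : p.Prime) (hq : q.Prime) (hpq : p ≠ q) :
    cyclotomic (p * q) ℤ * ((X ^ p - 1) * (X ^ q - 1)) = (X ^ (p * q) - 1) * (X - 1) := by
  have h1 := cyclotomic_expand_eq_cyclotomic_mul hq
    (fun h => hpq ((Nat.prime_dvd_prime_iff_eq hq hp).1 h).symm) ℤ
  have h2 := cyclotomic_prime_mul_X_sub_one ℤ p (hn := ⟨hp⟩)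
  have h3 := congrArg (expand ℤ q) h2
  simp only [map_mul, map_sub, map_pow, expand_X, map_one] at h3
  rw [h1] at h3
  rw [← h2, mul_comm p q, pow_mul, ← h3]
  ring_nf

lemma X_pow_mul_cyclotomic_mul_prime {p q u v : ℕ} (hp : p.Prime) (hq : q.Prime) (hpq : p ≠ q)
    (huv : p * u + q * v = p * q + 1) (hu : u ≤ q) (hv : v ≤ p) :
    X ^ (p * q) * cyclotomic (p * q) ℤ =
      X ^ (p * q) * ((∑ a ∈ range u, X ^ (p * a)) * ∑ b ∈ range v, X ^ (q * b)) -
        (∑ a ∈ Ico u q, X ^ (p * a)) * ∑ b ∈ Ico v p, X ^ (q * b) := by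
  have hne : ((X : ℤ[X]) ^ p - 1) * (X ^ q - 1) ≠ 0 :=
    mul_ne_zero (X_pow_sub_C_ne_zero hp.pos 1) (X_pow_sub_C_ne_zero hq.pos 1)
  apply mul_right_cancel₀ hne
  rw [mul_assoc, cyclotomic_mul_prime_mul hp hq hpq]
  have g (n k : ℕ) : (∑ a ∈ range n, (X : ℤ[X]) ^ (k * a)) * (X ^ k - 1) = X ^ (k * n) - 1 := by
    simp only [pow_mul]; exact geom_sum_mul _ _
  have g' (m n k : ℕ) (h : m ≤ n) :
      (∑ a ∈ Ico m n, (X : ℤ[X]) ^ (k * a)) * (X ^ k - 1) = X ^ (k * n) - X ^ (k * m) := by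
    simp only [pow_mul]; exact geom_sum_Ico_mul _ h
  have e : (X : ℤ[X]) ^ (p * u) * X ^ (q * v) = X ^ (p * q) * X := by
    rw [← pow_add, huv, pow_succ]
  calc _ = (X : ℤ[X]) ^ (p * q) * (((X : ℤ[X]) ^ (p * u) - 1) * ((X : ℤ[X]) ^ (q * v) - 1))
        - ((X : ℤ[X]) ^ (p * q) - X ^ (p * u)) * (X ^ (q * p) - X ^ (q * v)) := by
          rw [mul_comm q p]; linear_combination (1 - X ^ (p * q)) * e
    _ = _ := by
      rw [← g, ← g, ← g' u q p hu, ← g' v p q hv]; ring_nf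

lemma eq_and_eq_of_modEq {p q a b c d : ℕ} (hpq : p.Coprime q) (ha : a < q) (hb : b < p)
    (hc : c < q) (hd : d < p) (h : p * a + q * b ≡ p * c + q * d [MOD p * q]) :
    a = c ∧ b = d := by
  constructor
  · have h1 : p * a ≡ p * c [MOD q] := by
      have := h.of_mul_left p
      simpa [Nat.ModEq, Nat.add_mod] using this
    exact Nat.ModEq.eq_of_lt_of_lt (Nat.ModEq.cancel_left_of_coprime
      (by rwa [Nat.gcd_comm]) h1) ha hc
  · have h1 : q * b ≡ q * d [MOD p] := by
      have := h.of_mul_right q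
      simpa [Nat.ModEq, Nat.add_mod] using this
    exact Nat.ModEq.eq_of_lt_of_lt (Nat.ModEq.cancel_left_of_coprime hpq h1) hb hd

lemma coeff_cyclotomic_mul_prime {p q u v : ℕ} (hp : p.Prime) (hq : q.Prime) (hpq : p ≠ q)
    (huv : p * u + q * v = p * q + 1) (hu : u ≤ q) (hv : v ≤ p) {a b k : ℕ}
    (ha : a < q) (hb : b < p) (hk : k < p * q) (hab : p * a + q * b ≡ k [MOD p * q]) :
    (cyclotomic (p * q) ℤ).coeff k =
      if a < u ∧ b < v then 1 else if u ≤ a ∧ v ≤ b then -1 else 0 := by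
  have hco : p.Coprime q := (Nat.coprime_primes hp hq).2 hpq
  have h := congrArg (fun f => f.coeff (k + p * q))
    (X_pow_mul_cyclotomic_mul_prime hp hq hpq huv hu hv)
  simp only [coeff_sub, coeff_X_pow_mul, sum_mul_sum, ← pow_add, finsetSum_coeff, coeff_X_pow] at h
  rw [h]
  have e1 : ∀ c ∈ range u, ∀ d ∈ range v, (k = p * c + q * d) ↔ (c = a ∧ d = b) := by
    intro c hc d hd
    rw [mem_range] at hc hd
    constructor
    · rintro rfl
      obtain ⟨h1, h2⟩ := eq_and_eq_of_modEq hco ha hb (hc.trans_le hu) (hd.trans_le hv) hab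
      exact ⟨h1.symm, h2.symm⟩
    · rintro ⟨rfl, rfl⟩
      have : p * c + q * d < p * q := by nlinarith [hp.two_le, hq.two_le]
      rw [Nat.ModEq, Nat.mod_eq_of_lt this, Nat.mod_eq_of_lt hk] at hab
      exact hab.symm
  have e2 : ∀ c ∈ Ico u q, ∀ d ∈ Ico v p, (k + p * q = p * c + q * d) ↔ (c = a ∧ d = b) := by
    intro c hc d hd
    rw [mem_Ico] at hc hd
    constructor
    · intro h'
      have : p * a + q * b ≡ p * c + q * d [MOD p * q] := by
        rw [← h']; simpa [Nat.ModEq] using hab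
      obtain ⟨h1, h2⟩ := eq_and_eq_of_modEq hco ha hb hc.2 hd.2 this
      exact ⟨h1.symm, h2.symm⟩
    · rintro ⟨rfl, rfl⟩
      have h3 : p * q ≤ p * c + q * d := by nlinarith
      have h4 : p * c + q * d < p * q + p * q := by nlinarith
      have h5 : p * c + q * d - p * q < p * q := by omega
      have : p * c + q * d - p * q ≡ k [MOD p * q] := by
        have : (p * c + q * d - p * q + p * q) % (p * q) = k % (p * q) := by
          rw [Nat.sub_add_cancel h3]; exact hab
        simpa [Nat.ModEq] using this
      rw [Nat.ModEq, Nat.mod_eq_of_lt h5, Nat.mod_eq_of_lt hk] at this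
      omega
  rw [sum_congr rfl fun c hc => sum_congr rfl fun d hd => if_congr (e1 c hc d hd) rfl rfl,
    sum_congr rfl fun c hc => sum_congr rfl fun d hd => if_congr (e2 c hc d hd) rfl rfl]
  simp only [ite_and, sum_ite_irrel, sum_const_zero, sum_ite_eq', mem_range, mem_Ico]
  split_ifs <;> grind

/-- The coefficients of `Φ_N` of index at most `T`, seen as a function on `ZMod N`. -/
noncomputable def truncCoeff (N T : ℕ) (i : ZMod N) : ℤ :=
  if i.val ≤ T then (cyclotomic N ℤ).coeff i.val else 0

lemma cyclotomic_mul_three_mul {p q r : ℕ} (hp : p.Prime) (hq : q.Prime) (hr : r.Prime)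
    (hpq : p ≠ q) (hrpq : ¬ r ∣ p * q) (J : ℕ) :
    cyclotomic (p * q * r) ℤ * (1 - X ^ (p * q * J)) = expand ℤ r (cyclotomic (p * q) ℤ) *
      ∑ m ∈ range p, ∑ j ∈ range J, (X ^ (m + p * q * j) - X ^ (m + q + p * q * j)) := by
  have h1 := cyclotomic_expand_eq_cyclotomic_mul hr hrpq ℤ
  have h2 := cyclotomic_mul_prime_mul hp hq hpq
  have hne : (X : ℤ[X]) - 1 ≠ 0 := X_sub_C_ne_zero 1
  have gp : (∑ m ∈ range p, (X : ℤ[X]) ^ m) * (X - 1) = X ^ p - 1 := geom_sum_mul _ _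
  have gN : (∑ j ∈ range J, (X : ℤ[X]) ^ (p * q * j)) * (X ^ (p * q) - 1) =
      X ^ (p * q * J) - 1 := by
    simp only [pow_mul _ (p * q)]; exact geom_sum_mul _ _
  have hs : ∑ m ∈ range p, ∑ j ∈ range J,
      ((X : ℤ[X]) ^ (m + p * q * j) - X ^ (m + q + p * q * j)) =
      (∑ m ∈ range p, (X : ℤ[X]) ^ m) * (1 - X ^ q) * ∑ j ∈ range J, X ^ (p * q * j) := by
    rw [sum_mul, sum_mul_sum]
    refine sum_congr rfl fun m _ => sum_congr rfl fun j _ => ?_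
    ring
  apply mul_right_cancel₀ hne
  rw [hs, h1]
  linear_combination (cyclotomic (p * q * r) ℤ * (X - 1)) * gN
    + cyclotomic (p * q * r) ℤ * (∑ j ∈ range J, X ^ (p * q * j)) * h2
    + cyclotomic (p * q * r) ℤ * cyclotomic (p * q) ℤ * (X ^ q - 1)
      * (∑ j ∈ range J, X ^ (p * q * j)) * gp

lemma sum_ite_eq_progression {N J n e r i : ℕ} (hN : 0 < N) (he : e < N) (hJ : n < N * J) :
    (∑ j ∈ range J, if n = i * r + (e + N * j) then (1 : ℤ) else 0) =
      if i * r ≤ n ∧ ((i * r + e : ℕ) : ZMod N) = n then 1 else 0 := by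
  split_ifs with h
  · obtain ⟨h1, h2⟩ := h
    rw [ZMod.natCast_eq_natCast_iff] at h2
    have hle : i * r + e ≤ n := by
      by_contra! hlt
      have h3 : n ≡ i * r + e [MOD N] := h2.symm
      rw [Nat.modEq_iff_dvd' hlt.le] at h3
      have := Nat.le_of_dvd (by omega) h3
      omega
    obtain ⟨j, hj⟩ := (Nat.modEq_iff_dvd' hle).1 h2
    have hjJ : j < J := by
      by_contra! hh
      have := Nat.mul_le_mul_left N hh
      omega
    rw [sum_eq_single_of_mem j (mem_range.2 hjJ)]
    · rw [if_pos (by omega)]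
    · intro j' _ hne
      rw [if_neg]
      intro h4
      apply hne
      have : N * j' = N * j := by omega
      exact Nat.eq_of_mul_eq_mul_left hN this
  · apply sum_eq_zero
    intro j _
    rw [if_neg]
    intro h4
    apply h
    refine ⟨by omega, ?_⟩
    rw [h4]; push_cast; simp

lemma coeff_cyclotomic_mul_three {p q r : ℕ} (hp : p.Prime) (hq : q.Prime) (hr : r.Prime)
    (hpq : p < q) (hrpq : ¬ r ∣ p * q) {ρ : ZMod (p * q)} (hρ : ρ * r = 1) (n : ℕ) :
    (cyclotomic (p * q * r) ℤ).coeff n = ∑ m ∈ range p,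
      (truncCoeff (p * q) (n / r) (ρ * (n - m)) -
        truncCoeff (p * q) (n / r) (ρ * (n - (m + q)))) := by
  have hN : 0 < p * q := Nat.mul_pos hp.pos hq.pos
  have : NeZero (p * q) := ⟨hN.ne'⟩
  have hJ : n < p * q * (n + 1) := by nlinarith
  have h := congrArg (fun f => f.coeff n)
    (cyclotomic_mul_three_mul hp hq hr hpq.ne hrpq (n + 1))
  rw [mul_sub, mul_one, coeff_sub, coeff_mul_X_pow', if_neg (not_le.2 hJ), sub_zero] at h
  have hdeg : (cyclotomic (p * q) ℤ).natDegree < p * q := by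
    rw [natDegree_cyclotomic]
    exact Nat.totient_lt _ (by nlinarith [hp.two_le, hq.two_le])
  have hexp : expand ℤ r (cyclotomic (p * q) ℤ) =
      ∑ i ∈ range (p * q), C ((cyclotomic (p * q) ℤ).coeff i) * X ^ (i * r) := by
    rw [expand_eq_sum, sum_over_range' _ (by simp) _ hdeg]
    refine sum_congr rfl fun i _ => ?_
    rw [← pow_mul, mul_comm r]
  rw [h, hexp, sum_mul_sum, finsetSum_coeff]
  simp only [mul_sum, mul_sub, mul_assoc, ← pow_add, finsetSum_coeff, coeff_sub, coeff_C_mul,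
    coeff_X_pow, sum_sub_distrib]
  simp only [← mul_sum]
  have swap (F : ℕ → ℕ → ℤ) : ∑ x ∈ range (p * q), (cyclotomic (p * q) ℤ).coeff x *
      ∑ i ∈ range p, F x i =
        ∑ i ∈ range p, ∑ x ∈ range (p * q), (cyclotomic (p * q) ℤ).coeff x * F x i := by
    simp_rw [mul_sum]
    exact sum_comm
  rw [swap, swap]
  have key (e : ℕ) (he : e < p * q) :
      ∑ i ∈ range (p * q), (cyclotomic (p * q) ℤ).coeff i *
        (∑ j ∈ range (n + 1), if n = i * r + (e + p * (q * j)) then (1 : ℤ) else 0) =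
      truncCoeff (p * q) (n / r) (ρ * ((n : ZMod (p * q)) - (e : ZMod (p * q)))) := by
    have hval := ZMod.val_lt (ρ * ((n : ZMod (p * q)) - (e : ZMod (p * q))))
    rw [sum_eq_single_of_mem _ (mem_range.2 hval)]
    · simp only [← mul_assoc p q]
      rw [sum_ite_eq_progression hN he hJ, truncCoeff]
      have : (((ρ * ((n : ZMod (p * q)) - e)).val * r + e : ℕ) : ZMod (p * q)) = n := by
        push_cast
        rw [ZMod.natCast_zmod_val]
        linear_combination ((n : ZMod (p * q)) - e) * hρ
      simp only [this, and_true, ← Nat.le_div_iff_mul_le hr.pos]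
      split_ifs <;> simp
    · intro i hi hne
      simp only [← mul_assoc p q]
      rw [sum_ite_eq_progression hN he hJ, if_neg, mul_zero]
      rintro ⟨-, h2⟩
      apply hne
      have : ρ * ((n : ZMod (p * q)) - e) = i := by
        push_cast at h2
        linear_combination (-ρ) * h2 + (i : ZMod (p * q)) * hρ
      rw [this, ZMod.val_natCast_of_lt (mem_range.1 hi)]
  have hpq2 : p + q ≤ p * q := by nlinarith [hp.two_le, hq.two_le]
  simp only [← mul_sub]
  congr 1
  · refine sum_congr rfl fun m hm => ?_
    rw [mem_range] at hm
    exact key m (by omega)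
  · refine sum_congr rfl fun m hm => ?_
    rw [mem_range] at hm
    have := key (m + q) (by omega)
    push_cast at this
    exact this

lemma exists_prime_coeff_cyclotomic_mul_three {p q k : ℕ} (hp : p.Prime) (hq : q.Prime)
    (hk : 0 < k) (hkq : k * p < q) (T : ℕ) (i : ZMod (p * q)) :
    ∃ r : ℕ, r.Prime ∧ q < r ∧ ∃ n : ℕ, (cyclotomic (p * q * r) ℤ).coeff n =
      ∑ m ∈ range p, (truncCoeff (p * q) T (i + (q - k * p) * m) -
        truncCoeff (p * q) T (i + (q - k * p) * m + (q % p : ℕ) * q)) := by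
  have hpq : p < q := (Nat.le_mul_of_pos_left p hk).trans_lt hkq
  have hN : 0 < p * q := Nat.mul_pos hp.pos hq.pos
  have : NeZero (p * q) := ⟨hN.ne'⟩
  have hpq0 : (p : ZMod (p * q)) * q = 0 := by exact_mod_cast ZMod.natCast_self (p * q)
  have hpc : p.Coprime q := (Nat.coprime_primes hp hq).2 hpq.ne
  have hco : (q - k * p).Coprime (p * q) := by
    have hkc : (q - k * p).Coprime (k * p) := by
      rw [Nat.coprime_sub_self_left hkq.le]
      exact Nat.Coprime.mul_right (Nat.coprime_of_lt_prime hk.ne'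
        ((Nat.le_mul_of_pos_right k hp.pos).trans_lt hkq) hq) hpc.symm
    refine Nat.Coprime.mul_right hkc.coprime_mul_left_right ?_
    have := (Nat.coprime_self_add_right (m := q - k * p)).2 hkc
    rwa [Nat.sub_add_cancel hkq.le] at this
  have hs : ((q - k * p : ℕ) : ZMod (p * q)) = q - k * p := by
    rw [Nat.cast_sub hkq.le]; push_cast; ring
  set s := ZMod.unitOfCoprime _ hco
  have hsv : (s : ZMod (p * q)) = q - k * p := by rw [ZMod.coe_unitOfCoprime, hs]
  obtain ⟨r, hr, hrp, hrs⟩ := Nat.forall_exists_prime_gt_and_eq_mod ((-s)⁻¹).isUnit (p * q)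
  have hρ : ((-s : (ZMod (p * q))ˣ) : ZMod (p * q)) * r = 1 := by rw [hrs, Units.mul_inv]
  have hrpq : ¬ r ∣ p * q := fun h => absurd (Nat.le_of_dvd hN h) (by omega)
  set e := ((r : ZMod (p * q)) * i - r * T).val with he
  have he' : e < p * q := ZMod.val_lt _
  refine ⟨r, hrp, (Nat.le_mul_of_pos_left q hp.pos).trans_lt hr, r * T + e, ?_⟩
  rw [coeff_cyclotomic_mul_three hp hq hrp hpq hrpq hρ]
  have hdiv : (r * T + e) / r = T := by
    rw [Nat.mul_add_div hrp.pos, Nat.div_eq_of_lt (by omega), add_zero]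
  have hcast : ((r * T + e : ℕ) : ZMod (p * q)) = r * i := by
    push_cast; rw [he, ZMod.natCast_zmod_val]; ring
  have hmod : (q : ZMod (p * q)) * q = (q % p : ℕ) * q := by
    have h := congrArg (Nat.cast : ℕ → ZMod (p * q)) (Nat.div_add_mod q p)
    push_cast at h
    linear_combination (-q : ZMod (p * q)) * h + ((q / p : ℕ) : ZMod (p * q)) * hpq0
  rw [hdiv]
  refine sum_congr rfl fun m _ => ?_
  rw [hcast]
  rw [Units.val_neg, hsv] at hρ ⊢
  congr 2
  · linear_combination i * hρ
  · linear_combination i * hρ + hmod - (k : ZMod (p * q)) * hpq0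

lemma truncCoeff_natCast {p q u v : ℕ} (hp : p.Prime) (hq : q.Prime) (hpq : p ≠ q)
    (huv : p * u + q * v = p * q + 1) (hu : u ≤ q) (hv : v ≤ p) {a b : ℕ} (T : ℕ)
    (ha : a < q) (hb : b < p) :
    truncCoeff (p * q) T ((p * a + q * b : ℕ) : ZMod (p * q)) =
      if a < u ∧ b < v then if p * a + q * b ≤ T then 1 else 0
      else if u ≤ a ∧ v ≤ b then if p * a + q * b ≤ T + p * q then -1 else 0
      else 0 := by
  have hN : 0 < p * q := Nat.mul_pos hp.pos hq.pos
  have : NeZero (p * q) := ⟨hN.ne'⟩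
  rw [truncCoeff, ZMod.val_natCast, coeff_cyclotomic_mul_prime hp hq hpq huv hu hv ha hb
    (Nat.mod_lt _ hN) (Nat.mod_mod _ _).symm]
  by_cases h1 : a < u ∧ b < v
  · have : p * a + q * b < p * q := by
      have := Nat.mul_le_mul_left p h1.1
      have := Nat.mul_le_mul_left q h1.2
      have := hp.two_le
      grind
    simp only [h1, and_self, if_true, Nat.mod_eq_of_lt this]
  · by_cases h2 : u ≤ a ∧ v ≤ b
    · have h3 : p * q ≤ p * a + q * b := by
        have := Nat.mul_le_mul_left p h2.1
        have := Nat.mul_le_mul_left q h2.2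
        omega
      have h4 : p * a + q * b < p * q + p * q := by nlinarith
      have h5 : (p * a + q * b) % (p * q) = p * a + q * b - p * q := by
        rw [Nat.mod_eq_sub_mod h3, Nat.mod_eq_of_lt (by omega)]
      simp only [h1, h2, if_true, if_false, h5, and_self, Nat.sub_le_iff_le_add]
    · simp [h1, h2]

lemma sum_truncCoeff_of_le_add {p q u v k β : ℕ} (hp : p.Prime) (hq : q.Prime)
    (huv : p * u + q * v = p * q + 1) (hu : u ≤ q) (hv : v ≤ p) (hkq : k * p < q)
    (hβ : 2 * β + 1 < p) (h1 : p ≤ β + v)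
    (hk0 : 0 < k) (hk1 : (p - 2 * β - 1) * q < k * p * (p - β - 1)) (hk2 : k * (p - β - 1) < u)
    (hk3 : u + k * β ≤ q) :
    ∑ m ∈ range p,
      (truncCoeff (p * q) ((p - β - 1) * q)
          (((p * (k * (p - β - 1)) : ℕ) : ZMod (p * q)) + (q - k * p) * m) -
        truncCoeff (p * q) ((p - β - 1) * q)
          (((p * (k * (p - β - 1)) : ℕ) : ZMod (p * q)) + (q - k * p) * m + (β : ℕ) * q)) =
      (p - β : ℕ) := by
  have hpq0 : (p : ZMod (p * q)) * q = 0 := by exact_mod_cast ZMod.natCast_self (p * q)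
  have hpq : p ≠ q := by
    rintro rfl
    have := Nat.le_mul_of_pos_left p hk0
    omega
  obtain ⟨t, ht⟩ : ∃ t, t + β + 1 = p := ⟨p - β - 1, by omega⟩
  have e1 : p - β - 1 = t := by omega
  have e2 : p - 2 * β - 1 = t - β := by omega
  have e3 : p - β = t + 1 := by omega
  have htβ : β < t := by omega
  obtain ⟨s, hs⟩ : ∃ s, t = β + s := ⟨t - β, by omega⟩
  rw [e1] at hk1 hk2 ⊢
  rw [e2, hs, Nat.add_sub_cancel_left, ← hs] at hk1
  rw [e3]
  have eval := @truncCoeff_natCast p q u v hp hq hpq huv hu hv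
  have key : ∀ m ∈ range p,
      (truncCoeff (p * q) (t * q) (((p * (k * t) : ℕ) : ZMod (p * q)) + (q - k * p) * m) -
        truncCoeff (p * q) (t * q)
          (((p * (k * t) : ℕ) : ZMod (p * q)) + (q - k * p) * m + (β : ℕ) * q)) =
      if m < t + 1 then 1 else 0 := by
    intro m hm
    rw [mem_range] at hm
    by_cases hmt : m < t + 1
    · obtain ⟨d, rfl⟩ : ∃ d, t = m + d := ⟨t - m, by omega⟩
      have f1 : ((p * (k * (m + d)) : ℕ) : ZMod (p * q)) + (q - k * p) * m =
          ((p * (k * d) + q * m : ℕ) : ZMod (p * q)) := by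
        push_cast; ring
      have f2 : ((p * (k * (m + d)) : ℕ) : ZMod (p * q)) + (q - k * p) * m + (β : ℕ) * q =
          ((p * (k * d) + q * (m + β) : ℕ) : ZMod (p * q)) := by
        push_cast; ring
      have ha : k * d < u := (Nat.mul_le_mul_left k (by omega)).trans_lt hk2
      rw [f2, f1, eval _ (by omega) hm, eval _ (by omega) (by omega), if_pos hmt,
        if_pos ⟨ha, by omega⟩, if_pos]
      · split_ifs with g1 g2
        · exfalso
          nlinarith
        all_goals first | rfl | omega
      · nlinarith
    · obtain ⟨d, rfl⟩ : ∃ d, m = t + d := ⟨m - t, by omega⟩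
      have hkd : k * d ≤ k * β := Nat.mul_le_mul_left k (by omega)
      have hkd0 : 0 < k * d := Nat.mul_pos hk0 (by omega)
      have hc : ((q - k * d : ℕ) : ZMod (p * q)) = q - k * d := by
        rw [Nat.cast_sub (by omega)]; push_cast; ring
      have f1 : ((p * (k * t) : ℕ) : ZMod (p * q)) + (q - k * p) * (t + d : ℕ) =
          ((p * (q - k * d) + q * (t + d) : ℕ) : ZMod (p * q)) := by
        push_cast; rw [hc]; linear_combination -hpq0
      have f2 : ((p * (k * t) : ℕ) : ZMod (p * q)) + (q - k * p) * (t + d : ℕ) + (β : ℕ) * q =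
          ((p * (q - k * d) + q * (t + d + β - p) : ℕ) : ZMod (p * q)) := by
        push_cast; rw [hc, Nat.cast_sub (by omega)]; push_cast; ring
      rw [f2, f1, eval _ (by omega) hm, eval _ (by omega) (by omega), if_neg hmt,
        if_neg (c := q - k * d < u ∧ t + d < v) (by omega),
        if_neg (c := q - k * d < u ∧ t + d + β - p < v) (by omega),
        if_neg (c := u ≤ q - k * d ∧ v ≤ t + d + β - p) (by omega), sub_zero]
      obtain ⟨a, ha⟩ : ∃ a, a + k * d = q := ⟨q - k * d, by omega⟩
      rw [← ha, Nat.add_sub_cancel, ha]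
      split_ifs with g1 g2
      · exfalso
        have : d * (k * p) < d * q := Nat.mul_lt_mul_of_pos_left hkq (by omega)
        nlinarith
      · rfl
      · rfl
  have hfil : (range p).filter (fun m => m < t + 1) = range (t + 1) := by
    ext m
    simp only [mem_filter, mem_range]
    omega
  rw [sum_congr rfl key, sum_boole, hfil, card_range]

lemma sum_truncCoeff_of_add_lt {p q u v k β : ℕ} (hp : p.Prime) (hq : q.Prime)
    (huv : p * u + q * v = p * q + 1) (hu : u ≤ q) (hkq : k * p < q)
    (hk0 : 0 < k) (hv : 0 < v) (hβ : 2 * β + 1 < p) (h1 : v < β)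
    (hk1 : (p - v - β) * q ≤ k * p * (p - v)) (hk2 : k * (v - 1) < u)
    (hk3 : u + k * (p - v) ≤ q) :
    ∑ m ∈ range p,
      (truncCoeff (p * q) ((v - 1) * q)
          (((p * (k * (v - 1)) + q * (p - β) : ℕ) : ZMod (p * q)) + (q - k * p) * m) -
        truncCoeff (p * q) ((v - 1) * q)
          (((p * (k * (v - 1)) + q * (p - β) : ℕ) : ZMod (p * q)) +
            (q - k * p) * m + (β : ℕ) * q)) =
      -(p - β : ℕ) := by
  have hpq0 : (p : ZMod (p * q)) * q = 0 := by exact_mod_cast ZMod.natCast_self (p * q)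
  have hpq : p ≠ q := by
    rintro rfl
    have := Nat.le_mul_of_pos_left p hk0
    omega
  obtain ⟨t, rfl⟩ : ∃ t, v = t + 1 := ⟨v - 1, by omega⟩
  rw [Nat.add_sub_cancel] at hk2 ⊢
  have eval := @truncCoeff_natCast p q u (t + 1) hp hq hpq huv hu (by omega)
  have hβc : ((p - β : ℕ) : ZMod (p * q)) = p - β := by rw [Nat.cast_sub (by omega)]
  have key : ∀ m ∈ range p,
      (truncCoeff (p * q) (t * q)
          (((p * (k * t) + q * (p - β) : ℕ) : ZMod (p * q)) + (q - k * p) * m) -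
        truncCoeff (p * q) (t * q)
          (((p * (k * t) + q * (p - β) : ℕ) : ZMod (p * q)) +
            (q - k * p) * m + (β : ℕ) * q)) =
      - if m < t + 1 ∨ β + t + 1 ≤ m then 1 else 0 := by
    intro m hm
    rw [mem_range] at hm
    by_cases hmt : m < t + 1
    · obtain ⟨d, rfl⟩ : ∃ d, t = m + d := ⟨t - m, by omega⟩
      have f1 : ((p * (k * (m + d)) + q * (p - β) : ℕ) : ZMod (p * q)) + (q - k * p) * m =
          ((p * (k * d) + q * (m + p - β) : ℕ) : ZMod (p * q)) := by
        push_cast [Nat.cast_sub (show β ≤ m + p by omega)]; rw [hβc]; ring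
      have f2 : ((p * (k * (m + d)) + q * (p - β) : ℕ) : ZMod (p * q)) + (q - k * p) * m +
          (β : ℕ) * q = ((p * (k * d) + q * m : ℕ) : ZMod (p * q)) := by
        push_cast; rw [hβc]; linear_combination hpq0
      have ha : k * d < u := (Nat.mul_le_mul_left k (by omega)).trans_lt hk2
      rw [f2, f1, eval _ (by omega) (by omega), eval _ (by omega) (by omega), if_pos (Or.inl hmt),
        if_neg (by omega), if_neg (by omega), if_pos ⟨ha, hmt⟩, if_pos, zero_sub]
      nlinarith
    · obtain ⟨d, rfl⟩ : ∃ d, m = t + d := ⟨m - t, by omega⟩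
      have hkd : k * d ≤ k * (p - (t + 1)) := Nat.mul_le_mul_left k (by omega)
      have hkd0 : 0 < k * d := Nat.mul_pos hk0 (by omega)
      have hc : ((q - k * d : ℕ) : ZMod (p * q)) = q - k * d := by
        rw [Nat.cast_sub (by omega)]; push_cast; ring
      have hlt : d * (k * p) < d * q := Nat.mul_lt_mul_of_pos_left hkq (by omega)
      have f2 : ((p * (k * t) + q * (p - β) : ℕ) : ZMod (p * q)) +
          (q - k * p) * (t + d : ℕ) + (β : ℕ) * q =
          ((p * (q - k * d) + q * (t + d) : ℕ) : ZMod (p * q)) := by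
        push_cast; rw [hc, hβc]; ring
      obtain ⟨a, ha⟩ : ∃ a, a + k * d = q := ⟨q - k * d, by omega⟩
      have ha' : q - k * d = a := by omega
      rw [ha'] at f2 hc
      have hpa : p * a + d * (k * p) = p * q := by rw [← ha]; ring
      by_cases hβm : t + d < β
      · have f1 : ((p * (k * t) + q * (p - β) : ℕ) : ZMod (p * q)) + (q - k * p) * (t + d : ℕ) =
            ((p * a + q * (t + d + p - β) : ℕ) : ZMod (p * q)) := by
          push_cast [Nat.cast_sub (show β ≤ t + d + p by omega)]
          rw [hc, hβc]; linear_combination -hpq0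
        rw [f2, f1, eval _ (by omega) (by omega), eval _ (by omega) (by omega),
          if_neg (by omega), if_pos (by omega), if_neg, if_neg (by omega), if_pos (by omega),
          if_neg, if_neg (by omega)]
        · rfl
        · nlinarith
        · have := Nat.mul_le_mul_left q (show t + d ≤ t + d + p - β by omega)
          nlinarith
      · obtain ⟨b, hb⟩ : ∃ b, t + d = β + b := ⟨t + d - β, by omega⟩
        have f1 : ((p * (k * t) + q * (p - β) : ℕ) : ZMod (p * q)) + (q - k * p) * (t + d : ℕ) =
            ((p * a + q * b : ℕ) : ZMod (p * q)) := by
          have hb' := congrArg (Nat.cast : ℕ → ZMod (p * q)) hb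
          push_cast at hb'
          push_cast
          rw [hc, hβc]; linear_combination (q : ZMod (p * q)) * hb'
        rw [f2, f1, eval _ (by omega) (by omega), eval _ (by omega) (by omega),
          if_neg (c := a < u ∧ t + d < t + 1) (by omega),
          if_pos (c := u ≤ a ∧ t + 1 ≤ t + d) (by omega),
          if_neg (c := p * a + q * (t + d) ≤ t * q + p * q), if_neg (by omega)]
        · by_cases hbt : t + 1 ≤ b
          · rw [if_pos (by omega), if_pos, if_pos (by omega)]
            · rfl
            · obtain ⟨c, hc'⟩ : ∃ c, d + c = p - (t + 1) := ⟨p - (t + 1) - d, by omega⟩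
              have hβc' : p - (t + 1) - β + β = d + c := by omega
              have h3 : c * (k * p) ≤ c * q := Nat.mul_le_mul_left c hkq.le
              rw [← hc'] at hk1
              have h4 : t * q + d * q = β * q + b * q := by rw [← add_mul, hb, add_mul]
              have h5 : (d + c - β) * q + β * q = d * q + c * q := by
                rw [← add_mul, ← add_mul, Nat.sub_add_cancel (by omega)]
              linarith
          · rw [if_neg (by omega), if_neg (by omega)]
            rfl
        · nlinarith
  have hfil : #((range p).filter (fun m => m < t + 1 ∨ β + t + 1 ≤ m)) = p - β := by
    have : (range p).filter (fun m => m < t + 1 ∨ β + t + 1 ≤ m) =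
        range (t + 1) ∪ Ico (β + t + 1) p := by
      ext m
      simp only [mem_filter, mem_range, mem_union, mem_Ico]
      omega
    rw [this, card_union_of_disjoint, card_range, Nat.card_Ico]
    · omega
    · rw [disjoint_left]
      intro m
      simp only [mem_range, mem_Ico]
      omega
  rw [sum_congr rfl key, sum_neg_distrib, sum_boole, hfil]

lemma natAbs_coeff_le_cycHeight (n k : ℕ) :
    ((cyclotomic n ℤ).coeff k).natAbs ≤ cycHeight n := by
  by_cases h : k ≤ (cyclotomic n ℤ).natDegree
  · exact le_sup (f := fun k => ((cyclotomic n ℤ).coeff k).natAbs) (mem_range.2 (by omega))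
  · rw [coeff_eq_zero_of_natDegree_lt (by omega)]
    simp

lemma exists_mul_add_mul_eq {p q v β : ℕ} (hp : p.Prime) (hq : 0 < q) (hqβ : q % p = β)
    (hβv : β * v ≡ 1 [MOD p]) (hv0 : 0 < v) (hv : v ≤ p) :
    ∃ u, u ≤ q ∧ p * u + q * v = p * q + 1 := by
  have h1 : q * v ≡ 1 [MOD p] := by
    refine Nat.ModEq.trans (Nat.ModEq.mul_right v ?_) hβv
    rw [← hqβ]
    exact (Nat.mod_modEq q p).symm
  have h2 : q * v ≡ p * q + 1 [MOD p] := by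
    simpa [Nat.ModEq] using h1
  have h3 : q * v ≤ p * q := by nlinarith
  obtain ⟨u, hu⟩ := (Nat.modEq_iff_dvd' (by omega)).1 h2
  refine ⟨u, ?_, by omega⟩
  have : p * u ≤ p * q := by
    have : 1 ≤ q * v := Nat.mul_pos hq hv0
    omega
  exact Nat.le_of_mul_le_mul_left this hp.pos

lemma exists_prime_le_cycHeight_of_le_add {p q v β : ℕ} (hp : p.Prime) (hq : q.Prime)
    (hqβ : q % p = β) (hβv : β * v ≡ 1 [MOD p]) (hv : v ≤ p) (hq2 : p * p ≤ q)
    (hβ : 2 * β + 1 < p) (h1 : p ≤ β + v) (h2 : v ≤ 2 * β) :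
    ∃ r : ℕ, r.Prime ∧ q < r ∧ p - β ≤ cycHeight (p * q * r) := by
  obtain ⟨u, hu, huv⟩ := exists_mul_add_mul_eq hp hq.pos hqβ hβv (by omega) hv
  obtain ⟨t, ht⟩ : ∃ t, p = t + β + 1 := ⟨p - β - 1, by omega⟩
  obtain ⟨w, hw⟩ : ∃ w, p = v + w := ⟨p - v, by omega⟩
  have hwβ : w ≤ β := by omega
  have hpt : 0 < p * t := Nat.mul_pos hp.pos (by omega)
  have hu' : p * u = q * w + 1 := by
    have : p * q = q * v + q * w := by rw [← mul_add, ← hw, mul_comm]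
    omega
  have hptq : p * t ≤ q := (Nat.mul_le_mul_left p (by omega)).trans hq2
  set k := q * w / (p * t) with hk
  have hk1 : k * (p * t) ≤ q * w := Nat.div_mul_le_self _ _
  have hk2 : q * w < k * (p * t) + p * t := by
    have := Nat.lt_div_mul_add (a := q * w) hpt
    exact this
  have hk3 : (p - 2 * β - 1) * q < k * p * t := by
    have : p - 2 * β - 1 + 1 ≤ w := by omega
    have h3 := Nat.mul_le_mul_left q this
    have h4 : q * (p - 2 * β - 1 + 1) = (p - 2 * β - 1) * q + q := by ring
    have h5 : k * (p * t) = k * p * t := by ring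
    omega
  have hk0 : 0 < k := by
    rcases Nat.eq_zero_or_pos k with h | h
    · rw [h] at hk3; simp at hk3
    · exact h
  have hkq : k * p < q := by
    have h3 : q * w < q * t := Nat.mul_lt_mul_of_pos_left (by omega) hq.pos
    exact Nat.lt_of_mul_lt_mul_right (a := t) (by nlinarith)
  have ht' : p - β - 1 = t := by omega
  obtain ⟨r, hr, hqr, n, hn⟩ := exists_prime_coeff_cyclotomic_mul_three hp hq hk0 hkq
    ((p - β - 1) * q) ((p * (k * (p - β - 1)) : ℕ) : ZMod (p * q))
  rw [hqβ, sum_truncCoeff_of_le_add hp hq huv hu hv hkq hβ h1 hk0 (by rwa [ht'])] at hn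
  · refine ⟨r, hr, hqr, ?_⟩
    have := natAbs_coeff_le_cycHeight (p * q * r) n
    rwa [hn, Int.natAbs_natCast] at this
  · rw [ht']
    exact Nat.lt_of_mul_lt_mul_left (a := p) (by nlinarith)
  · have h3 : β * (k * p) < β * q := Nat.mul_lt_mul_of_pos_left hkq (by omega)
    have h4 : q * β ≤ q * v := Nat.mul_le_mul_left q (by omega)
    refine Nat.le_of_mul_le_mul_left (c := p) ?_ hp.pos
    have : p * q = q * v + q * w := by rw [← mul_add, ← hw, mul_comm]
    nlinarith

lemma exists_prime_le_cycHeight_of_add_lt {p q v β : ℕ} (hp : p.Prime) (hq : q.Prime)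
    (hqβ : q % p = β) (hβv : β * v ≡ 1 [MOD p]) (hv : 0 < v) (hq2 : p * p ≤ q)
    (hβ : 2 * β + 1 < p) (h1 : v < β) (h2 : p < β + 2 * v) :
    ∃ r : ℕ, r.Prime ∧ q < r ∧ p - β ≤ cycHeight (p * q * r) := by
  obtain ⟨u, hu, huv⟩ := exists_mul_add_mul_eq hp hq.pos hqβ hβv hv (by omega)
  obtain ⟨w, hw⟩ : ∃ w, p = v + w := ⟨p - v, by omega⟩
  have hw' : p - v = w := by omega
  have hpw : 0 < p * w := Nat.mul_pos hp.pos (by omega)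
  have hu' : p * u = q * w + 1 := by
    have : p * q = q * v + q * w := by rw [← mul_add, ← hw, mul_comm]
    omega
  have hqv : 0 < q * v := Nat.mul_pos hq.pos hv
  have hpwq : p * w ≤ q := (Nat.mul_le_mul_left p (by omega)).trans hq2
  set k := (q * v - 1) / (p * w) with hk
  have hk1 : k * (p * w) ≤ q * v - 1 := Nat.div_mul_le_self _ _
  have hk2 : q * v - 1 < k * (p * w) + p * w := Nat.lt_div_mul_add hpw
  have h5 : k * (p * w) = k * p * w := by ring
  have hk3 : (p - v - β) * q ≤ k * p * w := by
    have : p - v - β + 1 ≤ v := by omega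
    have h3 := Nat.mul_le_mul_left q this
    have h4 : q * (p - v - β + 1) = (p - v - β) * q + q := by ring
    omega
  have hk0 : 0 < k := by
    rcases Nat.eq_zero_or_pos k with h | h
    · rw [h, zero_mul, zero_mul, Nat.le_zero, mul_eq_zero] at hk3
      have := hq.pos
      omega
    · exact h
  have hvw : q * v < q * w := Nat.mul_lt_mul_of_pos_left (by omega) hq.pos
  have hkq : k * p < q := Nat.lt_of_mul_lt_mul_right (a := w) (by omega)
  obtain ⟨r, hr, hqr, n, hn⟩ := exists_prime_coeff_cyclotomic_mul_three hp hq hk0 hkq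
    ((v - 1) * q) ((p * (k * (v - 1)) + q * (p - β) : ℕ) : ZMod (p * q))
  rw [hqβ, sum_truncCoeff_of_add_lt hp hq huv hu hkq hk0 hv hβ h1
    (by rw [hw'] at hk3 ⊢; exact hk3)] at hn
  · refine ⟨r, hr, hqr, ?_⟩
    have := natAbs_coeff_le_cycHeight (p * q * r) n
    rwa [hn, Int.natAbs_neg, Int.natAbs_natCast] at this
  · refine Nat.lt_of_mul_lt_mul_left (a := p) ?_
    have : k * (p * (v - 1)) ≤ k * (p * w) :=
      Nat.mul_le_mul_left k (Nat.mul_le_mul_left p (by omega))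
    have h6 : p * (k * (v - 1)) = k * (p * (v - 1)) := by ring
    omega
  · rw [hw']
    refine Nat.le_of_mul_le_mul_left (c := p) ?_ hp.pos
    have h6 : p * (u + k * w) = p * u + k * (p * w) := by ring
    have : p * q = q * v + q * w := by rw [← mul_add, ← hw, mul_comm]
    omega

section

open MeasureTheory Filter Topology

/-- The Fejér kernel on the real line. -/
noncomputable def fejerKernel (u : ℝ) : ℝ := 2 * (1 - Real.cos u) / u ^ 2

lemma fejerKernel_nonneg (u : ℝ) : 0 ≤ fejerKernel u :=
  div_nonneg (by linarith [Real.cos_le_one u]) (sq_nonneg u)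

lemma measurable_fejerKernel : Measurable fejerKernel := by
  unfold fejerKernel; fun_prop

lemma fejerKernel_le (u : ℝ) : fejerKernel u ≤ 5 * (1 + u ^ 2)⁻¹ := by
  rw [fejerKernel, ← div_eq_mul_inv]
  rcases eq_or_ne u 0 with rfl | hu
  · norm_num
  · have : 0 < u ^ 2 := by positivity
    rw [div_le_div_iff₀ this (by positivity)]
    nlinarith [Real.one_sub_sq_div_two_le_cos (x := u), Real.neg_one_le_cos u]

lemma integrable_fejerKernel : Integrable fejerKernel :=
  (integrable_inv_one_add_sq.const_mul 5).mono' measurable_fejerKernel.aestronglyMeasurable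
    (Eventually.of_forall fun u => by
      rw [Real.norm_of_nonneg (fejerKernel_nonneg u)]; exact fejerKernel_le u)

lemma integral_fejerKernel_pos : 0 < ∫ u, fejerKernel u := by
  rw [integral_pos_iff_support_of_nonneg fejerKernel_nonneg integrable_fejerKernel]
  have : Set.Ioo (0 : ℝ) 1 ⊆ Function.support fejerKernel := by
    intro u hu
    have := Real.cos_lt_cos_of_nonneg_of_le_pi le_rfl
      (hu.2.le.trans (by linarith [Real.pi_gt_three])) hu.1
    rw [Real.cos_zero] at this
    exact (div_pos (by linarith) (pow_pos hu.1 2)).ne'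
  exact lt_of_lt_of_le (by simp) (measure_mono this)

lemma integral_one_sub_abs_mul_exp {u : ℝ} (hu : u ≠ 0) :
    ∫ s in (-1 : ℝ)..1, ((1 - |s| : ℝ) : ℂ) * Complex.exp (s * u * Complex.I) =
      (fejerKernel u : ℂ) := by
  set c : ℂ := u * Complex.I with hc
  have hc0 : c ≠ 0 := mul_ne_zero (by exact_mod_cast hu) Complex.I_ne_zero
  have hinteg (a b : ℝ) : IntervalIntegrable
      (fun s : ℝ => ((1 - |s| : ℝ) : ℂ) * Complex.exp (s * u * Complex.I)) volume a b := by
    apply Continuous.intervalIntegrable; fun_prop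
  have hexp (s : ℝ) :
      HasDerivAt (fun s : ℝ => Complex.exp (s * c)) (Complex.exp (s * c) * c) s := by
    have := ((hasDerivAt_id (s : ℂ)).mul_const c).cexp.comp_ofReal
    simpa using this
  have h1 : ∫ s in (-1 : ℝ)..0, ((1 - |s| : ℝ) : ℂ) * Complex.exp (s * u * Complex.I) =
      1 / c - 1 / c ^ 2 + Complex.exp (-c) / c ^ 2 := by
    have hd (s : ℝ) : HasDerivAt (fun s : ℝ => ((1 + s) / c - 1 / c ^ 2) * Complex.exp (s * c))
        ((1 + s) * Complex.exp (s * c)) s := by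
      have h :=
        ((((hasDerivAt_id (s : ℂ)).const_add 1).div_const c).sub_const (1 / c ^ 2)).comp_ofReal
      refine (h.mul (hexp s)).congr_deriv ?_
      simp only [id]
      field_simp
      ring
    rw [intervalIntegral.integral_congr (g := fun s : ℝ => (1 + s) * Complex.exp (s * c)),
      intervalIntegral.integral_eq_sub_of_hasDerivAt (fun s _ => hd s)]
    · simp; ring
    · apply Continuous.intervalIntegrable; fun_prop
    · intro s hs
      rw [Set.uIcc_of_le (by norm_num)] at hs
      simp only [abs_of_nonpos hs.2, hc]
      push_cast; ring_nf
  have h2 : ∫ s in (0 : ℝ)..1, ((1 - |s| : ℝ) : ℂ) * Complex.exp (s * u * Complex.I) =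
      Complex.exp c / c ^ 2 - 1 / c - 1 / c ^ 2 := by
    have hd (s : ℝ) : HasDerivAt (fun s : ℝ => ((1 - s) / c + 1 / c ^ 2) * Complex.exp (s * c))
        ((1 - s) * Complex.exp (s * c)) s := by
      have h :=
        ((((hasDerivAt_id (s : ℂ)).const_sub 1).div_const c).add_const (1 / c ^ 2)).comp_ofReal
      refine (h.mul (hexp s)).congr_deriv ?_
      simp only [id]
      field_simp
      ring
    rw [intervalIntegral.integral_congr (g := fun s : ℝ => (1 - s) * Complex.exp (s * c)),
      intervalIntegral.integral_eq_sub_of_hasDerivAt (fun s _ => hd s)]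
    · simp; ring
    · apply Continuous.intervalIntegrable; fun_prop
    · intro s hs
      rw [Set.uIcc_of_le (by norm_num)] at hs
      simp only [abs_of_nonneg hs.1, hc]
      push_cast; ring_nf
  rw [← intervalIntegral.integral_add_adjacent_intervals (hinteg (-1) 0) (hinteg 0 1), h1, h2,
    fejerKernel]
  have h3 : Complex.exp c + Complex.exp (-c) = 2 * Complex.cos u := by
    rw [Complex.cos, hc]; ring_nf
  have h4 : c ^ 2 = -(u : ℂ) ^ 2 := by rw [hc, mul_pow, Complex.I_sq]; ring
  have hu' : (u : ℂ) ≠ 0 := by exact_mod_cast hu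
  have h5 (x y : ℂ) : 1 / c - 1 / c ^ 2 + y / c ^ 2 + (x / c ^ 2 - 1 / c - 1 / c ^ 2) =
      (x + y - 2) / c ^ 2 := by ring
  rw [h5, h3, h4]
  push_cast
  field_simp
  ring

lemma integral_mul_fejerKernel {f : ℝ → ℂ} (hf : Integrable f) {l : ℝ} (hl : 0 < l) (y : ℝ) :
    ∫ u, f (y - u / l) * (fejerKernel u : ℂ) =
      l * ∫ s in (-1 : ℝ)..1, ((1 - |s| : ℝ) : ℂ) * Complex.exp (s * l * y * Complex.I) *
        ∫ t, f t * Complex.exp (-(s * l * t * Complex.I)) := by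
  have hf' : Integrable fun u => f (y - u / l) :=
    (hf.comp_sub_left y).comp_div hl.ne'
  have hg : Integrable (fun s : ℝ => ((1 - |s| : ℝ) : ℂ)) (volume.restrict (Set.Ioc (-1) 1)) := by
    apply Continuous.integrableOn_Ioc; fun_prop
  have hinteg : Integrable (Function.uncurry fun u s : ℝ =>
      f (y - u / l) * (((1 - |s| : ℝ) : ℂ) * Complex.exp (s * u * Complex.I)))
      (volume.prod (volume.restrict (Set.Ioc (-1) 1))) := by
    have := (hf'.mul_prod hg).mul_bdd (c := 1)
      (g := fun z : ℝ × ℝ => Complex.exp (z.2 * z.1 * Complex.I))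
      (by fun_prop) (Eventually.of_forall fun z => by
        rw [← Complex.ofReal_mul, Complex.norm_exp_ofReal_mul_I])
    refine this.congr (Eventually.of_forall fun z => ?_)
    simp only [Function.uncurry, mul_assoc]
  calc ∫ u, f (y - u / l) * (fejerKernel u : ℂ)
      = ∫ u, ∫ s in Set.Ioc (-1 : ℝ) 1,
          f (y - u / l) * (((1 - |s| : ℝ) : ℂ) * Complex.exp (s * u * Complex.I)) := by
        refine integral_congr_ae ?_
        filter_upwards [compl_mem_ae_iff.2 (measure_singleton (0 : ℝ))] with u hu
        rw [integral_const_mul, ← intervalIntegral.integral_of_le (by norm_num),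
          integral_one_sub_abs_mul_exp hu]
    _ = ∫ s in Set.Ioc (-1 : ℝ) 1, ∫ u,
          f (y - u / l) * (((1 - |s| : ℝ) : ℂ) * Complex.exp (s * u * Complex.I)) :=
        integral_integral_swap hinteg
    _ = _ := by
        rw [intervalIntegral.integral_of_le (by norm_num), ← integral_const_mul]
        refine integral_congr_ae (Eventually.of_forall fun s => ?_)
        have h1 := Measure.integral_comp_div (fun v => (fun t =>
          f t * (((1 - |s| : ℝ) : ℂ) * Complex.exp (s * (l * (y - t)) * Complex.I))) (y - v)) l
        rw [integral_sub_left_eq_self (fun t =>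
          f t * (((1 - |s| : ℝ) : ℂ) * Complex.exp (s * (l * (y - t)) * Complex.I))) volume y] at h1
        have hl' : (l : ℂ) ≠ 0 := by exact_mod_cast hl.ne'
        simp only
        rw [abs_of_pos hl, Complex.real_smul] at h1
        rw [← integral_const_mul]
        trans l * ∫ t, f t * (((1 - |s| : ℝ) : ℂ) * Complex.exp (s * (l * (y - t)) * Complex.I))
        · rw [← h1]
          refine integral_congr_ae (Eventually.of_forall fun u => ?_)
          simp only
          congr 3
          push_cast
          field_simp
          ring_nf
        · congr 1
          refine integral_congr_ae (Eventually.of_forall fun t => ?_)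
          simp only
          rw [show (s * (l * (y - t)) * Complex.I : ℂ) =
            s * l * y * Complex.I + -(s * l * t * Complex.I) by ring, Complex.exp_add]
          ring

lemma tendsto_integral_mul_fejerKernel {F : ℝ → ℝ} {C : ℝ} {H : ℂ → ℂ} (hF : Measurable F)
    (hF0 : ∀ t < 0, F t = 0) (hFC : ∀ t, |F t| ≤ C) (hH : ContinuousOn H {z | 0 ≤ z.re})
    (hFH : ∀ z : ℂ, 0 < z.re → ∫ t, (F t : ℂ) * Complex.exp (-(z * t)) = H z)
    {l : ℝ} (hl : 0 < l) :
    Tendsto (fun y => ∫ u, F (y - u / l) * fejerKernel u) atTop (𝓝 0) := by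
  have hbound (ε t : ℝ) (hε : 0 < ε) :
      ‖(F t : ℂ) * Complex.exp (-(ε * t))‖ ≤ C := by
    rw [norm_mul, Complex.norm_real, ← Complex.ofReal_mul, ← Complex.ofReal_neg,
      Complex.norm_exp_ofReal, Real.norm_eq_abs]
    rcases lt_or_ge t 0 with h | h
    · rw [hF0 t h]; simpa using (abs_nonneg _).trans (hFC 0)
    · refine (mul_le_of_le_one_right (abs_nonneg _) ?_).trans (hFC t)
      exact Real.exp_le_one_iff.2 (by nlinarith)
  have hinteg (ε : ℝ) (hε : 0 < ε) :
      Integrable fun t : ℝ => (F t : ℂ) * Complex.exp (-(ε * t)) := by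
    have h1 : IntegrableOn (fun t : ℝ => C * Real.exp (-ε * t)) (Set.Ici 0) := by
      rw [integrableOn_Ici_iff_integrableOn_Ioi]
      exact (integrableOn_exp_mul_Ioi (by linarith) 0).const_mul C
    rw [← integrable_indicator_iff measurableSet_Ici] at h1
    refine h1.mono' (by fun_prop) (Eventually.of_forall fun t => ?_)
    rcases lt_or_ge t 0 with h | h
    · rw [hF0 t h, Set.indicator_of_notMem (by simpa using h)]; simp
    · rw [Set.indicator_of_mem (by simpa using h), norm_mul, Complex.norm_real,
        ← Complex.ofReal_mul, ← Complex.ofReal_neg, Complex.norm_exp_ofReal, Real.norm_eq_abs,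
        neg_mul]
      exact mul_le_mul_of_nonneg_right (hFC t) (Real.exp_pos _).le
  have hstep (ε y : ℝ) (hε : 0 < ε) :
      ∫ u, (F (y - u / l) : ℂ) * Complex.exp (-(ε * (y - u / l : ℝ))) * (fejerKernel u : ℂ) =
      l * ∫ s in (-1 : ℝ)..1, ((1 - |s| : ℝ) : ℂ) * Complex.exp (s * l * y * Complex.I) *
        H (ε + s * l * Complex.I) := by
    rw [integral_mul_fejerKernel (f := fun t : ℝ => (F t : ℂ) * Complex.exp (-(ε * t)))
      (hinteg ε hε) hl y]
    congr 1
    refine intervalIntegral.integral_congr fun s _ => ?_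
    rw [← hFH _ (by simpa using hε)]
    congr 1
    refine integral_congr_ae (Eventually.of_forall fun t => ?_)
    simp only
    rw [mul_assoc, ← Complex.exp_add]
    ring_nf
  have hmem (ε s : ℝ) (hε : 0 ≤ ε) : (ε + s * l * Complex.I : ℂ) ∈ {z : ℂ | 0 ≤ z.re} := by
    simpa using hε
  have hzero (y : ℝ) : ((∫ u, F (y - u / l) * fejerKernel u : ℝ) : ℂ) =
      l * ∫ s in (-1 : ℝ)..1, ((1 - |s| : ℝ) : ℂ) * Complex.exp (s * l * y * Complex.I) *
        H (s * l * Complex.I) := by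
    have hL : Tendsto (fun ε : ℝ => ∫ u, (F (y - u / l) : ℂ) *
        Complex.exp (-(ε * (y - u / l : ℝ))) * (fejerKernel u : ℂ)) (𝓝[>] 0)
        (𝓝 ((∫ u, F (y - u / l) * fejerKernel u : ℝ) : ℂ)) := by
      rw [← integral_complex_ofReal]
      refine tendsto_integral_filter_of_dominated_convergence (fun u => C * fejerKernel u)
        ?_ ?_ (integrable_fejerKernel.const_mul C) (Eventually.of_forall fun u => ?_)
      · have := measurable_fejerKernel
        exact Eventually.of_forall fun ε => by fun_prop
      · filter_upwards [self_mem_nhdsWithin] with ε hε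
        refine Eventually.of_forall fun u => ?_
        rw [norm_mul, Complex.norm_real, Real.norm_of_nonneg (fejerKernel_nonneg u)]
        exact mul_le_mul_of_nonneg_right (hbound ε _ hε) (fejerKernel_nonneg u)
      · have : Continuous fun ε : ℝ => (F (y - u / l) : ℂ) *
            Complex.exp (-(ε * (y - u / l : ℝ))) * (fejerKernel u : ℂ) := by fun_prop
        simpa using (this.tendsto 0).mono_left nhdsWithin_le_nhds
    have hR : Tendsto (fun ε : ℝ => l * ∫ s in (-1 : ℝ)..1, ((1 - |s| : ℝ) : ℂ) *
        Complex.exp (s * l * y * Complex.I) * H (ε + s * l * Complex.I)) (𝓝[>] 0)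
        (𝓝 (l * ∫ s in (-1 : ℝ)..1, ((1 - |s| : ℝ) : ℂ) * Complex.exp (s * l * y * Complex.I) *
          H (s * l * Complex.I))) := by
      have hcont : ContinuousOn (fun x : ℝ × ℝ => ((1 - |x.2| : ℝ) : ℂ) *
          Complex.exp (x.2 * l * y * Complex.I) * H (x.1 + x.2 * l * Complex.I))
          (Set.Icc 0 1 ×ˢ Set.Icc (-1) 1) :=
        ContinuousOn.mul (by fun_prop)
          (hH.comp (by fun_prop) fun x hx => hmem _ _ hx.1.1)
      obtain ⟨M, hM⟩ := (isCompact_Icc.prod isCompact_Icc).exists_bound_of_continuousOn hcont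
      refine Tendsto.const_mul _ ?_
      refine intervalIntegral.tendsto_integral_filter_of_dominated_convergence (fun _ => M)
        ?_ ?_ intervalIntegrable_const (Eventually.of_forall fun s hs => ?_)
      · filter_upwards [Ioc_mem_nhdsGT (zero_lt_one (α := ℝ))] with ε hε
        rw [Set.uIoc_of_le (by norm_num)]
        have h2 : ContinuousOn (fun s : ℝ => ((1 - |s| : ℝ) : ℂ) *
          Complex.exp (s * l * y * Complex.I) * H (ε + s * l * Complex.I)) (Set.Ioc (-1) 1) :=
          hcont.comp (f := fun s => (ε, s)) (by fun_prop)
            fun s hs => ⟨⟨hε.1.le, hε.2⟩, ⟨hs.1.le, hs.2⟩⟩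
        exact h2.aestronglyMeasurable measurableSet_Ioc
      · filter_upwards [Ioc_mem_nhdsGT (zero_lt_one (α := ℝ))] with ε hε
        refine Eventually.of_forall fun s hs => ?_
        rw [Set.uIoc_of_le (by norm_num)] at hs
        exact hM (ε, s) ⟨⟨hε.1.le, hε.2⟩, ⟨hs.1.le, hs.2⟩⟩
      · refine Tendsto.const_mul _ ?_
        have h1 := hH _ (hmem 0 s le_rfl)
        have h2 : Tendsto (fun ε : ℝ => (ε + s * l * Complex.I : ℂ)) (𝓝[>] 0)
            (𝓝[{z : ℂ | 0 ≤ z.re}] ((0 : ℝ) + s * l * Complex.I)) := by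
          refine tendsto_nhdsWithin_iff.2 ⟨?_, ?_⟩
          · have : Continuous fun ε : ℝ => (ε + s * l * Complex.I : ℂ) := by fun_prop
            exact (this.tendsto 0).mono_left nhdsWithin_le_nhds
          · filter_upwards [self_mem_nhdsWithin] with ε hε using hmem ε s (le_of_lt hε)
        have h3 := h1.tendsto.comp h2
        simpa [Function.comp_def] using h3
    refine tendsto_nhds_unique (hL.congr' ?_) hR
    filter_upwards [self_mem_nhdsWithin] with ε hε using hstep ε y hε
  have hRL : Tendsto (fun y : ℝ => ∫ s in (-1 : ℝ)..1, ((1 - |s| : ℝ) : ℂ) *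
      Complex.exp (s * l * y * Complex.I) * H (s * l * Complex.I)) atTop (𝓝 0) := by
    have h1 := Real.tendsto_integral_exp_smul_cocompact ((Set.Ioc (-1 : ℝ) 1).indicator
      fun s : ℝ => ((1 - |s| : ℝ) : ℂ) * H (s * l * Complex.I))
    have h2 : Tendsto (fun y : ℝ => -(l / (2 * Real.pi)) * y) atTop (cocompact ℝ) :=
      (tendsto_id.const_mul_atTop_of_neg
        (neg_lt_zero.2 (div_pos hl Real.two_pi_pos))).mono_right atBot_le_cocompact
    refine (h1.comp h2).congr fun y => ?_
    rw [intervalIntegral.integral_of_le (by norm_num), ← integral_indicator measurableSet_Ioc]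
    refine integral_congr_ae (Eventually.of_forall fun s => ?_)
    simp only
    by_cases hs : s ∈ Set.Ioc (-1 : ℝ) 1
    · rw [Set.indicator_of_mem hs, Set.indicator_of_mem hs, Circle.smul_def,
        Real.fourierChar_apply, smul_eq_mul]
      have : ((2 * Real.pi * -(s * (-(l / (2 * Real.pi)) * y)) : ℝ) : ℂ) * Complex.I =
          s * l * y * Complex.I := by
        have := Real.pi_ne_zero
        have h : 2 * Real.pi * -(s * (-(l / (2 * Real.pi)) * y)) = s * l * y := by
          field_simp
        rw [h]; push_cast; ring
      rw [this]
      ring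
    · rw [Set.indicator_of_notMem hs, Set.indicator_of_notMem hs, smul_zero]
  have hfin : Tendsto (fun y => ((∫ u, F (y - u / l) * fejerKernel u : ℝ) : ℂ)) atTop
      (𝓝 ((0 : ℝ) : ℂ)) := by
    simp only [hzero]
    simpa using hRL.const_mul (l : ℂ)
  exact (Complex.continuous_re.tendsto _).comp hfin |>.congr fun y => Complex.ofReal_re _

/-- A Tauberian theorem of Wiener–Ikehara type, in additive form. -/
theorem tendsto_of_integral_mul_exp_eq {B : ℝ → ℝ} {A C : ℝ} {H : ℂ → ℂ}
    (hB : Monotone fun t => Real.exp t * B t) (hB0 : ∀ t < 0, B t = 0)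
    (hBnn : ∀ t, 0 ≤ B t) (hBC : ∀ t, B t ≤ C) (hH : ContinuousOn H {z | 0 ≤ z.re})
    (hHB : ∀ z : ℂ, 0 < z.re →
      ∫ t, ((B t - (Set.Ici 0).indicator (fun _ => A) t : ℝ) : ℂ) * Complex.exp (-(z * t)) = H z) :
    Tendsto B atTop (𝓝 A) := by
  have hBm : Measurable B := by
    have : B = fun t => Real.exp (-t) * (Real.exp t * B t) := by
      ext t; rw [← mul_assoc, ← Real.exp_add]; simp
    rw [this]
    exact (by fun_prop : Measurable fun t : ℝ => Real.exp (-t)).mul hB.measurable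
  set κ := ∫ u, fejerKernel u with hκ
  have hκ0 : 0 < κ := integral_fejerKernel_pos
  have hm := measurable_fejerKernel
  have hintB (l y : ℝ) : Integrable fun u => B (y - u / l) * fejerKernel u :=
    integrable_fejerKernel.bdd_mul (c := C) (hBm.comp (by fun_prop)).aestronglyMeasurable
      (Eventually.of_forall fun u => by rw [Real.norm_of_nonneg (hBnn _)]; exact hBC _)
  have hindm : Measurable ((Set.Ici (0 : ℝ)).indicator fun _ => A) :=
    measurable_const.indicator measurableSet_Ici
  have hindb (t : ℝ) : |(Set.Ici (0 : ℝ)).indicator (fun _ => A) t| ≤ |A| := by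
    by_cases h : t ∈ Set.Ici (0 : ℝ)
    · rw [Set.indicator_of_mem h]
    · rw [Set.indicator_of_notMem h]; simp
  have hlim {l : ℝ} (hl : 0 < l) :
      Tendsto (fun y => ∫ u, B (y - u / l) * fejerKernel u) atTop (𝓝 (A * κ)) := by
    have h1 := tendsto_integral_mul_fejerKernel (C := C + |A|) (hBm.sub hindm)
      (fun t ht => by simp [hB0 t ht, ht])
      (fun t => (abs_sub _ _).trans (add_le_add
        ((abs_of_nonneg (hBnn t)).trans_le (hBC t)) (hindb t))) hH hHB hl
    have h2 : Tendsto (fun y => ∫ u, (Set.Ici (0 : ℝ)).indicator (fun _ => A) (y - u / l) *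
        fejerKernel u) atTop (𝓝 (A * κ)) := by
      rw [hκ, ← integral_const_mul]
      refine tendsto_integral_filter_of_dominated_convergence (fun u => |A| * fejerKernel u)
        (Eventually.of_forall fun y => ?_) (Eventually.of_forall fun y => ?_)
        (integrable_fejerKernel.const_mul _) (Eventually.of_forall fun u => ?_)
      · exact ((hindm.comp (by fun_prop)).mul hm).aestronglyMeasurable
      · refine Eventually.of_forall fun u => ?_
        rw [norm_mul, Real.norm_of_nonneg (fejerKernel_nonneg u)]
        exact mul_le_mul_of_nonneg_right (hindb _) (fejerKernel_nonneg u)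
      · refine tendsto_const_nhds.congr' ?_
        filter_upwards [eventually_ge_atTop (u / l)] with y hy
        rw [Set.indicator_of_mem (by simpa using hy)]
    refine ((h1.add h2).congr fun y => ?_).trans (by rw [zero_add])
    rw [← integral_add]
    · refine integral_congr_ae (Eventually.of_forall fun u => ?_)
      simp only [Pi.sub_apply]
      ring
    · refine integrable_fejerKernel.bdd_mul (c := C + |A|) ?_ (Eventually.of_forall fun u =>
        (abs_sub _ _).trans (add_le_add ((abs_of_nonneg (hBnn _)).trans_le (hBC _)) (hindb _)))
      exact ((hBm.sub hindm).comp (by fun_prop)).aestronglyMeasurable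
    · refine integrable_fejerKernel.bdd_mul (c := |A|) ?_ (Eventually.of_forall fun u => hindb _)
      exact (hindm.comp (by fun_prop)).aestronglyMeasurable
  have hle (s t : ℝ) (hst : s ≤ t) : B s ≤ Real.exp (t - s) * B t := by
    have := hB hst
    rw [Real.exp_sub, div_mul_eq_mul_div, le_div_iff₀ (Real.exp_pos _), mul_comm]
    exact this
  have hwindow {δ : ℝ} (hδ : 0 < δ) : ∃ R > 0, κ * (1 - δ) ≤
      ∫ u, (Set.Ioc (-R) R).indicator fejerKernel u := by
    have h := intervalIntegral_tendsto_integral integrable_fejerKernel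
      tendsto_neg_atTop_atBot tendsto_id
    have h2 := (h.eventually (lt_mem_nhds (show κ * (1 - δ) < κ by nlinarith))).and
      (eventually_gt_atTop 0)
    obtain ⟨R, hR, hR0⟩ := h2.exists
    refine ⟨R, hR0, ?_⟩
    rw [integral_indicator measurableSet_Ioc, ← intervalIntegral.integral_of_le (by linarith)]
    exact hR.le
  have hindI (R : ℝ) : Integrable ((Set.Ioc (-R) R).indicator fejerKernel) :=
    integrable_fejerKernel.indicator measurableSet_Ioc
  have habs {δ R u : ℝ} (hδ : 0 < δ) (hR : 0 < R) (hu : u ∈ Set.Ioc (-R) R) :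
      |u / (R / δ)| ≤ δ := by
    rw [abs_div, abs_of_pos (div_pos hR hδ), div_le_iff₀ (div_pos hR hδ), mul_div_cancel₀ _ hδ.ne']
    exact abs_le.2 ⟨hu.1.le, hu.2⟩
  refine tendsto_order.2 ⟨fun a ha => ?_, fun a ha => ?_⟩
  · obtain ⟨δ, hδA, hδ⟩ : ∃ δ : ℝ, a * Real.exp (2 * δ) + C * δ < A ∧ 0 < δ := by
      have hc : Continuous fun δ : ℝ => a * Real.exp (2 * δ) + C * δ := by fun_prop
      have := (hc.tendsto 0).eventually (gt_mem_nhds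
        (show a * Real.exp (2 * 0) + C * 0 < A by simpa using ha))
      exact ((this.filter_mono nhdsWithin_le_nhds).and
        (self_mem_nhdsWithin (s := Set.Ioi 0))).exists
    obtain ⟨R, hR, hRκ⟩ := hwindow hδ
    have hl := (hlim (div_pos hR hδ)).comp (tendsto_atTop_add_const_right atTop (-δ) tendsto_id)
    filter_upwards [hl.eventually (lt_mem_nhds (mul_lt_mul_of_pos_right hδA hκ0))] with y hy
    have hC : 0 ≤ C := (hBnn 0).trans (hBC 0)
    have h1 : ∫ u, B (y + -δ - u / (R / δ)) * fejerKernel u ≤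
        ∫ u, (B y * Real.exp (2 * δ) * (Set.Ioc (-R) R).indicator fejerKernel u +
          C * (fejerKernel u - (Set.Ioc (-R) R).indicator fejerKernel u)) := by
      refine integral_mono (hintB _ _) (((hindI R).const_mul _).add
        ((integrable_fejerKernel.sub (hindI R)).const_mul C)) fun u => ?_
      simp only
      by_cases hu : u ∈ Set.Ioc (-R) R
      · rw [Set.indicator_of_mem hu, sub_self, mul_zero, add_zero]
        refine mul_le_mul_of_nonneg_right ?_ (fejerKernel_nonneg u)
        have h3 := abs_le.1 (habs hδ hR hu)
        refine (hle _ y (by linarith [h3.1])).trans ?_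
        rw [mul_comm]
        exact mul_le_mul_of_nonneg_left (Real.exp_le_exp.2 (by linarith [h3.2])) (hBnn y)
      · rw [Set.indicator_of_notMem hu, mul_zero, zero_add, sub_zero]
        exact mul_le_mul_of_nonneg_right (hBC _) (fejerKernel_nonneg u)
    have hinteg : Integrable fun u =>
        C * (fejerKernel u - (Set.Ioc (-R) R).indicator fejerKernel u) :=
      (integrable_fejerKernel.sub (hindI R)).const_mul C
    rw [integral_add ((hindI R).const_mul _) hinteg, integral_const_mul,
      integral_const_mul, integral_sub integrable_fejerKernel (hindI R), ← hκ] at h1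
    set J := ∫ u, (Set.Ioc (-R) R).indicator fejerKernel u
    have hJ : J ≤ κ := integral_mono (hindI R) integrable_fejerKernel
      (Set.indicator_le_self' fun u _ => fejerKernel_nonneg u)
    have h2 : (a * Real.exp (2 * δ) + C * δ) * κ <
      B y * Real.exp (2 * δ) * J + C * (κ - J) := hy.trans_le h1
    have h3 : B y * Real.exp (2 * δ) * J ≤ B y * Real.exp (2 * δ) * κ :=
      mul_le_mul_of_nonneg_left hJ (mul_nonneg (hBnn y) (Real.exp_pos _).le)
    have h4 : C * (κ - J) ≤ C * (κ * δ) := mul_le_mul_of_nonneg_left (by linarith) hC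
    have h5 : a * (Real.exp (2 * δ) * κ) < B y * (Real.exp (2 * δ) * κ) := by linarith
    exact lt_of_mul_lt_mul_right h5 (by positivity)
  · obtain ⟨δ, ⟨hδA, hδ1⟩, hδ⟩ : ∃ δ : ℝ, (A * Real.exp (2 * δ) < a * (1 - δ) ∧ δ < 1) ∧ 0 < δ := by
      have hc : Continuous fun δ : ℝ => a * (1 - δ) - A * Real.exp (2 * δ) := by fun_prop
      have h1 := (hc.tendsto 0).eventually (lt_mem_nhds (a := 0) (by simpa using ha))
      have h2 := gt_mem_nhds (zero_lt_one (α := ℝ))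
      have h3 := (((h1.and h2).filter_mono nhdsWithin_le_nhds).and
        (self_mem_nhdsWithin (s := Set.Ioi (0 : ℝ)))).exists
      exact h3.imp fun δ h => ⟨⟨by linarith [h.1.1], h.1.2⟩, h.2⟩
    obtain ⟨R, hR, hRκ⟩ := hwindow hδ
    have hl := (hlim (div_pos hR hδ)).comp (tendsto_atTop_add_const_right atTop δ tendsto_id)
    have hA : A * κ < a * (1 - δ) * Real.exp (-(2 * δ)) * κ := by
      refine mul_lt_mul_of_pos_right ?_ hκ0
      rw [Real.exp_neg, ← div_eq_mul_inv, lt_div_iff₀ (Real.exp_pos _)]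
      exact hδA
    filter_upwards [hl.eventually (gt_mem_nhds hA)] with y hy
    have h1 : ∫ u, B y * Real.exp (-(2 * δ)) * (Set.Ioc (-R) R).indicator fejerKernel u ≤
        ∫ u, B (y + δ - u / (R / δ)) * fejerKernel u := by
      refine integral_mono ((hindI R).const_mul _) (hintB _ _) fun u => ?_
      simp only
      by_cases hu : u ∈ Set.Ioc (-R) R
      · rw [Set.indicator_of_mem hu]
        refine mul_le_mul_of_nonneg_right ?_ (fejerKernel_nonneg u)
        have h3 := abs_le.1 (habs hδ hR hu)
        rw [Real.exp_neg, ← div_eq_mul_inv, div_le_iff₀ (Real.exp_pos _), mul_comm]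
        refine (hle y (y + δ - u / (R / δ)) (by linarith [h3.2])).trans ?_
        exact mul_le_mul_of_nonneg_right (Real.exp_le_exp.2 (by linarith [h3.1])) (hBnn _)
      · rw [Set.indicator_of_notMem hu, mul_zero]
        exact mul_nonneg (hBnn _) (fejerKernel_nonneg u)
    rw [integral_const_mul] at h1
    have h2 : B y * Real.exp (-(2 * δ)) * (κ * (1 - δ)) ≤
        B y * Real.exp (-(2 * δ)) * ∫ u, (Set.Ioc (-R) R).indicator fejerKernel u :=
      mul_le_mul_of_nonneg_left hRκ (mul_nonneg (hBnn y) (Real.exp_pos _).le)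
    have h3 := (h2.trans h1).trans_lt hy
    have h5 : B y * (Real.exp (-(2 * δ)) * (κ * (1 - δ))) <
        a * (Real.exp (-(2 * δ)) * (κ * (1 - δ))) := by linarith
    have : 0 < 1 - δ := by linarith
    exact lt_of_mul_lt_mul_right h5 (by positivity)

/-- The Chebyshev function of a residue class. -/
noncomputable def psiResidue {q : ℕ} (a : ZMod q) (x : ℝ) : ℝ :=
  ∑ n ∈ Icc 1 ⌊x⌋₊, ArithmeticFunction.vonMangoldt.residueClass a n

theorem psiResidue_mono {q : ℕ} (a : ZMod q) : Monotone (psiResidue a) := fun _ _ h =>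
  sum_le_sum_of_subset_of_nonneg (Icc_subset_Icc_right (Nat.floor_mono h))
    fun n _ _ => ArithmeticFunction.vonMangoldt.residueClass_nonneg a n

theorem psiResidue_nonneg {q : ℕ} (a : ZMod q) (x : ℝ) : 0 ≤ psiResidue a x :=
  sum_nonneg fun n _ => ArithmeticFunction.vonMangoldt.residueClass_nonneg a n

theorem psiResidue_le_psi {q : ℕ} (a : ZMod q) (x : ℝ) : psiResidue a x ≤ Chebyshev.psi x :=
  sum_le_sum fun n _ => ArithmeticFunction.vonMangoldt.residueClass_le a n

theorem psiResidue_le {q : ℕ} (a : ZMod q) {x : ℝ} (hx : 0 ≤ x) :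
    psiResidue a x ≤ (Real.log 4 + 4) * x :=
  (psiResidue_le_psi a x).trans (Chebyshev.psi_le_const_mul_self hx)

theorem psiResidue_of_lt_one {q : ℕ} (a : ZMod q) {x : ℝ} (hx : x < 1) : psiResidue a x = 0 := by
  simp [psiResidue, Nat.floor_eq_zero.2 hx]

theorem integral_psiResidue_mul_exp {q : ℕ} (a : ZMod q) {z : ℂ} (hz : 0 < z.re) :
    (z + 1) * ∫ t in Set.Ioi (0 : ℝ),
      ((Real.exp (-t) * psiResidue a (Real.exp t) : ℝ) : ℂ) * Complex.exp (-(z * t)) =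
      LSeries (fun n => (ArithmeticFunction.vonMangoldt.residueClass a n : ℂ)) (z + 1) := by
  have hO : (fun n => ∑ k ∈ Icc 1 n, ArithmeticFunction.vonMangoldt.residueClass a k)
      =O[atTop] fun n => (n : ℝ) ^ (1 : ℝ) := by
    refine Asymptotics.IsBigO.of_bound (Real.log 4 + 4) (Eventually.of_forall fun n => ?_)
    have h := psiResidue_le a (Nat.cast_nonneg (α := ℝ) n)
    have h0 := psiResidue_nonneg a (n : ℝ)
    rw [psiResidue, Nat.floor_natCast] at h h0
    rwa [Real.rpow_one, Real.norm_of_nonneg h0, Real.norm_of_nonneg n.cast_nonneg]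
  rw [LSeries_eq_mul_integral_of_nonneg _ zero_le_one
    (show 1 < (z + 1).re by simpa using hz) hO
    (ArithmeticFunction.vonMangoldt.residueClass_nonneg a)]
  congr 1
  have himg : Real.exp '' Set.Ioi 0 = Set.Ioi 1 := by
    ext x
    constructor
    · rintro ⟨t, ht, rfl⟩
      simpa using ht
    · intro hx
      have hx : 1 < x := hx
      exact ⟨Real.log x, Real.log_pos hx, Real.exp_log (by linarith)⟩
  rw [← himg, integral_image_eq_integral_abs_deriv_smul measurableSet_Ioi
    (fun x _ => (Real.hasDerivAt_exp x).hasDerivWithinAt) Real.exp_injective.injOn]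
  refine setIntegral_congr_fun measurableSet_Ioi fun t _ => ?_
  have h2 : ((Real.exp t : ℝ) : ℂ) ^ (-(z + 1 + 1)) = Complex.exp (t * -(z + 1 + 1)) := by
    rw [Complex.cpow_def_of_ne_zero (by exact_mod_cast (Real.exp_pos t).ne'),
      ← Complex.ofReal_log (Real.exp_pos t).le, Real.log_exp]
  simp only [h2, abs_of_pos (Real.exp_pos t), Complex.real_smul, psiResidue]
  push_cast
  rw [mul_left_comm, ← Complex.exp_add, mul_right_comm, mul_comm _ (∑ k ∈ _, _),
    ← Complex.exp_add]
  congr 2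
  ring

/-- The prime number theorem in arithmetic progressions, for the Chebyshev function. -/
theorem tendsto_psiResidue_exp {q : ℕ} [NeZero q] {a : ZMod q} (ha : IsUnit a) :
    Tendsto (fun t => Real.exp (-t) * psiResidue a (Real.exp t)) atTop
      (𝓝 ((q.totient : ℝ)⁻¹)) := by
  set A : ℝ := (q.totient : ℝ)⁻¹ with hA
  have hmul (t : ℝ) : Real.exp t * (Real.exp (-t) * psiResidue a (Real.exp t)) =
      psiResidue a (Real.exp t) := by
    rw [← mul_assoc, ← Real.exp_add]; simp
  have hnn (t : ℝ) : 0 ≤ Real.exp (-t) * psiResidue a (Real.exp t) :=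
    mul_nonneg (Real.exp_pos _).le (psiResidue_nonneg _ _)
  have hle (t : ℝ) : Real.exp (-t) * psiResidue a (Real.exp t) ≤ Real.log 4 + 4 := by
    rw [Real.exp_neg, ← div_eq_inv_mul, div_le_iff₀ (Real.exp_pos t)]
    exact psiResidue_le a (Real.exp_pos t).le
  have hmono : Monotone fun t => Real.exp t * (Real.exp (-t) * psiResidue a (Real.exp t)) := by
    simp_rw [hmul]
    exact fun s t h => psiResidue_mono a (Real.exp_le_exp.2 h)
  have hzero (t : ℝ) (ht : t < 0) : Real.exp (-t) * psiResidue a (Real.exp t) = 0 := by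
    rw [psiResidue_of_lt_one a (by simpa using ht), mul_zero]
  refine tendsto_of_integral_mul_exp_eq (C := Real.log 4 + 4)
    (H := fun z => (ArithmeticFunction.vonMangoldt.LFunctionResidueClassAux a (z + 1) - A) /
      (z + 1)) hmono hzero hnn hle ?_ fun z hz => ?_
  · refine ((ContinuousOn.comp
      (ArithmeticFunction.vonMangoldt.continuousOn_LFunctionResidueClassAux a)
      (by fun_prop) fun z hz => ?_).sub continuousOn_const).div (by fun_prop) fun z hz h => ?_
    · simpa using hz
    · have := congrArg Complex.re h
      have hz : 0 ≤ z.re := hz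
      simp at this
      linarith
  · have hz0 : z ≠ 0 := by rintro rfl; simp at hz
    have hz1 : z + 1 ≠ 0 := by
      intro h
      have := congrArg Complex.re h
      simp at this
      linarith
    have hexp : IntegrableOn (fun t : ℝ => Complex.exp (-(z * t))) (Set.Ioi 0) := by
      simpa [neg_mul] using integrableOn_exp_mul_complex_Ioi (a := -z) (by simpa using hz) 0
    have hmeas : Measurable fun t => Real.exp (-t) * psiResidue a (Real.exp t) :=
      (by fun_prop : Measurable fun t : ℝ => Real.exp (-t)).mul
        ((psiResidue_mono a).measurable.comp Real.measurable_exp)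
    have hinteg : IntegrableOn (fun t : ℝ => ((Real.exp (-t) * psiResidue a (Real.exp t) : ℝ) : ℂ) *
        Complex.exp (-(z * t))) (Set.Ioi 0) := by
      refine hexp.bdd_mul (c := Real.log 4 + 4)
        (Complex.measurable_ofReal.comp hmeas).aestronglyMeasurable
        (Eventually.of_forall fun t => ?_)
      rw [Complex.norm_real, Real.norm_of_nonneg (hnn t)]
      exact hle t
    have hG := ArithmeticFunction.vonMangoldt.eqOn_LFunctionResidueClassAux ha
      (show 1 < (z + 1).re by simpa using hz)
    have hL := integral_psiResidue_mul_exp a hz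
    have hE : ∫ t in Set.Ioi (0 : ℝ), Complex.exp (-(z * t)) = 1 / z := by
      have := integral_exp_mul_complex_Ioi (a := -z) (by simpa using hz) 0
      simpa [neg_mul] using this
    have hsplit : ∫ t, (((Real.exp (-t) * psiResidue a (Real.exp t) -
        (Set.Ici 0).indicator (fun _ => A) t : ℝ)) : ℂ) * Complex.exp (-(z * t)) =
        ∫ t in Set.Ioi (0 : ℝ), (((Real.exp (-t) * psiResidue a (Real.exp t) : ℝ) : ℂ) *
          Complex.exp (-(z * t)) - A * Complex.exp (-(z * t))) := by
      rw [← integral_Ici_eq_integral_Ioi, ← integral_indicator measurableSet_Ici]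
      refine integral_congr_ae (Eventually.of_forall fun t => ?_)
      by_cases ht : t ∈ Set.Ici (0 : ℝ)
      · simp only [Set.indicator_of_mem ht]
        push_cast
        ring
      · simp only [Set.indicator_of_notMem ht]
        rw [hzero t (by simpa using ht)]
        simp
    rw [hsplit, integral_sub hinteg (hexp.const_mul _), integral_const_mul, hE, eq_div_iff hz1, hG,
      sub_mul, mul_comm _ (z + 1), hL, hA]
    simp only [add_sub_cancel_right]
    push_cast
    field_simp
    ring

theorem tendsto_psiResidue_div {q : ℕ} [NeZero q] {a : ZMod q} (ha : IsUnit a) :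
    Tendsto (fun x => psiResidue a x / x) atTop (𝓝 ((q.totient : ℝ)⁻¹)) := by
  refine ((tendsto_psiResidue_exp ha).comp Real.tendsto_log_atTop).congr' ?_
  filter_upwards [eventually_gt_atTop 0] with x hx
  simp only [Function.comp, Real.exp_neg, Real.exp_log hx]
  rw [div_eq_inv_mul]

theorem tendsto_psi_sub_theta_div :
    Tendsto (fun x => (Chebyshev.psi x - Chebyshev.theta x) / x) atTop (𝓝 0) := by
  have h := Chebyshev.isBigO_psi_sub_theta_sqrt.mul
    (Asymptotics.isBigO_refl (fun x : ℝ => x⁻¹) atTop)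
  refine h.trans_tendsto ?_
  refine (tendsto_inv_atTop_zero.comp Real.tendsto_sqrt_atTop).congr' ?_
  filter_upwards [eventually_gt_atTop 0] with x hx
  have := Real.sqrt_pos.2 hx
  simp only [Function.comp]
  rw [← div_eq_mul_inv, eq_div_iff hx.ne', inv_mul_eq_div, div_eq_iff this.ne',
    Real.mul_self_sqrt hx.le]

/-- The prime number theorem. -/
theorem tendsto_primeCounting_mul_log_div :
    Tendsto (fun x => (Nat.primeCounting ⌊x⌋₊ : ℝ) * Real.log x / x) atTop (𝓝 1) := by
  have hpsi : Tendsto (fun x => Chebyshev.psi x / x) atTop (𝓝 1) := by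
    have h := tendsto_psiResidue_div (q := 1) (a := 1) isUnit_one
    rw [Nat.totient_one, Nat.cast_one, inv_one] at h
    refine h.congr fun x => ?_
    congr 1
    refine sum_congr rfl fun n _ => ?_
    exact Set.indicator_of_mem (s := {n : ℕ | (n : ZMod 1) = 1}) (Subsingleton.elim _ _) _
  have hpi : Tendsto (fun x => ((Nat.primeCounting ⌊x⌋₊ : ℝ) - Chebyshev.theta x / Real.log x) *
      (Real.log x / x)) atTop (𝓝 0) := by
    refine (Chebyshev.primeCounting_sub_theta_div_log_isBigO.mul
      (Asymptotics.isBigO_refl (fun x : ℝ => Real.log x / x) atTop)).trans_tendsto ?_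
    refine (tendsto_inv_atTop_zero.comp Real.tendsto_log_atTop).congr' ?_
    filter_upwards [eventually_gt_atTop 1] with x hx
    have := Real.log_pos hx
    have : x ≠ 0 := by linarith
    simp only [Function.comp]
    field_simp
  have := (hpi.add hpsi).sub tendsto_psi_sub_theta_div
  rw [zero_add, sub_zero] at this
  refine this.congr' ?_
  filter_upwards [eventually_gt_atTop 1] with x hx
  have := Real.log_pos hx
  have : x ≠ 0 := by linarith
  field_simp
  ring

/-- The sum over a residue class of the von Mangoldt function is bounded by the number of primes
in the class, up to the contribution of the prime powers. -/
theorem psiResidue_natCast_le {q : ℕ} (a : ZMod q) (x : ℕ) :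
    psiResidue a x ≤ #((Icc 1 x).filter fun n : ℕ => n.Prime ∧ (n : ZMod q) = a) * Real.log x +
      (Chebyshev.psi x - Chebyshev.theta x) := by
  rw [Chebyshev.psi_sub_theta_eq_sum_not_prime, psiResidue, Nat.floor_natCast,
    ← sum_filter_add_sum_filter_not (Icc 1 x) Nat.Prime]
  refine add_le_add ?_ (sum_le_sum fun n _ => ArithmeticFunction.vonMangoldt.residueClass_le a n)
  rw [← filter_filter, ← nsmul_eq_mul,
    ← sum_filter_add_sum_filter_not _ fun n : ℕ => (n : ZMod q) = a]
  rw [sum_eq_zero (s := {n ∈ _ | ¬ _}), add_zero]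
  · refine sum_le_card_nsmul _ _ _ fun n hn => ?_
    simp only [mem_filter, mem_Icc] at hn
    refine (ArithmeticFunction.vonMangoldt.residueClass_le a n).trans ?_
    refine ArithmeticFunction.vonMangoldt_le_log.trans ?_
    exact Real.log_le_log (by exact_mod_cast hn.1.1.1) (by exact_mod_cast hn.1.1.2)
  · intro n hn
    exact Set.indicator_of_notMem (s := {n : ℕ | (n : ZMod q) = a}) (mem_filter.1 hn).2 _

/-- The primes in a residue class have lower relative density at least `1 / φ(q)`. -/
theorem eventually_mul_primeCounting_le_card {q : ℕ} [NeZero q] {a : ZMod q} (ha : IsUnit a)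
    {η : ℝ} (hη : 0 < η) :
    ∀ᶠ x : ℕ in atTop, ((q.totient : ℝ)⁻¹ - η) * Nat.primeCounting x ≤
      #((Icc 1 x).filter fun n : ℕ => n.Prime ∧ (n : ZMod q) = a) := by
  have h1 := ((tendsto_psiResidue_div ha).sub tendsto_psi_sub_theta_div).sub
    (tendsto_primeCounting_mul_log_div.const_mul ((q.totient : ℝ)⁻¹ - η))
  have h2 := (h1.comp tendsto_natCast_atTop_atTop).eventually (lt_mem_nhds (a := 0) (by simpa))
  filter_upwards [h2, eventually_gt_atTop 1] with x hx hx1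
  have hlog : 0 < Real.log x := Real.log_pos (by exact_mod_cast hx1)
  have hx0 : (0 : ℝ) < x := by exact_mod_cast (by omega : 0 < x)
  have h3 := psiResidue_natCast_le a x
  simp only [Function.comp, Nat.floor_natCast] at hx
  rw [← mul_div_assoc, ← sub_div, ← sub_div, div_pos_iff_of_pos_right hx0] at hx
  refine le_of_mul_le_mul_right ?_ hlog
  linarith

/-- The Kloosterman sum of a pair of residues modulo a prime. -/
noncomputable def kloostermanSum (p : ℕ) [Fact p.Prime] (h k : ZMod p) : ℂ :=
  ∑ x : (ZMod p)ˣ, ZMod.stdAddChar (h * (x : ZMod p) + k * (x : ZMod p)⁻¹)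

/-- Parseval's identity for exponential sums in two variables. -/
theorem sum_norm_sum_stdAddChar_sq {p : ℕ} [NeZero p] {ι : Type*} [Fintype ι]
    (f g : ι → ZMod p) :
    ∑ h : ZMod p, ∑ k : ZMod p, ‖∑ i, ZMod.stdAddChar (h * f i + k * g i)‖ ^ 2 =
      (p : ℝ) ^ 2 *
        #((univ : Finset (ι × ι)).filter fun ij => f ij.1 = f ij.2 ∧ g ij.1 = g ij.2) := by
  rw [← Complex.ofReal_inj]
  push_cast
  have hnorm (h k : ZMod p) : (‖∑ i, ZMod.stdAddChar (h * f i + k * g i)‖ : ℂ) ^ 2 =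
      ∑ ij : ι × ι, ZMod.stdAddChar (h * (f ij.1 - f ij.2)) *
        ZMod.stdAddChar (k * (g ij.1 - g ij.2)) := by
    rw [← Complex.mul_conj', map_sum, Fintype.sum_mul_sum, Fintype.sum_prod_type]
    refine sum_congr rfl fun i _ => sum_congr rfl fun j _ => ?_
    rw [← AddChar.map_neg_eq_conj, ← AddChar.map_add_eq_mul, ← AddChar.map_add_eq_mul]
    congr 1
    ring
  simp_rw [hnorm]
  calc _ = ∑ ij : ι × ι, (∑ h : ZMod p, ZMod.stdAddChar (h * (f ij.1 - f ij.2))) *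
        ∑ k : ZMod p, ZMod.stdAddChar (k * (g ij.1 - g ij.2)) := by
        simp_rw [Fintype.sum_mul_sum]
        rw [sum_comm]
        simp_rw [sum_comm (s := univ (α := ZMod p)) (t := univ (α := ι × ι))]
        refine sum_congr rfl fun ij _ => sum_comm
    _ = ∑ ij : ι × ι, if f ij.1 = f ij.2 ∧ g ij.1 = g ij.2 then (p : ℂ) ^ 2 else 0 := by
        refine sum_congr rfl fun ij _ => ?_
        rw [AddChar.sum_mulShift _ (ZMod.isPrimitive_stdAddChar p),
          AddChar.sum_mulShift _ (ZMod.isPrimitive_stdAddChar p), ZMod.card]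
        simp only [sub_eq_zero]
        split_ifs <;> simp_all [sq]
    _ = _ := by
        rw [← sum_filter, sum_const, nsmul_eq_mul, mul_comm]

theorem card_units_add_eq_le (p : ℕ) [Fact p.Prime] :
    #((univ : Finset (((ZMod p)ˣ × (ZMod p)ˣ) × ((ZMod p)ˣ × (ZMod p)ˣ))).filter fun ij =>
      ((ij.1.1 : ZMod p) + ij.1.2 = ij.2.1 + ij.2.2) ∧
      ((ij.1.1 : ZMod p)⁻¹ + (ij.1.2 : ZMod p)⁻¹ =
        (ij.2.1 : ZMod p)⁻¹ + (ij.2.2 : ZMod p)⁻¹)) ≤ 3 * (p - 1) ^ 2 := by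
  classical
  set U := (ZMod p)ˣ
  have hcard : #(univ : Finset (U × U)) = (p - 1) ^ 2 := by
    rw [card_univ, Fintype.card_prod, ZMod.card_units, sq]
  let f₁ : U × U → (U × U) × (U × U) := fun xy => ((xy.1, -xy.1), (xy.2, -xy.2))
  let f₂ : U × U → (U × U) × (U × U) := fun xy => (xy, xy)
  let f₃ : U × U → (U × U) × (U × U) := fun xy => (xy, (xy.2, xy.1))
  refine (card_le_card (t := univ.image f₁ ∪ (univ.image f₂ ∪ univ.image f₃)) ?_).trans ?_
  · rintro ⟨⟨x, z⟩, ⟨y, w⟩⟩ h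
    simp only [mem_filter, mem_univ, true_and] at h
    obtain ⟨h1, h2⟩ := h
    have hx := x.ne_zero
    have hy := y.ne_zero
    have hz := z.ne_zero
    have hw := w.ne_zero
    simp only [mem_union, mem_image, mem_univ, true_and, f₁, f₂, f₃, Prod.mk.injEq]
    rw [inv_add_inv hx hz, inv_add_inv hy hw, h1] at h2
    by_cases hu : (y : ZMod p) + w = 0
    · left
      refine ⟨(x, y), ⟨rfl, Units.ext ?_⟩, rfl, Units.ext ?_⟩
      · rw [Units.val_neg]; linear_combination -h1 - hu
      · rw [Units.val_neg]; linear_combination -hu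
    · have h3 : (x : ZMod p) * z = y * w := by
        rw [div_eq_div_iff (mul_ne_zero hx hz) (mul_ne_zero hy hw)] at h2
        exact (mul_left_cancel₀ hu h2).symm
      have h4 : ((y : ZMod p) - x) * (y - z) = 0 := by linear_combination h3 - (y : ZMod p) * h1
      right
      rcases mul_eq_zero.1 h4 with h5 | h5
      · left
        have : x = y := Units.ext (by linear_combination -h5)
        subst this
        exact ⟨(x, z), rfl, Prod.ext rfl (Units.ext (by linear_combination h1))⟩
      · right
        have : z = y := Units.ext (by linear_combination -h5)
        subst this
        exact ⟨(x, z), rfl, rfl, Units.ext (by linear_combination h1)⟩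
  · refine (card_union_le _ _).trans ((add_le_add_right (card_union_le _ _) _).trans ?_)
    have h1 := card_image_le (s := univ) (f := f₁)
    have h2 := card_image_le (s := univ) (f := f₂)
    have h3 := card_image_le (s := univ) (f := f₃)
    rw [hcard] at h1 h2 h3
    omega

theorem sum_norm_kloostermanSum_pow_four_le (p : ℕ) [Fact p.Prime] :
    ∑ h : ZMod p, ∑ k : ZMod p, ‖kloostermanSum p h k‖ ^ 4 ≤
      (p : ℝ) ^ 2 * (3 * ((p - 1 : ℕ) : ℝ) ^ 2) := by
  have hsq (h k : ZMod p) : ‖kloostermanSum p h k‖ ^ 4 =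
      ‖∑ xz : (ZMod p)ˣ × (ZMod p)ˣ, ZMod.stdAddChar (h * ((xz.1 : ZMod p) + (xz.2 : ZMod p)) +
        k * ((xz.1 : ZMod p)⁻¹ + (xz.2 : ZMod p)⁻¹))‖ ^ 2 := by
    rw [show 4 = 2 * 2 from rfl, pow_mul, ← norm_pow, sq (kloostermanSum p h k), kloostermanSum,
      Fintype.sum_mul_sum, Fintype.sum_prod_type]
    congr 2
    refine sum_congr rfl fun x _ => sum_congr rfl fun z _ => ?_
    rw [← AddChar.map_add_eq_mul]
    congr 1
    ring
  simp_rw [hsq]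
  rw [sum_norm_sum_stdAddChar_sq]
  refine mul_le_mul_of_nonneg_left ?_ (by positivity)
  exact_mod_cast card_units_add_eq_le p

theorem kloostermanSum_mul_inv (p : ℕ) [Fact p.Prime] (h k : ZMod p) (t : (ZMod p)ˣ) :
    kloostermanSum p (h * (t : ZMod p)) (k * (t : ZMod p)⁻¹) = kloostermanSum p h k := by
  refine Fintype.sum_equiv (Equiv.mulLeft t) _ _ fun x => ?_
  simp only [Equiv.coe_mulLeft, mul_inv_rev, Units.val_mul]
  congr 1
  ring

/-- Kloosterman's bound. -/
theorem norm_kloostermanSum_pow_four_le {p : ℕ} [Fact p.Prime] {h k : ZMod p}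
    (hhk : h ≠ 0 ∨ k ≠ 0) : ‖kloostermanSum p h k‖ ^ 4 ≤ 3 * (p : ℝ) ^ 2 * (p - 1 : ℕ) := by
  have hp : 0 < p - 1 := Nat.sub_pos_of_lt (Fact.out : p.Prime).one_lt
  have hinj : Function.Injective fun t : (ZMod p)ˣ => (h * (t : ZMod p), k * (t : ZMod p)⁻¹) := by
    intro s t hst
    simp only [Prod.mk.injEq] at hst
    rcases hhk with h0 | h0
    · exact Units.ext (mul_left_cancel₀ h0 hst.1)
    · exact Units.ext (inv_injective (mul_left_cancel₀ h0 hst.2))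
  have hsum : ((p - 1 : ℕ) : ℝ) * ‖kloostermanSum p h k‖ ^ 4 ≤
      ∑ hk : ZMod p × ZMod p, ‖kloostermanSum p hk.1 hk.2‖ ^ 4 := by
    calc _ = ∑ t : (ZMod p)ˣ, ‖kloostermanSum p (h * (t : ZMod p)) (k * (t : ZMod p)⁻¹)‖ ^ 4 := by
          simp_rw [kloostermanSum_mul_inv]
          rw [sum_const, card_univ, ZMod.card_units, nsmul_eq_mul]
      _ = ∑ hk ∈ univ.map ⟨_, hinj⟩, ‖kloostermanSum p hk.1 hk.2‖ ^ 4 := by rw [sum_map]; rfl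
      _ ≤ _ := sum_le_sum_of_subset_of_nonneg (subset_univ _) fun _ _ _ => by positivity
  rw [Fintype.sum_prod_type] at hsum
  have hp' : (0 : ℝ) < (p - 1 : ℕ) := by exact_mod_cast hp
  refine le_of_mul_le_mul_left
    ((hsum.trans (sum_norm_kloostermanSum_pow_four_le p)).trans_eq ?_) hp'
  ring

/-- The covering map of the two-dimensional torus. -/
noncomputable def torusMk (y : ℝ × ℝ) : UnitAddTorus (Fin 2) :=
  ![(y.1 : UnitAddCircle), (y.2 : UnitAddCircle)]

theorem continuous_torusMk : Continuous torusMk := by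
  refine continuous_pi fun i => ?_
  fin_cases i
  · exact (AddCircle.continuous_mk' 1).comp continuous_fst
  · exact (AddCircle.continuous_mk' 1).comp continuous_snd

theorem isOpenMap_torusMk : IsOpenMap torusMk := by
  have h : torusMk = Pi.map (fun _ : Fin 2 => ((↑) : ℝ → UnitAddCircle)) ∘
      (Homeomorph.finTwoArrow (X := ℝ)).symm := by
    ext y i
    fin_cases i <;> rfl
  rw [h]
  exact (IsOpenMap.piMap (fun _ => QuotientAddGroup.isOpenMap_coe)
    (Eventually.of_forall fun _ => QuotientAddGroup.mk_surjective)).comp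
    (Homeomorph.isOpenMap _)

theorem torusMk_injOn : Set.InjOn torusMk (Set.Ioc 0 1 ×ˢ Set.Ioc 0 1) := by
  intro x hx y hy h
  have hi (a b : ℝ) (ha : a ∈ Set.Ioc (0 : ℝ) 1) (hb : b ∈ Set.Ioc (0 : ℝ) 1)
      (hab : (a : UnitAddCircle) = b) : a = b := by
    rw [← zero_add (1 : ℝ)] at ha hb
    exact (AddCircle.coe_eq_coe_iff_of_mem_Ioc ha hb).1 hab
  exact Prod.ext (hi _ _ hx.1 hy.1 (congrFun h 0)) (hi _ _ hx.2 hy.2 (congrFun h 1))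

/-- The point of the unit square attached to a residue and its inverse. -/
noncomputable def inversePoint (p : ℕ) (x : (ZMod p)ˣ) : ℝ × ℝ :=
  ((x : ZMod p).val / p, ((x : ZMod p)⁻¹).val / p)

theorem mFourier_torusMk (n : Fin 2 → ℤ) (y : ℝ × ℝ) :
    UnitAddTorus.mFourier n (torusMk y) =
      fourier (n 0) (y.1 : UnitAddCircle) * fourier (n 1) (y.2 : UnitAddCircle) := by
  simp [UnitAddTorus.mFourier, torusMk, Fin.prod_univ_two]

theorem fourier_val_div {p : ℕ} [NeZero p] (n : ℤ) (a : ZMod p) :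
    fourier n ((a.val / p : ℝ) : UnitAddCircle) = ZMod.stdAddChar ((n : ZMod p) * a) := by
  rw [← ZMod.toAddCircle_apply, fourier_apply, ← map_zsmul, ZMod.stdAddChar_apply,
    zsmul_eq_mul]
  rfl

theorem sum_mFourier_inversePoint {p : ℕ} [Fact p.Prime] (n : Fin 2 → ℤ) :
    ∑ x, UnitAddTorus.mFourier n (torusMk (inversePoint p x)) = kloostermanSum p (n 0) (n 1) := by
  refine sum_congr rfl fun x _ => ?_
  rw [mFourier_torusMk, inversePoint, fourier_val_div, fourier_val_div, AddChar.map_add_eq_mul]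

theorem integral_fourier_Ioc {n : ℤ} (hn : n ≠ 0) :
    ∫ x in Set.Ioc (0 : ℝ) 1, fourier n (x : UnitAddCircle) = 0 := by
  have hc : 2 * (Real.pi : ℂ) * Complex.I * n ≠ 0 := by simp [Real.pi_ne_zero, hn]
  have h (x : ℝ) : fourier n (x : UnitAddCircle) =
      Complex.exp (2 * Real.pi * Complex.I * n * x) := by
    rw [fourier_coe_apply, Complex.ofReal_one, div_one]
  simp_rw [h]
  rw [← intervalIntegral.integral_of_le zero_le_one, integral_exp_mul_complex hc]
  rw [show 2 * (Real.pi : ℂ) * Complex.I * n * (1 : ℝ) = n * (2 * Real.pi * Complex.I) by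
    push_cast; ring, Complex.exp_int_mul_two_pi_mul_I]
  simp

theorem integral_mFourier_torusMk {n : Fin 2 → ℤ} (hn : n ≠ 0) :
    ∫ y in Set.Ioc (0 : ℝ) 1 ×ˢ Set.Ioc (0 : ℝ) 1, UnitAddTorus.mFourier n (torusMk y) = 0 := by
  simp_rw [mFourier_torusMk]
  rw [Measure.volume_eq_prod, setIntegral_prod_mul (fun x : ℝ => fourier (n 0) (x : UnitAddCircle))
    (fun x : ℝ => fourier (n 1) (x : UnitAddCircle))]
  obtain ⟨i, hi⟩ := Function.ne_iff.1 hn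
  fin_cases i
  · rw [integral_fourier_Ioc (show n 0 ≠ 0 from hi), zero_mul]
  · rw [integral_fourier_Ioc (show n 1 ≠ 0 from hi), mul_zero]

theorem volume_real_unit_square :
    (volume : Measure (ℝ × ℝ)).real (Set.Ioc 0 1 ×ˢ Set.Ioc 0 1) = 1 := by
  simp [Measure.volume_eq_prod, Measure.real, Measure.prod_prod]

theorem norm_kloostermanSum_le {p : ℕ} [Fact p.Prime] {h k : ZMod p} (hhk : h ≠ 0 ∨ k ≠ 0)
    {ε : ℝ} (hε : 0 < ε) (hp : 12 / ε ^ 4 ≤ (p - 1 : ℕ)) :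
    ‖kloostermanSum p h k‖ ≤ ε * (p - 1 : ℕ) := by
  have h2 := (Fact.out : p.Prime).two_le
  set m : ℝ := ((p - 1 : ℕ) : ℝ)
  have hm : (p : ℝ) = m + 1 := by simp only [m]; exact_mod_cast (by omega : p = p - 1 + 1)
  have hm1 : 1 ≤ m := by simp only [m]; exact_mod_cast (by omega : 1 ≤ p - 1)
  refine le_of_pow_le_pow_left₀ (n := 4) (by norm_num) (by positivity)
    ((norm_kloostermanSum_pow_four_le hhk).trans ?_)
  rw [div_le_iff₀ (by positivity)] at hp
  have h4 : (p : ℝ) ^ 2 ≤ 4 * m ^ 2 := by rw [hm]; nlinarith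
  calc 3 * (p : ℝ) ^ 2 * m ≤ 3 * (4 * m ^ 2) * m := by gcongr
    _ = 12 * m ^ 3 := by ring
    _ ≤ m * ε ^ 4 * m ^ 3 := by gcongr
    _ = (ε * m) ^ 4 := by ring

theorem exists_forall_norm_sum_mFourier_sub_le (n : Fin 2 → ℤ) {ε : ℝ} (hε : 0 < ε) :
    ∃ P : ℕ, ∀ (p : ℕ) [Fact p.Prime], P < p →
      ‖∑ x, UnitAddTorus.mFourier n (torusMk (inversePoint p x)) - (p - 1 : ℕ) *
        ∫ y in Set.Ioc (0 : ℝ) 1 ×ˢ Set.Ioc (0 : ℝ) 1, UnitAddTorus.mFourier n (torusMk y)‖ ≤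
        ε * (p - 1 : ℕ) := by
  rcases eq_or_ne n 0 with rfl | hn
  · refine ⟨0, fun p _ _ => ?_⟩
    have hv := volume_real_unit_square
    simp only [UnitAddTorus.mFourier_zero, ContinuousMap.one_apply, sum_const, card_univ,
      ZMod.card_units, setIntegral_const, hv, one_smul, nsmul_eq_mul, sub_self, norm_zero]
    positivity
  · refine ⟨⌈12 / ε ^ 4⌉₊ + (n 0).natAbs + (n 1).natAbs + 1, fun p _ hp => ?_⟩
    rw [integral_mFourier_torusMk hn, mul_zero, sub_zero, sum_mFourier_inversePoint]
    have hcast (i : Fin 2) (hi : n i ≠ 0) (hip : (n i).natAbs < p) : (n i : ZMod p) ≠ 0 := by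
      rw [Ne, ZMod.intCast_zmod_eq_zero_iff_dvd]
      exact fun h => hip.not_ge (Nat.le_of_dvd (Int.natAbs_pos.2 hi) (Int.natCast_dvd.1 h))
    refine norm_kloostermanSum_le ?_ hε ((Nat.le_ceil _).trans ?_)
    · obtain ⟨i, hi⟩ := Function.ne_iff.1 hn
      fin_cases i
      · exact Or.inl (hcast 0 hi (by omega))
      · exact Or.inr (hcast 1 hi (by omega))
    · exact_mod_cast (by omega : ⌈12 / ε ^ 4⌉₊ ≤ p - 1)

theorem integrableOn_comp_torusMk (f : C(UnitAddTorus (Fin 2), ℂ)) :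
    IntegrableOn (fun y => f (torusMk y)) (Set.Ioc (0 : ℝ) 1 ×ˢ Set.Ioc (0 : ℝ) 1) :=
  ((f.continuous.comp continuous_torusMk).continuousOn.integrableOn_compact
    (isCompact_Icc.prod isCompact_Icc)).mono_set
    (Set.prod_mono Set.Ioc_subset_Icc_self Set.Ioc_subset_Icc_self)

/-- Equidistribution of the points `(x / p, x⁻¹ / p)` on the torus. -/
theorem exists_forall_norm_sum_sub_le (f : C(UnitAddTorus (Fin 2), ℂ)) {ε : ℝ} (hε : 0 < ε) :
    ∃ P : ℕ, ∀ (p : ℕ) [Fact p.Prime], P < p →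
      ‖∑ x, f (torusMk (inversePoint p x)) - (p - 1 : ℕ) *
        ∫ y in Set.Ioc (0 : ℝ) 1 ×ˢ Set.Ioc (0 : ℝ) 1, f (torusMk y)‖ ≤ ε * (p - 1 : ℕ) := by
  obtain ⟨g, hg, hfg⟩ : ∃ g ∈ Submodule.span ℂ (Set.range UnitAddTorus.mFourier),
      ‖f - g‖ < ε / 3 := by
    have hf : f ∈ (Submodule.span ℂ
        (Set.range (UnitAddTorus.mFourier (d := Fin 2)))).topologicalClosure := by
      rw [UnitAddTorus.span_mFourier_closure_eq_top]; trivial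
    obtain ⟨g, hg, h⟩ := Metric.mem_closure_iff.1 hf (ε / 3) (by positivity)
    exact ⟨g, hg, by rwa [← dist_eq_norm]⟩
  have hspan : ∀ ε : ℝ, 0 < ε → ∃ P : ℕ, ∀ (p : ℕ) [Fact p.Prime], P < p →
      ‖∑ x, g (torusMk (inversePoint p x)) - (p - 1 : ℕ) *
        ∫ y in Set.Ioc (0 : ℝ) 1 ×ˢ Set.Ioc (0 : ℝ) 1, g (torusMk y)‖ ≤ ε * (p - 1 : ℕ) := by
    clear hfg
    induction hg using Submodule.span_induction with
    | mem g hg =>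
      obtain ⟨n, rfl⟩ := hg
      exact fun ε hε => exists_forall_norm_sum_mFourier_sub_le n hε
    | zero =>
      refine fun ε hε => ⟨0, fun p _ _ => ?_⟩
      simp only [ContinuousMap.zero_apply, sum_const_zero, integral_zero, mul_zero, sub_zero,
        norm_zero]
      positivity
    | add g₁ g₂ _ _ h₁ h₂ =>
      intro ε hε
      obtain ⟨P₁, h₁⟩ := h₁ (ε / 2) (by positivity)
      obtain ⟨P₂, h₂⟩ := h₂ (ε / 2) (by positivity)
      refine ⟨max P₁ P₂, fun p _ hp => ?_⟩
      have h₁ := h₁ p (lt_of_le_of_lt (le_max_left _ _) hp)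
      have h₂ := h₂ p (lt_of_le_of_lt (le_max_right _ _) hp)
      simp only [ContinuousMap.add_apply]
      rw [sum_add_distrib,
        integral_add (integrableOn_comp_torusMk g₁) (integrableOn_comp_torusMk g₂), mul_add,
        add_sub_add_comm]
      exact (norm_add_le_of_le h₁ h₂).trans_eq (by ring)
    | smul c g _ h =>
      intro ε hε
      obtain ⟨P, h⟩ := h (ε / (‖c‖ + 1)) (by positivity)
      refine ⟨P, fun p _ hp => ?_⟩
      simp only [ContinuousMap.smul_apply, smul_eq_mul]
      rw [← mul_sum, integral_const_mul, mul_left_comm, ← mul_sub, norm_mul]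
      calc _ ≤ (‖c‖ + 1) * (ε / (‖c‖ + 1) * (p - 1 : ℕ)) := by
            gcongr
            · linarith
            · exact h p hp
        _ = _ := by field_simp
  obtain ⟨P, hP⟩ := hspan (ε / 3) (by positivity)
  refine ⟨P, fun p _ hp => ?_⟩
  have hdiff (t) : ‖f t - g t‖ ≤ ε / 3 := ((f - g).norm_coe_le_norm t).trans hfg.le
  have h1 : ‖∑ x : (ZMod p)ˣ, (f (torusMk (inversePoint p x)) - g (torusMk (inversePoint p x)))‖ ≤
      ε / 3 * (p - 1 : ℕ) := by
    refine (norm_sum_le_of_le univ fun x _ => hdiff _).trans_eq ?_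
    rw [sum_const, card_univ, ZMod.card_units, nsmul_eq_mul, mul_comm]
  have h2 : ‖∫ y in Set.Ioc (0 : ℝ) 1 ×ˢ Set.Ioc (0 : ℝ) 1, (f (torusMk y) - g (torusMk y))‖ ≤
      ε / 3 := by
    have hfin : volume (Set.Ioc (0 : ℝ) 1 ×ˢ Set.Ioc (0 : ℝ) 1) < ⊤ := by
      simp [Measure.volume_eq_prod, Measure.prod_prod]
    refine (norm_setIntegral_le_of_norm_le_const hfin fun y _ => hdiff _).trans_eq ?_
    rw [volume_real_unit_square, mul_one]
  rw [integral_sub (integrableOn_comp_torusMk f) (integrableOn_comp_torusMk g)] at h2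
  rw [sum_sub_distrib] at h1
  have h3 := hP p hp
  set S := ∑ x, f (torusMk (inversePoint p x))
  set S' := ∑ x, g (torusMk (inversePoint p x))
  set J := ∫ y in Set.Ioc (0 : ℝ) 1 ×ˢ Set.Ioc (0 : ℝ) 1, f (torusMk y)
  set J' := ∫ y in Set.Ioc (0 : ℝ) 1 ×ˢ Set.Ioc (0 : ℝ) 1, g (torusMk y)
  have h4 : ‖((p - 1 : ℕ) : ℂ) * (J - J')‖ ≤ (p - 1 : ℕ) * (ε / 3) := by
    rw [norm_mul, Complex.norm_natCast]
    gcongr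
  calc ‖S - (p - 1 : ℕ) * J‖ =
        ‖(S - S') + (S' - (p - 1 : ℕ) * J') - (p - 1 : ℕ) * (J - J')‖ := by congr 1; ring
    _ ≤ ε / 3 * (p - 1 : ℕ) + ε / 3 * (p - 1 : ℕ) + (p - 1 : ℕ) * (ε / 3) :=
        norm_sub_le_of_le (norm_add_le_of_le h1 h3) h4
    _ = ε * (p - 1 : ℕ) := by ring

theorem inversePoint_mem_Ioc {p : ℕ} [Fact p.Prime] (x : (ZMod p)ˣ) :
    inversePoint p x ∈ Set.Ioc (0 : ℝ) 1 ×ˢ Set.Ioc (0 : ℝ) 1 := by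
  have hp : (0 : ℝ) < p := by exact_mod_cast (Fact.out : p.Prime).pos
  have h {a : ZMod p} (ha : a ≠ 0) : (a.val / p : ℝ) ∈ Set.Ioc (0 : ℝ) 1 :=
    ⟨div_pos (by exact_mod_cast ZMod.val_pos.2 ha) hp,
      (div_le_one hp).2 (by exact_mod_cast (ZMod.val_lt a).le)⟩
  exact ⟨h x.ne_zero, h (inv_ne_zero x.ne_zero)⟩

/-- The points `(x / p, x⁻¹ / p)` visit an open subset of the unit square at least as often as
its area predicts, up to an arbitrarily small proportion. -/
theorem exists_forall_volume_sub_mul_le_card {U : Set (ℝ × ℝ)} (hU : IsOpen U)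
    (hUs : U ⊆ Set.Ioc 0 1 ×ˢ Set.Ioc 0 1) {ε : ℝ} (hε : 0 < ε) :
    ∃ P : ℕ, ∀ (p : ℕ) [Fact p.Prime], P < p →
      (volume.real U - ε) * (p - 1 : ℕ) ≤ {x | inversePoint p x ∈ U}.ncard := by
  have hbox : volume (Set.Ioc (0 : ℝ) 1 ×ˢ Set.Ioc (0 : ℝ) 1) ≠ ⊤ := by
    simp [Measure.volume_eq_prod, Measure.prod_prod]
  obtain ⟨K, hKU, hK, hKv⟩ : ∃ K ⊆ U, IsCompact K ∧ volume.real U - ε / 2 ≤ volume.real K := by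
    obtain ⟨K, hKU, hK, h⟩ := hU.measurableSet.exists_isCompact_lt_add
      (measure_ne_top_of_subset hUs hbox) (ε := ENNReal.ofReal (ε / 2)) (by simpa using hε)
    refine ⟨K, hKU, hK, ?_⟩
    have := ENNReal.toReal_mono (by simp [hK.measure_lt_top.ne]) h.le
    rw [ENNReal.toReal_add hK.measure_lt_top.ne (by simp), ENNReal.toReal_ofReal (by positivity)]
      at this
    rw [sub_le_iff_le_add]
    exact this
  obtain ⟨g, hgK, hgU, hg⟩ := exists_continuous_one_zero_of_isCompact
    (hK.image continuous_torusMk) (isOpenMap_torusMk U hU).isClosed_compl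
    (Set.disjoint_compl_right_iff_subset.2 (Set.image_mono hKU))
  let f : C(UnitAddTorus (Fin 2), ℂ) := ⟨fun t => (g t : ℂ), by fun_prop⟩
  have hfg (t) : f t = (g t : ℂ) := rfl
  obtain ⟨P, hP⟩ := exists_forall_norm_sum_sub_le f (half_pos hε)
  refine ⟨P, fun p _ hp => ?_⟩
  have h := hP p hp
  simp only [hfg] at h
  rw [integral_complex_ofReal] at h
  have h' : |∑ x, g (torusMk (inversePoint p x)) - (p - 1 : ℕ) *
      ∫ y in Set.Ioc (0 : ℝ) 1 ×ˢ Set.Ioc (0 : ℝ) 1, g (torusMk y)| ≤ ε / 2 * (p - 1 : ℕ) := by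
    rw [← Real.norm_eq_abs, ← Complex.norm_real]
    push_cast
    exact h
  have hinteg : IntegrableOn (fun y => g (torusMk y)) (Set.Ioc (0 : ℝ) 1 ×ˢ Set.Ioc (0 : ℝ) 1) :=
    (integrableOn_comp_torusMk f).re
  have hJ : volume.real K ≤ ∫ y in Set.Ioc (0 : ℝ) 1 ×ˢ Set.Ioc (0 : ℝ) 1, g (torusMk y) :=
    calc volume.real K = ∫ y in K, g (torusMk y) := by
          rw [setIntegral_congr_fun (g := fun _ => (1 : ℝ)) hK.measurableSet
            fun y hy => hgK (Set.mem_image_of_mem _ hy)]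
          simp
      _ ≤ _ := setIntegral_mono_set hinteg (Eventually.of_forall fun y => (hg.2 _).1)
          (hKU.trans hUs).eventuallyLE
  have hS : ∑ x, g (torusMk (inversePoint p x)) ≤ {x | inversePoint p x ∈ U}.ncard := by
    classical
    rw [Set.ncard_eq_toFinset_card', ← nsmul_one, ← sum_const]
    rw [← sum_subset (subset_univ {x | inversePoint p x ∈ U}.toFinset)]
    · exact sum_le_sum fun x _ => (hg.2 _).2
    · intro x _ hx
      refine hgU fun ⟨y, hy, hyx⟩ => hx ?_
      rw [Set.mem_toFinset]
      have := torusMk_injOn (hUs hy) (inversePoint_mem_Ioc x) hyx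
      rwa [Set.mem_ofPred_eq, ← this]
  have h3 := (abs_le.1 h').1
  have h4 := mul_le_mul_of_nonneg_left (hKv.trans hJ) (Nat.cast_nonneg (α := ℝ) (p - 1))
  linarith

theorem isOpen_regionBetween {f g : ℝ → ℝ} (hf : Continuous f) (hg : Continuous g) {s : Set ℝ}
    (hs : IsOpen s) : IsOpen (regionBetween f g s) :=
  (hs.preimage continuous_fst).inter ((isOpen_lt (hf.comp continuous_fst) continuous_snd).inter
    (isOpen_lt continuous_snd (hg.comp continuous_fst)))

theorem volume_real_regionBetween_Ioo {f g : ℝ → ℝ} (hf : Continuous f) (hg : Continuous g)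
    {a b : ℝ} (hab : a ≤ b) (hfg : ∀ x ∈ Set.Ioo a b, f x ≤ g x) :
    volume.real (regionBetween f g (Set.Ioo a b)) = ∫ x in a..b, (g x - f x) := by
  rw [Measure.real, Measure.volume_eq_prod, volume_regionBetween_eq_integral
    ((hf.continuousOn.integrableOn_Icc).mono_set Set.Ioo_subset_Icc_self)
    ((hg.continuousOn.integrableOn_Icc).mono_set Set.Ioo_subset_Icc_self) measurableSet_Ioo hfg]
  simp only [Pi.sub_apply]
  rw [ENNReal.toReal_ofReal
      (setIntegral_nonneg measurableSet_Ioo fun x hx => sub_nonneg.2 (hfg x hx)),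
    intervalIntegral.integral_of_le hab, integral_Ioc_eq_integral_Ioo]

/-- The region of pairs `(β / p, β⁻¹ / p)` that force a large coefficient. -/
def largeHeightRegion : Set (ℝ × ℝ) :=
  regionBetween (fun x => 1 - x) (fun x => 2 * x) (Set.Ioo (1 / 3) (1 / 2)) ∪
    regionBetween (fun x => (1 - x) / 2) (fun x => x) (Set.Ioo (1 / 3) (1 / 2))

theorem isOpen_largeHeightRegion : IsOpen largeHeightRegion :=
  (isOpen_regionBetween (by fun_prop) (by fun_prop) isOpen_Ioo).union
    (isOpen_regionBetween (by fun_prop) (by fun_prop) isOpen_Ioo)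

theorem largeHeightRegion_subset : largeHeightRegion ⊆ Set.Ioc 0 1 ×ˢ Set.Ioc 0 1 := by
  rintro ⟨x, y⟩ (⟨⟨h1, h2⟩, h3, h4⟩ | ⟨⟨h1, h2⟩, h3, h4⟩) <;>
  · simp only at h1 h2 h3 h4
    exact ⟨⟨by simp only; linarith, by simp only; linarith⟩,
      ⟨by simp only; linarith, by simp only; linarith⟩⟩

theorem volume_real_largeHeightRegion : volume.real largeHeightRegion = 1 / 16 := by
  have hdisj : Disjoint
      (regionBetween (fun x : ℝ => 1 - x) (fun x => 2 * x) (Set.Ioo (1 / 3) (1 / 2)))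
      (regionBetween (fun x : ℝ => (1 - x) / 2) (fun x => x) (Set.Ioo (1 / 3) (1 / 2))) := by
    rw [Set.disjoint_left]
    rintro ⟨x, y⟩ ⟨⟨h1, h2⟩, h3, h4⟩ ⟨⟨h5, h6⟩, h7, h8⟩
    simp only at h1 h2 h3 h4 h5 h6 h7 h8
    linarith
  have hbox : volume (Set.Ioc (0 : ℝ) 1 ×ˢ Set.Ioc (0 : ℝ) 1) ≠ ⊤ := by
    simp [Measure.volume_eq_prod, Measure.prod_prod]
  have hsub := largeHeightRegion_subset
  rw [largeHeightRegion] at hsub ⊢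
  rw [measureReal_union hdisj
    (isOpen_regionBetween (by fun_prop) (by fun_prop) isOpen_Ioo).measurableSet
    (measure_ne_top_of_subset (Set.subset_union_left.trans hsub) hbox)
    (measure_ne_top_of_subset (Set.subset_union_right.trans hsub) hbox),
    volume_real_regionBetween_Ioo (by fun_prop) (by fun_prop) (by norm_num)
      (fun x hx => by linarith [hx.1]),
    volume_real_regionBetween_Ioo (by fun_prop) (by fun_prop) (by norm_num)
      (fun x hx => by linarith [hx.1])]
  have h1 : ∫ x in (1 / 3 : ℝ)..(1 / 2), (2 * x - (1 - x)) = 1 / 24 := by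
    rw [show (fun x : ℝ => 2 * x - (1 - x)) = fun x => 3 * x - 1 by ext; ring,
      intervalIntegral.integral_sub (Continuous.intervalIntegrable (by fun_prop) _ _)
      (Continuous.intervalIntegrable (by fun_prop) _ _), intervalIntegral.integral_const_mul,
      integral_id, intervalIntegral.integral_const]
    norm_num
  have h2 : ∫ x in (1 / 3 : ℝ)..(1 / 2), (x - (1 - x) / 2) = 1 / 48 := by
    rw [show (fun x : ℝ => x - (1 - x) / 2) = fun x => 3 / 2 * x - 1 / 2 by ext; ring,
      intervalIntegral.integral_sub (Continuous.intervalIntegrable (by fun_prop) _ _)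
      (Continuous.intervalIntegrable (by fun_prop) _ _), intervalIntegral.integral_const_mul,
      integral_id, intervalIntegral.integral_const]
    norm_num
  rw [h1, h2]
  norm_num

/-- The units modulo `p` whose primes `q` admit a prime `r` with `A(pqr) > (p + 1) / 2`. -/
def largeHeightUnits (p : ℕ) : Set (ZMod p)ˣ :=
  {x | inversePoint p x ∈ largeHeightRegion ∧ 2 * (x : ZMod p).val + 1 ≠ p}

theorem exists_forall_mul_le_ncard_largeHeightUnits {ε : ℝ} (hε : 0 < ε) :
    ∃ P : ℕ, ∀ (p : ℕ) [Fact p.Prime], P < p →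
      (1 / 16 - ε) * (p - 1 : ℕ) ≤ (largeHeightUnits p).ncard := by
  obtain ⟨P, hP⟩ := exists_forall_volume_sub_mul_le_card isOpen_largeHeightRegion
    largeHeightRegion_subset (half_pos hε)
  refine ⟨max P (⌈2 / ε⌉₊ + 1), fun p _ hp => ?_⟩
  have h1 := hP p ((le_max_left _ _).trans_lt hp)
  rw [volume_real_largeHeightRegion] at h1
  have h2 : 2 / ε ≤ (p - 1 : ℕ) := (Nat.le_ceil _).trans
    (by exact_mod_cast (by have := (le_max_right _ _).trans_lt hp; omega : ⌈2 / ε⌉₊ ≤ p - 1))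
  rw [div_le_iff₀ hε] at h2
  have h3 : ({x | inversePoint p x ∈ largeHeightRegion}.ncard : ℝ) ≤
      (largeHeightUnits p).ncard + 1 := by
    have hsub : {x | inversePoint p x ∈ largeHeightRegion} ⊆
        largeHeightUnits p ∪ {x | 2 * (x : ZMod p).val + 1 = p} := fun x hx => by
      by_cases h : 2 * (x : ZMod p).val + 1 = p
      · exact Or.inr h
      · exact Or.inl ⟨hx, h⟩
    have hone : {x : (ZMod p)ˣ | 2 * (x : ZMod p).val + 1 = p}.ncard ≤ 1 :=
      (Set.ncard_le_one (Set.toFinite _)).2 fun x hx y hy => Units.ext (ZMod.val_injective p (by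
        simp only [Set.mem_ofPred_eq] at hx hy; omega))
    exact_mod_cast (Set.ncard_le_ncard hsub (Set.toFinite _)).trans
      ((Set.ncard_union_le _ _).trans (Nat.add_le_add_left hone _))
  linarith

theorem exists_prime_lt_cycHeight_of_mem_largeHeightUnits {p q : ℕ} [Fact p.Prime]
    (hq : q.Prime) (hq2 : p * p ≤ q) {x : (ZMod p)ˣ} (hx : x ∈ largeHeightUnits p)
    (hqx : (q : ZMod p) = x) :
    ∃ r : ℕ, r.Prime ∧ q < r ∧ ((p : ℝ) + 1) / 2 < (cycHeight (p * q * r) : ℝ) := by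
  have hp : p.Prime := Fact.out
  have hp0 : (0 : ℝ) < p := by exact_mod_cast hp.pos
  obtain ⟨hU, hne⟩ := hx
  set β := (x : ZMod p).val with hβ
  set v := ((x : ZMod p)⁻¹).val with hv
  have hqβ : q % p = β := by rw [hβ, ← hqx, ZMod.val_natCast]
  have hβv : β * v ≡ 1 [MOD p] := by
    rw [← ZMod.natCast_eq_natCast_iff]
    push_cast
    rw [ZMod.natCast_zmod_val, ZMod.natCast_zmod_val, mul_inv_cancel₀ x.ne_zero]
  have hvp : v < p := ZMod.val_lt _
  have hv0 : 0 < v := ZMod.val_pos.2 (inv_ne_zero x.ne_zero)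
  suffices h : 2 * β + 1 < p ∧ ∃ r, r.Prime ∧ q < r ∧ p - β ≤ cycHeight (p * q * r) by
    obtain ⟨hβp, r, hr, hqr, h⟩ := h
    refine ⟨r, hr, hqr, ?_⟩
    have : (p : ℝ) + 2 ≤ 2 * (cycHeight (p * q * r) : ℝ) := by exact_mod_cast (by omega)
    linarith
  have hxe : (inversePoint p x).1 * p = β := div_mul_cancel₀ _ hp0.ne'
  have hye : (inversePoint p x).2 * p = v := div_mul_cancel₀ _ hp0.ne'
  have h2β (h : (inversePoint p x).1 < 1 / 2) : 2 * β + 1 < p := by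
    have : (2 * β : ℝ) < p := by nlinarith
    have : 2 * β < p := by exact_mod_cast this
    omega
  rcases hU with ⟨⟨h1, h2⟩, h3, h4⟩ | ⟨⟨h1, h2⟩, h3, h4⟩
  · have h5 : (p : ℝ) < β + v := by simp only at h3; nlinarith
    have h6 : (v : ℝ) < 2 * β := by simp only at h4; nlinarith
    exact ⟨h2β h2, exists_prime_le_cycHeight_of_le_add hp hq hqβ hβv hvp.le hq2 (h2β h2)
      (by exact_mod_cast h5.le) (by exact_mod_cast h6.le)⟩
  · have h5 : (p : ℝ) < β + 2 * v := by simp only at h3; nlinarith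
    have h6 : (v : ℝ) < β := by simp only at h4; nlinarith
    exact ⟨h2β h2, exists_prime_le_cycHeight_of_add_lt hp hq hqβ hβv hv0 hq2 (h2β h2)
      (by exact_mod_cast h6) (by exact_mod_cast h5)⟩

theorem beiterCount_le_primeCounting (p x : ℕ) : beiterCount p x ≤ Nat.primeCounting x := by
  rw [Nat.primeCounting, Nat.primeCounting', Nat.count_eq_card_filter_range,
    ← Set.ncard_coe_finset]
  refine Set.ncard_le_ncard (fun q hq => ?_) (Finset.finite_toSet _)
  simpa [Nat.lt_succ_iff] using ⟨hq.2.1, hq.2.2.1⟩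

theorem sum_card_le_beiterCount_add {p : ℕ} [Fact p.Prime] {B : Finset (ZMod p)ˣ}
    (hB : (B : Set (ZMod p)ˣ) ⊆ largeHeightUnits p) (n : ℕ) :
    ∑ x ∈ B, #((Icc 1 n).filter fun q : ℕ => q.Prime ∧ (q : ZMod p) = x) ≤
      beiterCount p n + p * p := by
  have hp2 := (Fact.out : p.Prime).two_le
  have hdisj : (B : Set (ZMod p)ˣ).PairwiseDisjoint
      fun x => (Icc 1 n).filter fun q : ℕ => q.Prime ∧ (q : ZMod p) = x := by
    intro x _ y _ hxy
    refine disjoint_left.2 fun q hqx hqy => hxy (Units.ext ?_)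
    rw [mem_filter] at hqx hqy
    exact hqx.2.2.symm.trans hqy.2.2
  rw [← card_biUnion hdisj, ← Set.ncard_coe_finset, beiterCount, ← card_range (p * p),
    ← Set.ncard_coe_finset (range _)]
  refine le_trans (Set.ncard_le_ncard (fun q hq => ?_) (Set.Finite.union ?_ (finite_toSet _)))
    (Set.ncard_union_le _ _)
  · simp only [coe_biUnion, Set.mem_iUnion, mem_coe, mem_filter, mem_Icc] at hq
    obtain ⟨x, hx, ⟨_, hqn⟩, hq, hqx⟩ := hq
    rcases lt_or_ge q (p * p) with h | h
    · exact Or.inr (mem_coe.2 (mem_range.2 h))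
    · exact Or.inl ⟨by nlinarith, hqn, hq,
        exists_prime_lt_cycHeight_of_mem_largeHeightUnits hq h (hB hx) hqx⟩
  · exact (Set.finite_Iic n).subset fun q hq => hq.2.1

theorem ncard_largeHeightUnits_div_le_lowerDelta {p : ℕ} [Fact p.Prime] :
    ((largeHeightUnits p).ncard : ℝ) / (p - 1 : ℕ) ≤ lowerDelta p := by
  classical
  have hm : (0 : ℝ) < (p - 1 : ℕ) := by
    exact_mod_cast Nat.sub_pos_of_lt (Fact.out : p.Prime).one_lt
  rw [Set.ncard_eq_toFinset_card']
  set B := (largeHeightUnits p).toFinset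
  refine le_of_forall_pos_sub_le fun ε hε => ?_
  have hcob : IsCoboundedUnder (· ≥ ·) atTop
      fun x : ℕ => (beiterCount p x : ℝ) / (Nat.primeCounting x : ℝ) :=
    (isBoundedUnder_of_eventually_le (a := 1) (Eventually.of_forall fun x =>
      div_le_one_of_le₀ (by exact_mod_cast beiterCount_le_primeCounting p x)
        (by positivity))).isCoboundedUnder_ge
  refine le_liminf_of_le hcob ?_
  have hη : 0 < ε / 2 / (#B + 1) := by positivity
  have hall := (eventually_all_finset B).2 fun x _ =>
    eventually_mul_primeCounting_le_card (q := p) x.isUnit hη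
  have hπ : ∀ᶠ n : ℕ in atTop, (p * p : ℝ) / (ε / 2) + 1 ≤ Nat.primeCounting n :=
    (tendsto_natCast_atTop_atTop.comp Nat.tendsto_primeCounting).eventually_ge_atTop _
  filter_upwards [hall, hπ] with n hn hπn
  have hπ0 : (0 : ℝ) < Nat.primeCounting n := lt_of_lt_of_le (by positivity) hπn
  have h1 := sum_le_sum hn
  rw [sum_const, nsmul_eq_mul, Nat.totient_prime Fact.out] at h1
  have h2 : ((∑ x ∈ B, #((Icc 1 n).filter fun q : ℕ => q.Prime ∧ (q : ZMod p) = x) : ℕ) : ℝ) ≤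
      beiterCount p n + p * p := by
    exact_mod_cast sum_card_le_beiterCount_add (Set.coe_toFinset _).subset n
  push_cast at h2
  have h3 : (p * p : ℝ) ≤ ε / 2 * Nat.primeCounting n := by
    have := (div_le_iff₀ (half_pos hε)).1 ((lt_add_one _).le.trans hπn)
    linarith
  have h4 : (#B : ℝ) * (ε / 2 / (#B + 1)) ≤ ε / 2 := by
    rw [mul_div_assoc', div_le_iff₀ (by positivity)]
    nlinarith
  rw [le_div_iff₀ hπ0, div_eq_mul_inv]
  have h5 := mul_le_mul_of_nonneg_right h4 hπ0.le
  linarith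

end

theorem stmt_12 :
    ∀ ε : ℝ, 0 < ε → ∃ P : ℕ, ∀ p : ℕ, p.Prime → P < p →
      1 / 16 - ε ≤ lowerDelta p := by
  intro ε hε
  obtain ⟨P, hP⟩ := exists_forall_mul_le_ncard_largeHeightUnits hε
  refine ⟨P, fun p hp hPp => ?_⟩
  have : Fact p.Prime := ⟨hp⟩
  have hm : (0 : ℝ) < (p - 1 : ℕ) := by exact_mod_cast Nat.sub_pos_of_lt hp.one_lt
  exact ((le_div_iff₀ hm).2 (hP p hPp)).trans ncard_largeHeightUnits_div_le_lowerDelta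
end

section
/- Let p be a prime and let a, b, c, d be real numbers with 0 ≤ a < b < p and 0 ≤ c < d < p. Let 𝓘 denote the number of pairs of positive integers (x, y) with a ≤ x < b, c ≤ y < d, and xy ≡ 1 (mod p). Then |𝓘 − (b−a)(d−c)/p| < √p · (log p + 1.1)², where log denotes the natural logarithm. The same bound holds for the half-open rectangle (a,b] × (c,d]. -/
/-- The number of points `(x, y)` with positive integer coordinates lying in the
set `S ⊆ ℝ²` and satisfying `x y ≡ 1 (mod p)`. -/
noncomputable def invCount (p : ℕ) (S : Set (ℝ × ℝ)) : ℕ :=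
  ({xy : ℕ × ℕ | 0 < xy.1 ∧ 0 < xy.2 ∧ ((xy.1 : ℝ), (xy.2 : ℝ)) ∈ S ∧
    xy.1 * xy.2 ≡ 1 [MOD p]}).ncard

open Polynomial

section Stepanov

variable {K : Type*} [Field K]

/-- Uniqueness of base-`X ^ Q` expansions with digits of degree less than `Q`. -/
lemma eq_zero_of_eval_X_pow_eq_zero {Q : ℕ} (P : K[X][X])
    (hP : ∀ i, (P.coeff i).natDegree < Q) (h : P.eval (X ^ Q) = 0) : P = 0 := by
  induction hn : P.natDegree using Nat.strong_induction_on generalizing P with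
  | _ n ih =>
    have hdecomp := P.divX_mul_X_add
    have hev : P.divX.eval (X ^ Q) * X ^ Q + P.coeff 0 = 0 := by
      rw [← h]; conv_rhs => rw [← hdecomp]
      simp
    have h0 : P.coeff 0 = 0 := by
      have hd : (X ^ Q : K[X]) ∣ P.coeff 0 :=
        ⟨-P.divX.eval (X ^ Q), by linear_combination hev⟩
      by_contra hne
      have := natDegree_le_of_dvd hd hne
      rw [natDegree_X_pow] at this
      exact absurd (hP 0) (by omega)
    have hdiv : P.divX.eval (X ^ Q) = 0 := by
      rw [h0, add_zero] at hev
      exact (mul_eq_zero.mp hev).resolve_right (pow_ne_zero _ X_ne_zero)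
    rw [h0] at hdecomp
    have hdX : P.divX = 0 := by
      by_cases hn0 : n = 0
      · rw [hn0] at hn
        rw [eq_C_of_natDegree_eq_zero hn, divX_C]
      · refine ih (P.divX.natDegree) ?_ P.divX (fun i => ?_) hdiv rfl
        · rw [natDegree_divX_eq_natDegree_tsub_one]; omega
        · rw [coeff_divX]; exact hP _
    rw [← hdecomp, hdX]; simp

lemma natDegree_coeff_mul_le {a b : ℕ} {A B : K[X][X]} (hA : ∀ i, (A.coeff i).natDegree ≤ a)
    (hB : ∀ i, (B.coeff i).natDegree ≤ b) (i : ℕ) : ((A * B).coeff i).natDegree ≤ a + b := by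
  rw [coeff_mul]
  exact natDegree_sum_le_of_forall_le _ _ fun x _ => natDegree_mul_le_of_le (hA _) (hB _)

lemma eq_zero_of_eval_add_pow_mul_eval_eq_zero (p : ℕ) [Fact p.Prime] [CharP K p] {m g D : ℕ}
    (hQ : p ^ m = 2 * g + 1) {f : K[X]} (hf : Squarefree f) (hfu : ¬ IsUnit f)
    (hD : 2 * D + f.natDegree < p ^ m) {A B : K[X][X]} (hA : ∀ i, (A.coeff i).natDegree ≤ D)
    (hB : ∀ i, (B.coeff i).natDegree ≤ D)
    (h : A.eval (X ^ p ^ m) + f ^ (g + 1) * B.eval (X ^ p ^ m) = 0) : A = 0 ∧ B = 0 := by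
  set F : K[X][X] := (f.map (iterateFrobenius K p m)).map C with hF
  have hf0 : f ≠ 0 := hf.ne_zero
  have hFev : F.eval (X ^ p ^ m) = f ^ p ^ m := by
    rw [← map_iterateFrobenius_expand p f m, hF, map_expand, expand_eq_comp_X_pow, comp, eval_map]
  have hP : A ^ 2 - C f * F * B ^ 2 = 0 := by
    apply eq_zero_of_eval_X_pow_eq_zero (Q := p ^ m)
    · intro i
      have h1 := natDegree_coeff_mul_le hA hA i
      have h2 := natDegree_coeff_mul_le (A := C f * F) (a := f.natDegree)
        (natDegree_coeff_mul_le (a := f.natDegree) (b := 0)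
          (fun i => by rw [coeff_C]; split_ifs <;> simp)
          (fun i => by rw [hF, coeff_map]; simp)) (natDegree_coeff_mul_le hB hB) i
      rw [coeff_sub, pow_two, pow_two]
      refine (natDegree_sub_le _ _).trans_lt (max_lt ?_ ?_) <;> omega
    · simp only [eval_sub, eval_mul, eval_pow, eval_C, hFev]
      have : A.eval (X ^ p ^ m) = -(f ^ (g + 1) * B.eval (X ^ p ^ m)) := by linear_combination h
      rw [this, hQ]; ring
  have hB0 : B = 0 := by
    by_contra hne
    have hl := congrArg leadingCoeff (sub_eq_zero.mp hP)
    have hFl : F.leadingCoeff = C (f.leadingCoeff ^ p ^ m) := by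
      rw [hF, leadingCoeff_map_of_injective C_injective, leadingCoeff_map, iterateFrobenius_def]
    rw [leadingCoeff_pow, leadingCoeff_mul, leadingCoeff_mul, leadingCoeff_pow, leadingCoeff_C,
      hFl] at hl
    have hb : B.leadingCoeff ≠ 0 := leadingCoeff_ne_zero.mpr hne
    obtain ⟨e, he⟩ := (IsIntegrallyClosed.pow_dvd_pow_iff (two_ne_zero)).mp
      (Dvd.intro_left _ hl.symm)
    have hc : f.leadingCoeff ^ p ^ m ≠ 0 := pow_ne_zero _ (leadingCoeff_ne_zero.mpr hf0)
    have he2 : e * e = f * C (f.leadingCoeff ^ p ^ m) := by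
      apply mul_left_cancel₀ (pow_ne_zero 2 hb)
      rw [he] at hl
      linear_combination hl
    have hcu : IsUnit (C (f.leadingCoeff ^ p ^ m)) := isUnit_C.mpr (isUnit_iff_ne_zero.mpr hc)
    have heu : IsUnit e := hf e (hcu.dvd_mul_right.mp (dvd_of_eq he2))
    exact hfu (isUnit_of_mul_isUnit_left (he2 ▸ heu.mul heu))
  refine ⟨?_, hB0⟩
  simpa [hB0] using hP

variable [Fintype K]

lemma natCard_degreeLT (n : ℕ) : Nat.card (degreeLT K n) = Nat.card K ^ n := by
  rw [Nat.card_congr (degreeLTEquiv K n).toEquiv]; simp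

lemma exists_auxiliary_coefficients (p : ℕ) [Fact p.Prime] [CharP K p] {m e D J : ℕ}
    (f : K[X]) (ε : K)
    (hN : p ^ m * D + J + e * f.natDegree < 2 * J * (D + 1)) :
    ∃ r s : Fin J → K[X], (∀ j, (r j).natDegree ≤ D) ∧ (∀ j, (s j).natDegree ≤ D) ∧
      ¬ (r = 0 ∧ s = 0) ∧
      ∑ j, (r j ^ p ^ m + C ε * s j ^ p ^ m * f ^ e) * X ^ (j : ℕ) = 0 := by
  classical
  set N := p ^ m * D + J + e * f.natDegree with hNdef
  let T : (Fin J → K[X]) × (Fin J → K[X]) → K[X] := fun u =>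
    ∑ j, (u.1 j ^ p ^ m + C ε * u.2 j ^ p ^ m * f ^ e) * X ^ (j : ℕ)
  have hdeg : ∀ r s : Fin J → degreeLT K (D + 1),
      T (fun j => r j, fun j => s j) ∈ degreeLT K N := by
    intro r s
    refine Submodule.sum_mem _ fun j _ => ?_
    have hnd : ∀ q : degreeLT K (D + 1), (q : K[X]).natDegree ≤ D := fun q =>
      Nat.lt_succ_iff.mp (by
        by_cases h0 : (q : K[X]) = 0
        · rw [h0]; simp
        · exact (natDegree_lt_iff_degree_lt h0).mpr (mem_degreeLT.mp q.2))
    have hpw : ∀ q : degreeLT K (D + 1), ((q : K[X]) ^ p ^ m).natDegree ≤ p ^ m * D := fun q =>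
      natDegree_pow_le_of_le _ (hnd q)
    have hterm : (((r j : K[X]) ^ p ^ m + C ε * (s j : K[X]) ^ p ^ m * f ^ e) *
        X ^ (j : ℕ)).natDegree ≤ (p ^ m * D + e * f.natDegree) + j := by
      refine natDegree_mul_le_of_le (natDegree_add_le_of_degree_le ((hpw _).trans (by omega)) ?_)
        (natDegree_X_pow_le _)
      exact natDegree_mul_le_of_le ((natDegree_C_mul_le _ _).trans (hpw _))
        natDegree_pow_le
    rw [mem_degreeLT]
    refine (natDegree_le_iff_degree_le.mp hterm).trans_lt ?_
    have := j.2
    exact_mod_cast (by omega : p ^ m * D + e * f.natDegree + (j : ℕ) < N)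
  let Φ : (Fin J → degreeLT K (D + 1)) × (Fin J → degreeLT K (D + 1)) → degreeLT K N :=
    fun u => ⟨T (fun j => u.1 j, fun j => u.2 j), hdeg u.1 u.2⟩
  have hfin : ∀ n, Finite (degreeLT K n) := fun n => Finite.of_equiv _ (degreeLTEquiv K n).symm.toEquiv
  have hninj : ¬ Function.Injective Φ := by
    intro hinj
    have := Nat.card_le_card_of_injective Φ hinj
    rw [Nat.card_prod, Nat.card_fun, natCard_degreeLT, natCard_degreeLT, ← pow_mul, ← pow_add,
      Nat.card_eq_fintype_card (α := Fin J), Fintype.card_fin] at this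
    have h2 := (Nat.pow_le_pow_iff_right (Finite.one_lt_card (α := K))).mp this
    nlinarith
  rw [Function.not_injective_iff] at hninj
  obtain ⟨u, v, huv, hne⟩ := hninj
  have hT : T (fun j => u.1 j, fun j => u.2 j) = T (fun j => v.1 j, fun j => v.2 j) :=
    congrArg Subtype.val huv
  have hnd : ∀ q : degreeLT K (D + 1), (q : K[X]).natDegree ≤ D := fun q =>
    Nat.lt_succ_iff.mp (by
      by_cases h0 : (q : K[X]) = 0
      · rw [h0]; simp
      · exact (natDegree_lt_iff_degree_lt h0).mpr (mem_degreeLT.mp q.2))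
  refine ⟨fun j => ((u.1 j - v.1 j : degreeLT K (D + 1)) : K[X]),
    fun j => ((u.2 j - v.2 j : degreeLT K (D + 1)) : K[X]), fun j => hnd _, fun j => hnd _, ?_, ?_⟩
  · rintro ⟨h1, h2⟩
    apply hne
    refine Prod.ext (funext fun j => ?_) (funext fun j => ?_)
    · exact sub_eq_zero.mp (Subtype.ext (congrFun h1 j))
    · exact sub_eq_zero.mp (Subtype.ext (congrFun h2 j))
  · rw [← sub_eq_zero.mpr hT, ← Finset.sum_sub_distrib]
    refine Finset.sum_congr rfl fun j _ => ?_
    simp only [Submodule.coe_sub, sub_pow_expChar_pow]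
    ring

/-- Stepanov's method: the number of `x` at which `f ^ ((q - 1) / 2)` takes a given value, over a
field with `q = Q ^ 2` elements. -/
lemma two_mul_card_pow_eq_le (p : ℕ) [Fact p.Prime] [CharP K p] {m g : ℕ}
    (hQ : p ^ m = 2 * g + 1) (hK : Fintype.card K = (p ^ m) ^ 2) [DecidableEq K]
    {f : K[X]} (hf : Squarefree f) (hd : 0 < f.natDegree) (hg : 2 * f.natDegree ≤ g) (ε : K) :
    2 * (Finset.univ.filter fun x => f.eval x ^ (Fintype.card K / 2) = ε).card ≤
      Fintype.card K + 4 * f.natDegree * p ^ m := by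
  set d := f.natDegree with hdd
  obtain ⟨D, hD⟩ : ∃ D, g = D + d := ⟨g - d, by omega⟩
  have hfu : ¬ IsUnit f := fun h => by
    have := natDegree_eq_zero_of_isUnit h; omega
  have hN : p ^ m * D + (g + d) + (g + 1) * d < 2 * (g + d) * (D + 1) := by
    rw [hQ, hD]; rw [hD] at hg; nlinarith
  obtain ⟨r, s, hr, hs, hne, hT⟩ := exists_auxiliary_coefficients p (J := g + d) f ε hN
  set R : K[X] := ∑ j, (r j + s j * f ^ (g + 1)) * (X ^ p ^ m) ^ (j : ℕ) with hR
  have hR0 : R ≠ 0 := by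
    intro h0
    have key := eq_zero_of_eval_add_pow_mul_eval_eq_zero p hQ hf hfu (D := D) (by omega)
      (A := ∑ j, C (r j) * X ^ (j : ℕ)) (B := ∑ j, C (s j) * X ^ (j : ℕ))
      (fun i => by
        rw [finsetSum_coeff]
        refine natDegree_sum_le_of_forall_le _ _ fun j _ => ?_
        rw [coeff_C_mul_X_pow]; split_ifs
        · exact hr j
        · simp)
      (fun i => by
        rw [finsetSum_coeff]
        refine natDegree_sum_le_of_forall_le _ _ fun j _ => ?_
        rw [coeff_C_mul_X_pow]; split_ifs
        · exact hs j
        · simp)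
      (by
        rw [← h0, hR, eval_finsetSum, eval_finsetSum, Finset.mul_sum, ← Finset.sum_add_distrib]
        refine Finset.sum_congr rfl fun j _ => ?_
        simp only [eval_mul, eval_C, eval_pow, eval_X]; ring)
    have hcoeff : ∀ (t : Fin (g + d) → K[X]), ∑ j, C (t j) * X ^ (j : ℕ) = 0 → t = 0 := by
      intro t ht
      funext j
      have := congrArg (fun P => P.coeff (j : ℕ)) ht
      simpa [finsetSum_coeff, coeff_X_pow, Fin.val_inj] using this
    exact hne ⟨hcoeff r key.1, hcoeff s key.2⟩
  have hroot : ∀ x ∈ Finset.univ.filter (fun x => f.eval x ^ (Fintype.card K / 2) = ε),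
      R.IsRoot x := by
    intro x hx
    have hx : f.eval x ^ (Fintype.card K / 2) = ε := by simpa using hx
    have hexp : (g + 1) * p ^ m = Fintype.card K / 2 + (g + 1) := by
      have : Fintype.card K = 2 * (2 * g ^ 2 + 2 * g) + 1 := by rw [hK, hQ]; ring
      rw [this, hQ, show (2 * (2 * g ^ 2 + 2 * g) + 1) / 2 = 2 * g ^ 2 + 2 * g by omega]; ring
    have hpow : (R.eval x) ^ p ^ m = 0 := by
      have hTx := congrArg (eval x) hT
      rw [eval_zero] at hTx
      rw [← hTx, hR, eval_finsetSum, eval_finsetSum, ← iterateFrobenius_def, map_sum]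
      refine Finset.sum_congr rfl fun j _ => ?_
      simp only [iterateFrobenius_def, eval_mul, eval_add, eval_pow, eval_X, eval_C,
        mul_pow, add_pow_expChar_pow]
      have hxj : ((x ^ p ^ m) ^ (j : ℕ)) ^ p ^ m = x ^ (j : ℕ) := by
        rw [pow_right_comm, ← pow_mul x (p ^ m), ← pow_two, ← hK, FiniteField.pow_card]
      rw [← pow_mul (eval x f), hexp, pow_add, hx, hxj]
      ring
    exact pow_eq_zero_iff (by rw [hQ]; omega) |>.mp hpow
  have hcard : (Finset.univ.filter fun x => f.eval x ^ (Fintype.card K / 2) = ε).card ≤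
      R.natDegree := by
    refine le_trans (Multiset.card_le_card ?_) (card_roots' R)
    rw [Multiset.le_iff_subset (Finset.nodup _)]
    intro x hx
    exact (mem_roots hR0).mpr (hroot x hx)
  have hRdeg : R.natDegree ≤ D + (g + 1) * d + (p ^ m) * (g + d - 1) := by
    refine natDegree_sum_le_of_forall_le _ _ fun j _ => natDegree_mul_le_of_le ?_ ?_
    · refine natDegree_add_le_of_degree_le ((hr j).trans (by omega)) ?_
      exact natDegree_mul_le_of_le (hs j) natDegree_pow_le
    · rw [← pow_mul, natDegree_X_pow]
      exact Nat.mul_le_mul_left _ (by have := j.2; omega)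
  obtain ⟨c, hc⟩ : ∃ c, g + d = c + 1 := ⟨g + d - 1, by omega⟩
  rw [hc, Nat.add_sub_cancel] at hRdeg
  have hmul : (2 * g + 1) * c + (2 * g + 1) = (2 * g + 1) * (g + d) := by rw [hc]; ring
  have hfinal : 2 * (D + (g + 1) * d + p ^ m * c) ≤ Fintype.card K + 4 * d * p ^ m := by
    rw [hK, hQ]; nlinarith
  omega

lemma abs_sum_quadraticChar_eval_le (p : ℕ) [Fact p.Prime] [CharP K p] {m g : ℕ}
    (hQ : p ^ m = 2 * g + 1) (hK : Fintype.card K = (p ^ m) ^ 2) [DecidableEq K]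
    {f : K[X]} (hf : Squarefree f) (hd : 0 < f.natDegree) (hg : 2 * f.natDegree ≤ g) :
    |∑ x, quadraticChar K (f.eval x)| ≤ 5 * f.natDegree * p ^ m := by
  have hodd : Fintype.card K % 2 = 1 := by
    rw [hK, hQ, Nat.pow_mod]; simp [Nat.add_mod]
  have hchar : ringChar K ≠ 2 := by
    intro h
    have := FiniteField.even_card_of_char_two h
    omega
  have hne : (1 : K) ≠ -1 := (Ring.neg_one_ne_one_of_char_ne_two hchar).symm
  have h1 := two_mul_card_pow_eq_le p hQ hK hf hd hg (1 : K)
  have h2 := two_mul_card_pow_eq_le p hQ hK hf hd hg (-1 : K)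
  have h3 : (Finset.univ.filter fun x => f.eval x = 0).card ≤ f.natDegree := by
    refine le_trans (Multiset.card_le_card ?_) (card_roots' f)
    rw [Multiset.le_iff_subset (Finset.nodup _)]
    intro x hx
    exact (mem_roots hf.ne_zero).mpr (by simpa using hx)
  have hval : ∀ x : K, quadraticChar K (f.eval x) =
      (if f.eval x ^ (Fintype.card K / 2) = 1 then 1 else 0) -
        (if f.eval x ^ (Fintype.card K / 2) = -1 then 1 else 0) ∧
      (1 : ℤ) = (if f.eval x ^ (Fintype.card K / 2) = 1 then 1 else 0) +
        (if f.eval x ^ (Fintype.card K / 2) = -1 then 1 else 0) +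
        (if f.eval x = 0 then 1 else 0) := by
    intro x
    have hq := quadraticChar_eq_pow_of_char_ne_two' hchar (f.eval x)
    have hpos : Fintype.card K / 2 ≠ 0 := by
      have := Fintype.one_lt_card (α := K); omega
    by_cases h0 : f.eval x = 0
    · simp [h0, hpos]
    · rcases quadraticChar_dichotomy h0 with h | h
      · rw [h] at hq
        simp only [Int.cast_one] at hq
        simp [h, ← hq, h0, hne]
      · rw [h] at hq
        simp only [Int.cast_neg, Int.cast_one] at hq
        simp [h, ← hq, h0, hne.symm]
  have hs := Finset.sum_congr (rfl : (Finset.univ : Finset K) = _) fun x _ => (hval x).1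
  have ht := Finset.sum_congr (rfl : (Finset.univ : Finset K) = _) fun x _ => (hval x).2
  simp only [Finset.sum_sub_distrib, Finset.sum_add_distrib, Finset.sum_boole,
    Finset.sum_const, Finset.card_univ, nsmul_eq_mul, mul_one] at hs ht
  rw [hs]
  have hdQ : f.natDegree ≤ f.natDegree * p ^ m :=
    Nat.le_mul_of_pos_right _ (by rw [hQ]; omega)
  rw [show (5 * f.natDegree * p ^ m : ℤ) = 5 * ((f.natDegree * p ^ m : ℕ) : ℤ) by push_cast; ring]
  rw [show 4 * f.natDegree * p ^ m = 4 * (f.natDegree * p ^ m) by ring] at h1 h2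
  rw [abs_le]
  constructor <;> omega

end Stepanov

section Kloosterman

/-- The Kloosterman sum `∑ ψ (x + a / x)` over the nonzero elements of a finite field. -/
noncomputable def kloosterman {K : Type*} [Field K] [Fintype K] [DecidableEq K]
    (ψ : AddChar K ℂ) (a : K) : ℂ :=
  ∑ x, if x = 0 then 0 else ψ (x + a / x)

variable {K : Type*} [Field K] [Fintype K] [DecidableEq K]

lemma sum_comp_sq_eq (h2 : ringChar K ≠ 2) (G : K → ℂ) :
    ∑ t, G (t ^ 2) = ∑ u, G u * (1 + quadraticChar K u) := by
  rw [← Finset.sum_fiberwise_of_maps_to (s := Finset.univ) (t := Finset.univ)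
    (g := fun t : K => t ^ 2) (fun _ _ => Finset.mem_univ _)]
  refine Finset.sum_congr rfl fun u _ => ?_
  rw [Finset.sum_congr rfl (g := fun _ => G u) (fun t ht => by
    rw [(Finset.mem_filter.mp ht).2]), Finset.sum_const, nsmul_eq_mul, mul_comm]
  congr 1
  have h := quadraticChar_card_sqrts h2 u
  have h' : ((Finset.univ.filter fun t : K => t ^ 2 = u).card : ℤ) = quadraticChar K u + 1 := by
    rw [← h]; congr 2; ext t; simp
  rw [add_comm]
  exact_mod_cast congrArg (Int.cast : ℤ → ℂ) h'

lemma sum_comp_sq_add_sum_comp_mul_sq (h2 : ringChar K ≠ 2) {δ : K} (hδ : quadraticChar K δ = -1)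
    (G : K → ℂ) : ∑ t, (G (t ^ 2) + G (δ * t ^ 2)) = 2 * ∑ u, G u := by
  have hδ0 : δ ≠ 0 := by rintro rfl; simp at hδ
  have h : ∑ u, G (δ * u) * (1 + quadraticChar K u) = ∑ u, G u * (1 - quadraticChar K u) := by
    refine Fintype.sum_equiv (Equiv.mulLeft₀ δ hδ0) _ _ fun u => ?_
    rw [Equiv.mulLeft₀_apply, map_mul, hδ]
    push_cast
    ring
  rw [Finset.sum_add_distrib, sum_comp_sq_eq h2 G, sum_comp_sq_eq h2 (fun u => G (δ * u)), h,
    ← Finset.sum_add_distrib, Finset.mul_sum]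
  exact Finset.sum_congr rfl fun u _ => by ring

lemma kloosterman_sq (h2 : ringChar K ≠ 2) (ψ : AddChar K ℂ) (a : K) :
    kloosterman ψ a ^ 2 = ∑ s, ∑ t, if s ^ 2 - t ^ 2 = 0 then 0 else
      ψ (2 * s * (1 + a / (s ^ 2 - t ^ 2))) := by
  have h20 : (2 : K) ≠ 0 := Ring.two_ne_zero h2
  let e : K × K ≃ K × K :=
    { toFun := fun z => (z.1 + z.2, z.1 - z.2)
      invFun := fun z => ((z.1 + z.2) / 2, (z.1 - z.2) / 2)
      left_inv := fun z => by ext <;> simp <;> field_simp <;> ring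
      right_inv := fun z => by ext <;> simp <;> field_simp <;> ring }
  rw [pow_two, kloosterman, Finset.sum_mul_sum, ← Fintype.sum_prod_type', ← Fintype.sum_prod_type']
  refine (Fintype.sum_equiv e _ _ fun z => ?_).symm
  obtain ⟨s, t⟩ := z
  have hst : s ^ 2 - t ^ 2 = (s + t) * (s - t) := by ring
  simp only [e, Equiv.coe_fn_mk, hst, mul_eq_zero]
  by_cases h1 : s + t = 0
  · simp [h1]
  by_cases h3 : s - t = 0
  · simp [h3]
  simp only [h1, h3, or_self, if_false]
  rw [← AddChar.map_add_eq_mul]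
  congr 1
  field_simp
  ring

lemma sum_norm_form_eq (h2 : ringChar K ≠ 2) {ψ : AddChar K ℂ} (hψ : ψ ≠ 1) {a : K} (ha : a ≠ 0)
    {δ : K} (hδ : quadraticChar K δ = -1) :
    (∑ s, ∑ t, if s ^ 2 - δ * t ^ 2 = 0 then 0 else
      ψ (2 * s * (1 + a / (s ^ 2 - δ * t ^ 2)))) =
      2 * Fintype.card K - kloosterman ψ a ^ 2 := by
  have h20 : (2 : K) ≠ 0 := Ring.two_ne_zero h2
  rw [kloosterman_sq h2, eq_sub_iff_add_eq, ← Finset.sum_add_distrib]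
  have hs : ∀ s : K, (∑ t, if s ^ 2 - δ * t ^ 2 = 0 then 0 else
      ψ (2 * s * (1 + a / (s ^ 2 - δ * t ^ 2)))) + (∑ t, if s ^ 2 - t ^ 2 = 0 then 0 else
      ψ (2 * s * (1 + a / (s ^ 2 - t ^ 2)))) =
      2 * ∑ n, if n = 0 then 0 else ψ (2 * s * (1 + a / n)) := by
    intro s
    rw [← Finset.sum_add_distrib]
    have := sum_comp_sq_add_sum_comp_mul_sq h2 hδ
      (fun u => if s ^ 2 - u = 0 then 0 else ψ (2 * s * (1 + a / (s ^ 2 - u))))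
    rw [Finset.sum_congr rfl fun t _ => add_comm _ _, this]
    congr 1
    exact Fintype.sum_equiv (Equiv.subLeft (s ^ 2)) _ _ fun u => rfl
  rw [Finset.sum_congr rfl fun s _ => hs s, ← Finset.mul_sum, Finset.sum_comm]
  congr 1
  have hprim : ψ.IsPrimitive := AddChar.IsPrimitive.of_ne_one hψ
  have hn : ∀ n : K, (∑ s, if n = 0 then 0 else ψ (2 * s * (1 + a / n))) =
      if n = -a then (Fintype.card K : ℂ) else 0 := by
    intro n
    by_cases hn0 : n = 0
    · subst hn0; simp [ha]
    simp only [hn0, if_false]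
    have := AddChar.sum_mulShift (2 * (1 + a / n)) hprim
    rw [Finset.sum_congr rfl fun s _ => by rw [show 2 * s * (1 + a / n) = s * (2 * (1 + a / n)) by ring],
      this]
    have hiff : 2 * (1 + a / n) = 0 ↔ n = -a := by
      field_simp
      rw [eq_neg_iff_add_eq_zero]; simp [h20]
    simp [hiff]
  rw [Finset.sum_congr rfl fun n _ => hn n]
  simp

lemma exists_quadratic_extension {p : ℕ} [Fact p.Prime] {K : Type} [Field K] [Fintype K]
    [DecidableEq K] [CharP K p] (hp2 : p ≠ 2) {ψ : AddChar K ℂ} (hψ : ψ ≠ 1)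
    (hfrob : ∀ y, ψ (y ^ p) = ψ y) {a : K} (ha : a ≠ 0) :
    ∃ (L : Type) (_ : Field L) (_ : Fintype L) (_ : DecidableEq L) (_ : CharP L p)
      (φ : AddChar L ℂ) (b : L), φ ≠ 1 ∧ (∀ y, φ (y ^ p) = φ y) ∧ b ≠ 0 ∧
      Fintype.card L = Fintype.card K ^ 2 ∧
      kloosterman φ b = 2 * Fintype.card K - kloosterman ψ a ^ 2 := by
  have h2 : ringChar K ≠ 2 := by rwa [ringChar.eq K p]
  have h20 : (2 : K) ≠ 0 := Ring.two_ne_zero h2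
  obtain ⟨δ, hδ⟩ := quadraticChar_exists_neg_one h2
  have hns : ¬ IsSquare δ := quadraticChar_neg_one_iff_not_isSquare.mp hδ
  have hfact : Fact (∀ r : K, r ^ 2 ≠ δ + 0 * r) :=
    ⟨fun r hr => hns ⟨r, by rw [← pow_two, hr]; ring⟩⟩
  let : Fintype (QuadraticAlgebra K δ 0) :=
    Fintype.ofEquiv _ (QuadraticAlgebra.equivProd δ 0).symm
  have : CharP (QuadraticAlgebra K δ 0) p :=
    charP_of_injective_algebraMap (algebraMap K (QuadraticAlgebra K δ 0)).injective p
  let φ : AddChar (QuadraticAlgebra K δ 0) ℂ :=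
    { toFun := fun z => ψ (2 * z.re)
      map_zero_eq_one' := by rw [QuadraticAlgebra.re_zero, mul_zero, AddChar.map_zero_eq_one]
      map_add_eq_mul' := fun z w => by
        rw [QuadraticAlgebra.re_add, mul_add, AddChar.map_add_eq_mul] }
  have hφ : ∀ z : QuadraticAlgebra K δ 0, φ z = ψ (2 * z.re) := fun z => rfl
  refine ⟨QuadraticAlgebra K δ 0, inferInstance, inferInstance, inferInstance, inferInstance, φ,
    algebraMap K _ a, ?_, ?_, ?_, ?_, ?_⟩
  · intro h1
    apply hψ
    ext x
    have := DFunLike.congr_fun h1 (algebraMap K (QuadraticAlgebra K δ 0) (x / 2))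
    rw [hφ, QuadraticAlgebra.algebraMap_re, mul_div_cancel₀ _ h20] at this
    simpa using this
  · intro z
    have hre : ∀ w : QuadraticAlgebra K δ 0,
        algebraMap K (QuadraticAlgebra K δ 0) (2 * w.re) = w + star w := by
      intro w
      rw [← QuadraticAlgebra.algebraMap_trace_eq_add_star, QuadraticAlgebra.trace_def, zero_mul,
        add_zero]
    have : (2 * (z ^ p).re) = (2 * z.re) ^ p := by
      apply (algebraMap K (QuadraticAlgebra K δ 0)).injective
      rw [map_pow, hre, hre, star_pow, add_pow_char]
    rw [hφ, hφ, this, hfrob]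
  · simpa using ha
  · rw [Fintype.card_congr (QuadraticAlgebra.equivProd δ 0), Fintype.card_prod, pow_two]
  · rw [← sum_norm_form_eq h2 hψ ha hδ, kloosterman, ← Fintype.sum_prod_type']
    refine Fintype.sum_equiv (QuadraticAlgebra.equivProd δ 0) _ _ fun z => ?_
    change _ = if z.re ^ 2 - δ * z.im ^ 2 = 0 then 0 else
      ψ (2 * z.re * (1 + a / (z.re ^ 2 - δ * z.im ^ 2)))
    have hnorm : QuadraticAlgebra.norm z = z.re ^ 2 - δ * z.im ^ 2 := by
      rw [QuadraticAlgebra.norm_def]; ring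
    have hiff : z = 0 ↔ z.re ^ 2 - δ * z.im ^ 2 = 0 := by
      rw [← hnorm, QuadraticAlgebra.norm_eq_zero_iff_eq_zero]
    by_cases h0 : z = 0
    · rw [if_pos h0, if_pos (hiff.mp h0)]
    have hN : z.re ^ 2 - δ * z.im ^ 2 ≠ 0 := fun h => h0 (hiff.mpr h)
    have hdiv : algebraMap K (QuadraticAlgebra K δ 0) a / z =
        ⟨a * z.re / (z.re ^ 2 - δ * z.im ^ 2), -(a * z.im) / (z.re ^ 2 - δ * z.im ^ 2)⟩ := by
      rw [div_eq_iff h0]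
      ext
      · rw [QuadraticAlgebra.re_mul, QuadraticAlgebra.algebraMap_re]
        field_simp
        ring
      · rw [QuadraticAlgebra.im_mul, QuadraticAlgebra.algebraMap_im]
        field_simp
        ring
    rw [if_neg h0, if_neg hN, hφ, QuadraticAlgebra.re_add, hdiv]
    congr 1
    ring

end Kloosterman

section WeilBound

variable {K : Type*} [Field K] [Fintype K] [DecidableEq K]

lemma kloosterman_eq_sum_quadraticChar (h2 : ringChar K ≠ 2) {ψ : AddChar K ℂ} (hψ : ψ ≠ 1)
    {a : K} (ha : a ≠ 0) :
    kloosterman ψ a = ∑ u, ψ u * quadraticChar K (u ^ 2 - 4 * a) := by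
  have h20 : (2 : K) ≠ 0 := Ring.two_ne_zero h2
  have hcount : ∀ v : K, (1 + quadraticChar K v : ℂ) = ∑ t : K, if t ^ 2 = v then 1 else 0 := by
    intro v
    have := sum_comp_sq_eq h2 (fun u => if u = v then (1 : ℂ) else 0)
    simpa using this.symm
  have hsum : ∑ u, ψ u * quadraticChar K (u ^ 2 - 4 * a) =
      ∑ u, ∑ t, if t ^ 2 = u ^ 2 - 4 * a then ψ u else 0 := by
    have h0 := AddChar.sum_eq_zero_of_ne_one hψ
    have hadd : ∑ u, ψ u * quadraticChar K (u ^ 2 - 4 * a) =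
        ∑ u, ψ u + ∑ u, ψ u * quadraticChar K (u ^ 2 - 4 * a) := by rw [h0, zero_add]
    rw [hadd, ← Finset.sum_add_distrib]
    refine Finset.sum_congr rfl fun u _ => ?_
    rw [show ψ u + ψ u * quadraticChar K (u ^ 2 - 4 * a) =
      ψ u * (1 + quadraticChar K (u ^ 2 - 4 * a)) by ring, hcount, Finset.mul_sum]
    exact Finset.sum_congr rfl fun t _ => by split_ifs <;> simp
  let e : K × K ≃ K × K :=
    { toFun := fun z => ((z.1 + z.2) / 2, (z.1 - z.2) / 2)
      invFun := fun z => (z.1 + z.2, z.1 - z.2)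
      left_inv := fun z => by ext <;> simp <;> field_simp <;> ring
      right_inv := fun z => by ext <;> simp <;> field_simp <;> ring }
  have hchange : (∑ u, ∑ t, if t ^ 2 = u ^ 2 - 4 * a then ψ u else 0) =
      ∑ x, ∑ y, if x * y = a then ψ (x + y) else 0 := by
    rw [← Fintype.sum_prod_type', ← Fintype.sum_prod_type']
    refine Fintype.sum_equiv e _ _ fun z => ?_
    have hiff : z.2 ^ 2 = z.1 ^ 2 - 4 * a ↔ (z.1 + z.2) / 2 * ((z.1 - z.2) / 2) = a := by
      have h4 : (4 : K) ≠ 0 := by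
        rw [show (4 : K) = 2 * 2 by norm_num]; exact mul_ne_zero h20 h20
      rw [div_mul_div_comm, div_eq_iff (mul_ne_zero h20 h20)]
      constructor <;> intro h <;> linear_combination -h
    simp only [e, Equiv.coe_fn_mk, hiff]
    congr 2
    field_simp
    ring
  rw [hsum, hchange, kloosterman]
  refine Finset.sum_congr rfl fun x _ => ?_
  by_cases hx : x = 0
  · simp [hx, ha.symm]
  · have hiff : ∀ y, x * y = a ↔ y = a / x := fun y => by
      rw [eq_div_iff hx, mul_comm]
    simp [hx, hiff]

lemma squarefree_artinSchreier_sq_sub {K : Type*} [Field K] (p : ℕ) [Fact p.Prime] [CharP K p]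
    (h2 : ringChar K ≠ 2) {a : K} (ha : a ≠ 0) (c : K) :
    Squarefree ((X ^ p - X + C c) ^ 2 - C (4 * a) : K[X]) := by
  have h20 : (2 : K) ≠ 0 := Ring.two_ne_zero h2
  have h4 : (4 : K) * a ≠ 0 := by
    rw [show (4 : K) = 2 * 2 by norm_num]; exact mul_ne_zero (mul_ne_zero h20 h20) ha
  apply Polynomial.Separable.squarefree
  have hder : derivative ((X ^ p - X + C c) ^ 2 - C (4 * a) : K[X]) =
      -C 2 * (X ^ p - X + C c) := by
    have hX : derivative (X ^ p : K[X]) = 0 := by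
      rw [derivative_X_pow, CharP.cast_eq_zero, C_0, zero_mul]
    rw [derivative_sub, derivative_C, derivative_pow, derivative_add, derivative_sub, hX]
    simp
  rw [separable_def, hder]
  refine ⟨-C (1 / (4 * a)), -C (1 / (4 * a)) * C (1 / 2) * (X ^ p - X + C c), ?_⟩
  have e1 : C (1 / (4 * a)) * C (4 * a) = (1 : K[X]) := by
    rw [← C_mul, one_div_mul_cancel h4, C_1]
  have e2 : C (1 / 2) * C 2 = (1 : K[X]) := by
    rw [← C_mul, one_div_mul_cancel h20, C_1]
  linear_combination e1 + C (1 / (4 * a)) * (X ^ p - X + C c) ^ 2 * e2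

lemma natDegree_artinSchreier_sq_sub {K : Type*} [Field K] (p : ℕ) [hp : Fact p.Prime] (a c : K) :
    ((X ^ p - X + C c) ^ 2 - C (4 * a) : K[X]).natDegree = 2 * p := by
  have h1 : (X ^ p - X + C c : K[X]).natDegree = p := by
    rw [natDegree_add_C, natDegree_sub_eq_left_of_natDegree_lt, natDegree_X_pow]
    simpa using hp.out.one_lt
  rw [natDegree_sub_C, natDegree_pow, h1]

lemma norm_kloosterman_le_of_card_eq_sq (p : ℕ) [Fact p.Prime] [CharP K p] (hp2 : p ≠ 2) {m : ℕ}
    (hK : Fintype.card K = (p ^ m) ^ 2) (hm : 8 * p < p ^ m) {ψ : AddChar K ℂ} (hψ : ψ ≠ 1)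
    (hfrob : ∀ y, ψ (y ^ p) = ψ y) {a : K} (ha : a ≠ 0) :
    ‖kloosterman ψ a‖ ≤ 10 * p * p ^ m := by
  have h2 : ringChar K ≠ 2 := by rwa [ringChar.eq K p]
  have hodd : Odd (p ^ m) := (((Fact.out : p.Prime).eq_two_or_odd').resolve_left hp2).pow
  obtain ⟨g, hg⟩ := hodd
  have hbound : ∀ c : K, ‖∑ y : K, (quadraticChar K ((c + (y ^ p - y)) ^ 2 - 4 * a) : ℂ)‖ ≤
      10 * p * p ^ m := by
    intro c
    have h := abs_sum_quadraticChar_eval_le p hg hK (squarefree_artinSchreier_sq_sub p h2 ha c)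
      (by rw [natDegree_artinSchreier_sq_sub]; have := (Fact.out : p.Prime).pos; omega)
      (by rw [natDegree_artinSchreier_sq_sub]; omega)
    rw [natDegree_artinSchreier_sq_sub] at h
    have h' : ∑ y : K, (quadraticChar K ((c + (y ^ p - y)) ^ 2 - 4 * a) : ℂ) =
        ((∑ x, quadraticChar K (eval x ((X ^ p - X + C c) ^ 2 - C (4 * a) : K[X])) : ℤ) : ℂ) := by
      push_cast
      refine Finset.sum_congr rfl fun y _ => ?_
      simp [add_comm]
    rw [h', Complex.norm_intCast]
    have h3 : ((|∑ x, quadraticChar K (eval x ((X ^ p - X + C c) ^ 2 - C (4 * a) : K[X]))| : ℤ) : ℝ)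
      ≤ ((5 * (2 * p : ℕ) * p ^ m : ℤ) : ℝ) := by exact_mod_cast h
    rw [Int.cast_abs] at h3
    refine h3.trans (le_of_eq ?_)
    push_cast; ring
  have htriv : ∀ y : K, ψ (y ^ p - y) = 1 := by
    intro y
    rw [AddChar.map_sub_eq_div, hfrob, div_self (ψ.val_isUnit y).ne_zero]
  have havg : (Fintype.card K : ℂ) * kloosterman ψ a =
      ∑ u, ψ u * ∑ y : K, (quadraticChar K ((u + (y ^ p - y)) ^ 2 - 4 * a) : ℂ) := by
    have hy : ∀ y : K, ∑ u, ψ u * (quadraticChar K ((u + (y ^ p - y)) ^ 2 - 4 * a) : ℂ) =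
        kloosterman ψ a := by
      intro y
      rw [kloosterman_eq_sum_quadraticChar h2 hψ ha]
      refine Fintype.sum_equiv (Equiv.addRight (y ^ p - y)) _ _ fun u => ?_
      rw [Equiv.coe_addRight, AddChar.map_add_eq_mul, htriv, mul_one]
    simp_rw [Finset.mul_sum]
    rw [Finset.sum_comm, Finset.sum_congr rfl fun y _ => hy y, Finset.sum_const,
      Finset.card_univ, nsmul_eq_mul]
  have hq : (0 : ℝ) < Fintype.card K := by exact_mod_cast Fintype.card_pos
  have hnorm : (Fintype.card K : ℝ) * ‖kloosterman ψ a‖ ≤ Fintype.card K * (10 * p * p ^ m) := by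
    calc (Fintype.card K : ℝ) * ‖kloosterman ψ a‖ = ‖(Fintype.card K : ℂ) * kloosterman ψ a‖ := by
          rw [norm_mul, Complex.norm_natCast]
      _ ≤ ∑ u : K, (10 * p * p ^ m : ℝ) := by
          rw [havg]
          refine (norm_sum_le _ _).trans (Finset.sum_le_sum fun u _ => ?_)
          rw [norm_mul, AddChar.norm_apply, one_mul]
          exact hbound u
      _ = _ := by simp
  exact le_of_mul_le_mul_left hnorm hq

lemma exists_tower {p : ℕ} [Fact p.Prime] {K : Type} [Field K] [Fintype K]
    [DecidableEq K] [CharP K p] (hp2 : p ≠ 2) {ψ : AddChar K ℂ} (hψ : ψ ≠ 1)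
    (hfrob : ∀ y, ψ (y ^ p) = ψ y) (hK : Fintype.card K = p) {a : K} (ha : a ≠ 0)
    {δ : ℝ} (hδ : (2 + δ) * √p ≤ ‖kloosterman ψ a‖) (hδ0 : 0 ≤ δ) (k : ℕ) :
    ∃ (L : Type) (_ : Field L) (_ : Fintype L) (_ : DecidableEq L) (_ : CharP L p)
      (φ : AddChar L ℂ) (b : L), φ ≠ 1 ∧ (∀ y, φ (y ^ p) = φ y) ∧ b ≠ 0 ∧
      Fintype.card L = p ^ 2 ^ k ∧
      (2 + 4 ^ k * δ) * √p ^ 2 ^ k ≤ ‖kloosterman φ b‖ := by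
  induction k with
  | zero => exact ⟨K, inferInstance, inferInstance, inferInstance, inferInstance, ψ, a, hψ, hfrob,
      ha, by simpa using hK, by simpa using hδ⟩
  | succ k ih =>
    obtain ⟨L, _, _, _, _, φ, b, hφ, hφf, hb, hL, hle⟩ := ih
    obtain ⟨M, i1, i2, i3, i4, θ, c, hθ, hθf, hc, hM, heq⟩ :=
      exists_quadratic_extension hp2 hφ hφf hb
    refine ⟨M, i1, i2, i3, i4, θ, c, hθ, hθf, hc, by rw [hM, hL, ← pow_mul, pow_succ], ?_⟩
    rw [heq]
    have hcard : (Fintype.card L : ℝ) = (√p ^ 2 ^ k) ^ 2 := by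
      rw [hL, ← pow_mul, mul_comm, pow_mul, Real.sq_sqrt (Nat.cast_nonneg _)]; push_cast; rfl
    set S : ℝ := √p ^ 2 ^ k with hS
    have hS0 : 0 ≤ S := by positivity
    have h1 : ‖kloosterman φ b‖ ^ 2 - 2 * S ^ 2 ≤
        ‖2 * (Fintype.card L : ℂ) - kloosterman φ b ^ 2‖ := by
      have := norm_sub_norm_le (kloosterman φ b ^ 2) (2 * (Fintype.card L : ℂ))
      rw [norm_sub_rev, norm_pow, norm_mul, Complex.norm_natCast, hcard] at this
      simpa using this
    have h2 : ((2 + 4 ^ k * δ) * S) ^ 2 ≤ ‖kloosterman φ b‖ ^ 2 :=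
      pow_le_pow_left₀ (by positivity) hle 2
    have h3 : √p ^ 2 ^ (k + 1) = S ^ 2 := by rw [hS, ← pow_mul, pow_succ]
    rw [h3]
    refine le_trans ?_ h1
    have h4 : 0 ≤ (4 ^ k * δ) ^ 2 * S ^ 2 := by positivity
    rw [pow_succ]
    nlinarith

/-- **Weil's bound** for Kloosterman sums over a prime field. -/
theorem norm_kloosterman_le (p : ℕ) [Fact p.Prime] (hp2 : p ≠ 2) {ψ : AddChar (ZMod p) ℂ}
    (hψ : ψ ≠ 1) {a : ZMod p} (ha : a ≠ 0) : ‖kloosterman ψ a‖ ≤ 2 * √p := by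
  by_contra! hlt
  have hp : (0 : ℝ) < √p := Real.sqrt_pos.mpr (by exact_mod_cast (Fact.out : p.Prime).pos)
  have hp3 : 2 ≤ p := (Fact.out : p.Prime).two_le
  set δ : ℝ := ‖kloosterman ψ a‖ / √p - 2 with hδ
  have hδ0 : 0 < δ := by rw [hδ, sub_pos, lt_div_iff₀ hp]; exact hlt
  have hδe : (2 + δ) * √p ≤ ‖kloosterman ψ a‖ := by
    rw [hδ, add_sub_cancel, div_mul_cancel₀ _ hp.ne']
  obtain ⟨n, hn⟩ := exists_nat_gt (10 * p / δ)
  set k := n + 4 with hk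
  obtain ⟨L, _, _, _, _, φ, b, hφ, hφf, hb, hL, hle⟩ :=
    exists_tower hp2 hψ (fun y => by rw [ZMod.pow_card]) (ZMod.card p) ha hδe hδ0.le (k + 1)
  have hm : 8 * p < p ^ 2 ^ k := by
    have h5 : 5 ≤ 2 ^ k := by
      rw [hk, pow_add]; have := Nat.one_le_two_pow (n := n); omega
    calc 8 * p < 2 ^ 4 * p := by omega
      _ ≤ p ^ 4 * p := Nat.mul_le_mul_right _ (Nat.pow_le_pow_left hp3 4)
      _ = p ^ 5 := by ring
      _ ≤ _ := Nat.pow_le_pow_right (by omega) h5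
  have hup := norm_kloosterman_le_of_card_eq_sq p hp2 (m := 2 ^ k)
    (by rw [hL, ← pow_mul, pow_succ]) hm hφ hφf hb
  have hS : √p ^ 2 ^ (k + 1) = (p : ℝ) ^ 2 ^ k := by
    rw [pow_succ, mul_comm, pow_mul, Real.sq_sqrt (Nat.cast_nonneg _)]
  rw [hS] at hle
  have hpk : (0 : ℝ) < (p : ℝ) ^ 2 ^ k := by positivity
  have hcmp := le_of_mul_le_mul_right (hle.trans hup) hpk
  have h4 : (n : ℝ) ≤ 4 ^ (k + 1) := by
    have : n < 4 ^ (k + 1) := lt_trans (by omega : n < k + 1) (Nat.lt_pow_self (by norm_num))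
    exact_mod_cast this.le
  rw [div_lt_iff₀ hδ0] at hn
  nlinarith

end WeilBound

section Completion

open Finset

lemma sum_mul_addChar_eq {K : Type*} [Field K] [Fintype K] [DecidableEq K] {ψ : AddChar K ℂ}
    (hψ : ψ.IsPrimitive) (A : Finset K) (x : K) :
    ∑ h, (∑ s ∈ A, ψ (h * s)) * ψ (-(h * x)) = if x ∈ A then (Fintype.card K : ℂ) else 0 := by
  have h1 : ∀ h, (∑ s ∈ A, ψ (h * s)) * ψ (-(h * x)) = ∑ s ∈ A, ψ (h * (s - x)) := by
    intro h
    rw [sum_mul]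
    refine sum_congr rfl fun s _ => ?_
    rw [← AddChar.map_add_eq_mul]
    congr 1
    ring
  simp_rw [h1]
  rw [sum_comm]
  simp_rw [AddChar.sum_mulShift _ hψ, sub_eq_zero]
  simp

lemma norm_sum_addChar_mul_add_inv_le (p : ℕ) [Fact p.Prime] (hp2 : p ≠ 2)
    {ψ : AddChar (ZMod p) ℂ} (hψ : ψ ≠ 1) {h k : ZMod p} (hh : h ≠ 0) (hk : k ≠ 0) :
    ‖∑ x, ψ (-(h * x)) * ψ (-(k * x⁻¹))‖ ≤ 2 * √p + 1 := by
  have key : ∑ x, ψ (-(h * x)) * ψ (-(k * x⁻¹)) = kloosterman ψ (h * k) + 1 := by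
    have h1 : ∑ x, ψ (-(h * x)) * ψ (-(k * x⁻¹)) = ∑ y, ψ (y + h * k / y) := by
      refine Fintype.sum_equiv (Equiv.mulLeft₀ (-h) (neg_ne_zero.mpr hh)) _ _ fun x => ?_
      rw [← AddChar.map_add_eq_mul]
      change ψ (-(h * x) + -(k * x⁻¹)) = ψ (-h * x + h * k / (-h * x))
      congr 1
      by_cases hx : x = 0
      · simp [hx]
      · field_simp
    have h2 : (1 : ℂ) = ∑ y : ZMod p, if y = 0 then 1 else 0 := by simp
    rw [h1, kloosterman, h2, ← sum_add_distrib]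
    refine sum_congr rfl fun y _ => ?_
    by_cases hy : y = 0 <;> simp [hy]
  rw [key]
  refine (norm_add_le _ _).trans ?_
  rw [norm_one]
  gcongr
  exact norm_kloosterman_le p hp2 hψ (mul_ne_zero hh hk)

lemma sq_mul_card_filter_inv_eq {K : Type*} [Field K] [Fintype K] [DecidableEq K]
    {ψ : AddChar K ℂ} (hψ : ψ.IsPrimitive) (A B : Finset K) :
    (Fintype.card K : ℂ) ^ 2 * #{x ∈ A | x⁻¹ ∈ B} = ∑ h, ∑ k, (∑ s ∈ A, ψ (h * s)) *
      (∑ s ∈ B, ψ (k * s)) * ∑ x, ψ (-(h * x)) * ψ (-(k * x⁻¹)) := by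
  have h1 : (Fintype.card K : ℂ) ^ 2 * #{x ∈ A | x⁻¹ ∈ B} =
      ∑ x, (if x ∈ A then (Fintype.card K : ℂ) else 0) *
        (if x⁻¹ ∈ B then (Fintype.card K : ℂ) else 0) := by
    have : #{x ∈ A | x⁻¹ ∈ B} = #{x : K | x ∈ A ∧ x⁻¹ ∈ B} := by
      congr 1; ext; simp
    rw [this, card_filter, Nat.cast_sum, mul_sum]
    refine sum_congr rfl fun x _ => ?_
    by_cases h1 : x ∈ A <;> by_cases h2 : x⁻¹ ∈ B <;> simp [h1, h2, sq]
  rw [h1]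
  have h2 : ∀ x, (if x ∈ A then (Fintype.card K : ℂ) else 0) *
      (if x⁻¹ ∈ B then (Fintype.card K : ℂ) else 0) = ∑ h, ∑ k, (∑ s ∈ A, ψ (h * s)) *
        (∑ s ∈ B, ψ (k * s)) * (ψ (-(h * x)) * ψ (-(k * x⁻¹))) := by
    intro x
    rw [← sum_mul_addChar_eq hψ, ← sum_mul_addChar_eq hψ, sum_mul_sum]
    exact sum_congr rfl fun h _ => sum_congr rfl fun k _ => by ring
  rw [sum_congr rfl fun x _ => h2 x, sum_comm]
  refine sum_congr rfl fun h _ => ?_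
  rw [sum_comm]
  exact sum_congr rfl fun k _ => (mul_sum _ _ _).symm

lemma abs_card_filter_inv_sub_le (p : ℕ) [Fact p.Prime] (hp2 : p ≠ 2) {ψ : AddChar (ZMod p) ℂ}
    (hψ : ψ.IsPrimitive) (A B : Finset (ZMod p)) :
    |(#{x ∈ A | x⁻¹ ∈ B} : ℝ) - #A * #B / p| ≤ (2 * √p + 1) *
      ((∑ h ∈ {0}ᶜ, ‖∑ s ∈ A, ψ (h * s)‖) / p) * ((∑ h ∈ {0}ᶜ, ‖∑ s ∈ B, ψ (h * s)‖) / p) := by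
  have hp : (0 : ℝ) < p := by exact_mod_cast (Fact.out : p.Prime).pos
  have hψ1 : ψ ≠ 1 := by
    have := hψ one_ne_zero
    rwa [AddChar.mulShift_one] at this
  set F : ZMod p → ZMod p → ℂ := fun h k => (∑ s ∈ A, ψ (h * s)) *
      (∑ s ∈ B, ψ (k * s)) * ∑ x, ψ (-(h * x)) * ψ (-(k * x⁻¹)) with hF
  have hsum0 : ∀ h : ZMod p, h ≠ 0 → ∑ x, ψ (-(h * x)) = 0 := by
    intro h hh
    have := AddChar.sum_mulShift (-h) hψ
    rw [if_neg (neg_ne_zero.mpr hh), Nat.cast_zero] at this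
    rw [← this]
    exact sum_congr rfl fun x _ => by congr 1; ring
  have hF0 : F 0 0 = p * #A * #B := by
    simp only [hF, zero_mul, neg_zero, AddChar.map_zero_eq_one, mul_one, sum_const, card_univ,
      ZMod.card, nsmul_eq_mul]
    ring
  have hF1 : ∀ h, h ≠ 0 → F h 0 = 0 := by
    intro h hh
    simp only [hF, zero_mul, neg_zero, AddChar.map_zero_eq_one, mul_one, hsum0 h hh, mul_zero]
  have hF2 : ∀ k, k ≠ 0 → F 0 k = 0 := by
    intro k hk
    have : ∑ x, ψ (-(k * x⁻¹)) = 0 := by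
      rw [← hsum0 k hk]
      exact Fintype.sum_equiv (Equiv.inv (ZMod p)) _ _ fun x => rfl
    simp only [hF, zero_mul, neg_zero, AddChar.map_zero_eq_one, one_mul, this, mul_zero]
  have hsplit : ∑ h, ∑ k, F h k = p * #A * #B + ∑ h ∈ {0}ᶜ, ∑ k ∈ {0}ᶜ, F h k := by
    rw [Fintype.sum_eq_add_sum_compl 0, Fintype.sum_eq_add_sum_compl 0, hF0,
      sum_eq_zero (s := {0}ᶜ) fun k hk => hF2 k (by simpa using hk), add_zero]
    congr 1
    refine sum_congr rfl fun h hh => ?_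
    rw [Fintype.sum_eq_add_sum_compl 0, hF1 h (by simpa using hh), zero_add]
  have hmain := sq_mul_card_filter_inv_eq hψ A B
  rw [ZMod.card] at hmain
  have hnorm : ‖∑ h ∈ {0}ᶜ, ∑ k ∈ {0}ᶜ, F h k‖ ≤ (2 * √p + 1) *
      (∑ h ∈ {0}ᶜ, ‖∑ s ∈ A, ψ (h * s)‖) * ∑ h ∈ {0}ᶜ, ‖∑ s ∈ B, ψ (h * s)‖ := by
    rw [mul_assoc, sum_mul_sum, mul_sum]
    refine (norm_sum_le _ _).trans (sum_le_sum fun h hh => ?_)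
    rw [mul_sum]
    refine (norm_sum_le _ _).trans (sum_le_sum fun k hk => ?_)
    rw [norm_mul, norm_mul, mul_comm]
    gcongr
    exact norm_sum_addChar_mul_add_inv_le p hp2 hψ1 (by simpa using hh) (by simpa using hk)
  have hreal : ∑ h ∈ {0}ᶜ, ∑ k ∈ {0}ᶜ, F h k =
      (((p : ℝ) ^ 2 * (#{x ∈ A | x⁻¹ ∈ B} - #A * #B / p) : ℝ) : ℂ) := by
    have hpc : (p : ℂ) ≠ 0 := by exact_mod_cast hp.ne'
    have : ∑ h ∈ {0}ᶜ, ∑ k ∈ {0}ᶜ, F h k =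
        (p : ℂ) ^ 2 * #{x ∈ A | x⁻¹ ∈ B} - p * #A * #B := by
      rw [hmain, hsplit]; ring
    rw [this]
    push_cast
    field_simp
  rw [hreal, Complex.norm_real, Real.norm_eq_abs, abs_mul, abs_of_pos (by positivity)] at hnorm
  rw [mul_assoc, div_mul_div_comm, mul_div_assoc', le_div_iff₀ (by positivity)]
  linarith [hnorm]

lemma norm_sum_Ico_addChar_le (p : ℕ) [Fact p.Prime] {n₀ n₁ : ℕ} (hn : n₁ ≤ p)
    {h : ZMod p} (hh : h ≠ 0) :
    ‖∑ s ∈ (Ico n₀ n₁).image (Nat.cast : ℕ → ZMod p), ZMod.stdAddChar (h * s)‖ ≤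
      1 / Real.sin (Real.pi * h.val / p) := by
  have hp : (0 : ℝ) < p := by exact_mod_cast (Fact.out : p.Prime).pos
  have hv0 : (0 : ℝ) < h.val := by
    exact_mod_cast Nat.pos_of_ne_zero fun h0 => hh ((ZMod.val_eq_zero h).mp h0)
  have hv1 : (h.val : ℝ) < p := by exact_mod_cast ZMod.val_lt h
  have hsin : 0 < Real.sin (Real.pi * h.val / p) := by
    apply Real.sin_pos_of_pos_of_lt_pi
    · positivity
    · rw [div_lt_iff₀ hp]; exact mul_lt_mul_of_pos_left hv1 Real.pi_pos
  set z : ℂ := ZMod.stdAddChar h with hz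
  have hz1 : ‖z - 1‖ = 2 * Real.sin (Real.pi * h.val / p) := by
    have : z = Complex.exp (Complex.I * (2 * (Real.pi * h.val / p) : ℝ)) := by
      have h1 := ZMod.stdAddChar_coe (N := p) (h.val : ℤ)
      rw [Int.cast_natCast, ZMod.natCast_zmod_val] at h1
      rw [hz, h1]
      congr 1
      push_cast
      ring
    rw [this, Complex.norm_exp_I_mul_ofReal_sub_one, mul_div_cancel_left₀ _ two_ne_zero,
      Real.norm_of_nonneg (by positivity)]
  have hzne : z ≠ 1 := by
    intro h1
    rw [h1, sub_self, norm_zero] at hz1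
    linarith
  have hinj : Set.InjOn (Nat.cast : ℕ → ZMod p) (Ico n₀ n₁ : Finset ℕ) := by
    intro x hx y hy hxy
    simp only [coe_Ico, Set.mem_Ico] at hx hy
    have := congrArg ZMod.val hxy
    rwa [ZMod.val_cast_of_lt (by omega), ZMod.val_cast_of_lt (by omega)] at this
  have hgeom : ∑ s ∈ (Ico n₀ n₁).image (Nat.cast : ℕ → ZMod p), ZMod.stdAddChar (h * s) =
      ∑ n ∈ Ico n₀ n₁, z ^ n := by
    rw [sum_image hinj]
    refine sum_congr rfl fun n _ => ?_
    rw [hz, ← AddChar.map_nsmul_eq_pow, nsmul_eq_mul, mul_comm]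
  have hzn : ‖z‖ = 1 := AddChar.norm_apply _ _
  rw [hgeom]
  rcases le_total n₀ n₁ with hle | hle
  · rw [geom_sum_Ico hzne hle, norm_div, hz1, div_le_div_iff₀ (by positivity) hsin]
    have : ‖z ^ n₁ - z ^ n₀‖ ≤ 2 := by
      refine (norm_sub_le _ _).trans ?_
      rw [norm_pow, norm_pow, hzn, one_pow, one_pow]
      norm_num
    nlinarith
  · rw [Ico_eq_empty_of_le hle, sum_empty, norm_zero]
    positivity

lemma one_div_sin_le {y : ℝ} (h0 : 0 < y) (h1 : y ≤ Real.pi / 2) :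
    1 / Real.sin y ≤ 1 / y + 1 / 2 := by
  have hy : y < 1.6 := by linarith [Real.pi_lt_d2]
  have hs := Real.sin_gt_sub_cube h0
  have hpos : 0 < Real.sin y := Real.sin_pos_of_pos_of_lt_pi h0 (by linarith [Real.pi_pos])
  rw [div_add_div _ _ h0.ne' two_ne_zero, div_le_div_iff₀ hpos (by positivity)]
  have : (2 + y) * (y - y ^ 3 / 6) ≤ (2 + y) * Real.sin y :=
    mul_le_mul_of_nonneg_left hs.le (by positivity)
  have h3 : 0 ≤ y ^ 2 * (1 - y / 3 - y ^ 2 / 6) :=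
    mul_nonneg (sq_nonneg y) (by nlinarith)
  nlinarith

lemma sum_one_div_sin_le {m : ℕ} (hm : 1 ≤ m) :
    (∑ j ∈ Ico 1 (2 * m + 1), 1 / Real.sin (Real.pi * j / (2 * m + 1 : ℕ))) / (2 * m + 1 : ℕ) ≤
      2 / Real.pi * (1 + Real.log m) + 1 / 2 := by
  set p : ℕ := 2 * m + 1 with hp
  have hp0 : (0 : ℝ) < p := by positivity
  have hpi := Real.pi_pos
  set f : ℕ → ℝ := fun j => 1 / Real.sin (Real.pi * j / p) with hf
  have hrefl : ∑ j ∈ Ico (m + 1) p, f j = ∑ j ∈ Ico 1 (m + 1), f j := by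
    have h1 := sum_Ico_reflect f 1 (m := m + 1) (n := p) (by omega)
    rw [show p + 1 - (m + 1) = m + 1 by omega, Nat.add_sub_cancel] at h1
    rw [← h1]
    refine sum_congr rfl fun j hj => ?_
    rw [mem_Ico] at hj
    simp only [hf]
    rw [Nat.cast_sub (by omega), mul_sub, sub_div, mul_div_cancel_right₀ _ hp0.ne',
      Real.sin_pi_sub]
  have hbound : ∑ j ∈ Ico 1 (m + 1), f j ≤ ∑ j ∈ Ico 1 (m + 1), 
      (p / Real.pi * (j : ℝ)⁻¹ + 1 / 2) := by
    refine sum_le_sum fun j hj => ?_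
    rw [mem_Ico] at hj
    have hj0 : (0 : ℝ) < j := by exact_mod_cast hj.1
    have hj1 : (2 * j : ℝ) ≤ p := by exact_mod_cast (by omega : 2 * j ≤ p)
    refine (one_div_sin_le (by positivity) ?_).trans (le_of_eq ?_)
    · rw [div_le_div_iff₀ hp0 two_pos]; nlinarith
    · rw [one_div_div]; field_simp
  have hharm : ∑ j ∈ Ico 1 (m + 1), (j : ℝ)⁻¹ ≤ 1 + Real.log m := by
    refine le_trans (le_of_eq ?_) (harmonic_le_one_add_log m)
    rw [harmonic_eq_sum_Icc]
    push_cast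
    exact sum_congr (by ext; simp) fun _ _ => rfl
  rw [sum_add_distrib, ← mul_sum, sum_const, Nat.card_Ico, nsmul_eq_mul,
    Nat.add_sub_cancel] at hbound
  rw [← sum_Ico_consecutive f (by omega : 1 ≤ m + 1) (by omega : m + 1 ≤ p), hrefl,
    div_le_iff₀ hp0]
  have h1 : p / Real.pi * ∑ j ∈ Ico 1 (m + 1), (j : ℝ)⁻¹ ≤ p / Real.pi * (1 + Real.log m) :=
    mul_le_mul_of_nonneg_left hharm (by positivity)
  have h2 : (2 / Real.pi * (1 + Real.log m) + 1 / 2) * p =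
      2 * (p / Real.pi * (1 + Real.log m)) + p / 2 := by ring
  have h3 : (p : ℝ) = 2 * m + 1 := by rw [hp]; push_cast; ring
  rw [h2]
  linarith

lemma sum_norm_sum_Ico_addChar_le (p : ℕ) [Fact p.Prime] (hp2 : p ≠ 2) {n₀ n₁ : ℕ}
    (hn : n₁ ≤ p) :
    (∑ h ∈ {0}ᶜ, ‖∑ s ∈ (Ico n₀ n₁).image (Nat.cast : ℕ → ZMod p), ZMod.stdAddChar (h * s)‖) / p ≤
      0.6367 * (Real.log p + 1.1) := by
  have hp : (0 : ℝ) < p := by exact_mod_cast (Fact.out : p.Prime).pos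
  obtain ⟨m, hm⟩ := ((Fact.out : p.Prime).eq_two_or_odd').resolve_left hp2
  have hm1 : 1 ≤ m := by have := (Fact.out : p.Prime).two_le; omega
  have h1 : ∑ h ∈ {0}ᶜ, ‖∑ s ∈ (Ico n₀ n₁).image (Nat.cast : ℕ → ZMod p),
      ZMod.stdAddChar (h * s)‖ ≤ ∑ j ∈ Ico 1 p, 1 / Real.sin (Real.pi * j / p) := by
    refine (sum_le_sum fun h hh => norm_sum_Ico_addChar_le p hn (by simpa using hh)).trans
      (le_of_eq ?_)
    refine sum_nbij' ZMod.val Nat.cast ?_ ?_ ?_ ?_ ?_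
    · intro h hh
      have h0 : h.val ≠ 0 := fun h0 => by simp [(ZMod.val_eq_zero h).mp h0] at hh
      exact mem_Ico.mpr ⟨Nat.pos_of_ne_zero h0, ZMod.val_lt h⟩
    · intro j hj
      rw [mem_Ico] at hj
      rw [mem_compl, mem_singleton, ZMod.natCast_eq_zero_iff]
      exact Nat.not_dvd_of_pos_of_lt hj.1 hj.2
    · exact fun h _ => ZMod.natCast_zmod_val h
    · exact fun j hj => ZMod.val_cast_of_lt (mem_Ico.mp hj).2
    · exact fun _ _ => rfl
  have h2 := sum_one_div_sin_le hm1
  rw [← hm] at h2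
  refine ((div_le_div_iff_of_pos_right hp).mpr h1).trans (h2.trans ?_)
  have hm0 : (1 : ℝ) ≤ m := by exact_mod_cast hm1
  have hlog0 : 0 ≤ Real.log m := Real.log_nonneg hm0
  have hlog : Real.log 2 + Real.log m ≤ Real.log p := by
    rw [← Real.log_mul two_ne_zero (by positivity)]
    refine Real.log_le_log (by positivity) ?_
    rw [hm]; push_cast; linarith
  have hpi : 2 / Real.pi ≤ 0.6367 := by
    rw [div_le_iff₀ Real.pi_pos]; linarith [Real.pi_gt_d4]
  have h3 : 2 / Real.pi * (1 + Real.log m) ≤ 0.6367 * (1 + Real.log m) :=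
    mul_le_mul_of_nonneg_right hpi (by positivity)
  linarith [Real.log_two_gt_d9]

end Completion

section Rectangles

open Finset

lemma exists_nat_Ico_iff_mem_Ico {p : ℕ} {a b : ℝ} (ha : 0 ≤ a) (hab : a < b) (hbp : b < p) :
    ∃ n₀ n₁ : ℕ, n₀ ≤ n₁ ∧ 1 ≤ n₀ ∧ n₁ ≤ p ∧ |((n₁ - n₀ : ℕ) : ℝ) - (b - a)| ≤ 1 ∧
      ∀ x : ℕ, 0 < x → ((x : ℝ) ∈ Set.Ico a b ↔ x ∈ Ico n₀ n₁) := by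
  have hb0 : 0 < b := ha.trans_lt hab
  have hb1 : 1 ≤ ⌈b⌉₊ := Nat.ceil_pos.mpr hb0
  have hle : max 1 ⌈a⌉₊ ≤ ⌈b⌉₊ := max_le hb1 (Nat.ceil_mono hab.le)
  refine ⟨max 1 ⌈a⌉₊, ⌈b⌉₊, hle, le_max_left _ _, Nat.ceil_le.mpr hbp.le, ?_, fun x hx => ?_⟩
  · rw [Nat.cast_sub hle, abs_le]
    have h1 := Nat.le_ceil b
    have h2 := Nat.ceil_lt_add_one hb0.le
    have h3 := Nat.le_ceil a
    have h4 := Nat.ceil_lt_add_one ha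
    rcases ha.eq_or_lt with h0 | h0
    · rw [← h0, Nat.ceil_zero, max_eq_left zero_le_one, Nat.cast_one]
      constructor <;> linarith
    · rw [max_eq_right (Nat.ceil_pos.mpr h0)]
      constructor <;> linarith
  · rw [Set.mem_Ico, mem_Ico, max_le_iff, Nat.ceil_le, Nat.lt_ceil]
    exact ⟨fun h => ⟨⟨hx, h.1⟩, h.2⟩, fun h => ⟨h.1.2, h.2⟩⟩

lemma exists_nat_Ico_iff_mem_Ioc {p : ℕ} {a b : ℝ} (ha : 0 ≤ a) (hab : a < b) (hbp : b < p) :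
    ∃ n₀ n₁ : ℕ, n₀ ≤ n₁ ∧ 1 ≤ n₀ ∧ n₁ ≤ p ∧ |((n₁ - n₀ : ℕ) : ℝ) - (b - a)| ≤ 1 ∧
      ∀ x : ℕ, 0 < x → ((x : ℝ) ∈ Set.Ioc a b ↔ x ∈ Ico n₀ n₁) := by
  have hb0 : 0 ≤ b := ha.trans hab.le
  have hle : ⌊a⌋₊ + 1 ≤ ⌊b⌋₊ + 1 := Nat.succ_le_succ (Nat.floor_mono hab.le)
  refine ⟨⌊a⌋₊ + 1, ⌊b⌋₊ + 1, hle, by omega, (Nat.floor_lt hb0).mpr hbp, ?_, fun x hx => ?_⟩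
  · rw [Nat.cast_sub hle, abs_le]
    have h1 := Nat.floor_le hb0
    have h2 := Nat.lt_floor_add_one b
    have h3 := Nat.floor_le ha
    have h4 := Nat.lt_floor_add_one a
    push_cast
    constructor <;> linarith
  · rw [Set.mem_Ioc, mem_Ico, Nat.succ_le_iff, Nat.floor_lt ha, Nat.lt_succ_iff,
      Nat.le_floor_iff hb0]

lemma invCount_prod_eq_card (p : ℕ) [Fact p.Prime] {S T : Set ℝ} {n₀ n₁ m₀ m₁ : ℕ}
    (hn₀ : 1 ≤ n₀) (hn₁ : n₁ ≤ p) (hm₀ : 1 ≤ m₀) (hm₁ : m₁ ≤ p)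
    (hS : ∀ x : ℕ, 0 < x → ((x : ℝ) ∈ S ↔ x ∈ Ico n₀ n₁))
    (hT : ∀ x : ℕ, 0 < x → ((x : ℝ) ∈ T ↔ x ∈ Ico m₀ m₁)) :
    invCount p (S ×ˢ T) = #{x ∈ (Ico n₀ n₁).image (Nat.cast : ℕ → ZMod p) |
      x⁻¹ ∈ (Ico m₀ m₁).image (Nat.cast : ℕ → ZMod p)} := by
  have hset : {xy : ℕ × ℕ | 0 < xy.1 ∧ 0 < xy.2 ∧ ((xy.1 : ℝ), (xy.2 : ℝ)) ∈ S ×ˢ T ∧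
      xy.1 * xy.2 ≡ 1 [MOD p]} =
      ({xy ∈ Ico n₀ n₁ ×ˢ Ico m₀ m₁ | xy.1 * xy.2 ≡ 1 [MOD p]} : Finset (ℕ × ℕ)) := by
    ext ⟨x, y⟩
    simp only [Set.mem_ofPred_eq, mem_coe, mem_filter, mem_product, Set.mem_prod]
    constructor
    · rintro ⟨hx, hy, ⟨h1, h2⟩, h3⟩
      exact ⟨⟨(hS x hx).mp h1, (hT y hy).mp h2⟩, h3⟩
    · rintro ⟨⟨h1, h2⟩, h3⟩
      have hx : 0 < x := hn₀.trans (mem_Ico.mp h1).1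
      have hy : 0 < y := hm₀.trans (mem_Ico.mp h2).1
      exact ⟨hx, hy, ⟨(hS x hx).mpr h1, (hT y hy).mpr h2⟩, h3⟩
  have hmod : ∀ x y : ℕ, y ∈ Ico m₀ m₁ → (x * y ≡ 1 [MOD p] ↔ (x : ZMod p)⁻¹ = y) := by
    intro x y hy
    rw [mem_Ico] at hy
    have hy0 : (y : ZMod p) ≠ 0 := by
      rw [Ne, ZMod.natCast_eq_zero_iff]
      exact Nat.not_dvd_of_pos_of_lt (by omega) (by omega)
    rw [← ZMod.natCast_eq_natCast_iff, Nat.cast_mul, Nat.cast_one, inv_eq_iff_eq_inv,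
      mul_eq_one_iff_eq_inv₀ hy0]
  have hinj : ∀ x y : ℕ, x < p → y < p → (x : ZMod p) = y → x = y := by
    intro x y hx hy hxy
    have := congrArg ZMod.val hxy
    rwa [ZMod.val_cast_of_lt hx, ZMod.val_cast_of_lt hy] at this
  rw [invCount, hset, Set.ncard_coe_finset]
  refine card_nbij (fun xy => (xy.1 : ZMod p)) ?_ ?_ ?_
  · rintro ⟨x, y⟩ hxy
    simp only [mem_coe, mem_filter, mem_product] at hxy ⊢
    exact ⟨mem_image_of_mem _ hxy.1.1,
      mem_image.mpr ⟨y, hxy.1.2, ((hmod x y hxy.1.2).mp hxy.2).symm⟩⟩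
  · rintro ⟨x, y⟩ hxy ⟨x', y'⟩ hxy' heq
    simp only [mem_coe, mem_filter, mem_product] at hxy hxy' heq
    have e := (hmod x y hxy.1.2).mp hxy.2
    have e' := (hmod x' y' hxy'.1.2).mp hxy'.2
    simp only [mem_Ico] at hxy hxy'
    have h1 : x = x' := hinj _ _ (by omega) (by omega) heq
    have h2 : y = y' := hinj _ _ (by omega) (by omega) (by rw [← e, ← e', heq])
    rw [h1, h2]
  · intro z hz
    simp only [mem_coe, mem_filter, mem_image] at hz
    obtain ⟨⟨x, hx, rfl⟩, y, hy, hxy⟩ := hz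
    refine ⟨(x, y), ?_, rfl⟩
    simp only [mem_coe, mem_filter, mem_product]
    exact ⟨⟨hx, hy⟩, (hmod x y hy).mpr hxy.symm⟩

lemma abs_mul_div_sub_mul_div_le {p : ℝ} (hp : 0 < p) {s t u v : ℝ} (hs0 : 0 ≤ s) (hs : s ≤ p)
    (hv0 : 0 ≤ v) (hv : v ≤ p) (hsu : |s - u| ≤ 1) (htv : |t - v| ≤ 1) :
    |s * t / p - u * v / p| ≤ 2 := by
  rw [← sub_div, abs_div, abs_of_pos hp, div_le_iff₀ hp,
    show s * t - u * v = s * (t - v) + v * (s - u) by ring]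
  refine (abs_add_le _ _).trans ?_
  rw [abs_mul, abs_mul, abs_of_nonneg hs0, abs_of_nonneg hv0]
  nlinarith [abs_nonneg (s - u), abs_nonneg (t - v)]

lemma error_lt_of_eleven_le {p : ℕ} (hp : 11 ≤ p) :
    (2 * √p + 1) * (0.6367 * (Real.log p + 1.1)) * (0.6367 * (Real.log p + 1.1)) + 2 <
      √p * (Real.log p + 1.1) ^ 2 := by
  have hp' : (11 : ℝ) ≤ p := by exact_mod_cast hp
  have hsqrt : 3.316 ≤ √(p : ℝ) := Real.le_sqrt_of_sq_le (by linarith)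
  have hlog : 3.4 * Real.log 2 ≤ Real.log p := by
    have h1 : Real.log ((2 : ℝ) ^ 34) ≤ Real.log ((p : ℝ) ^ 10) :=
      Real.log_le_log (by positivity)
        (le_trans (by norm_num) (pow_le_pow_left₀ (by norm_num) hp' 10))
    rw [Real.log_pow, Real.log_pow] at h1
    push_cast at h1
    linarith
  have hL : 3.45 ≤ Real.log p + 1.1 := by linarith [Real.log_two_gt_d9]
  set L := Real.log p + 1.1
  set r := √(p : ℝ)
  have hL2 : 11.9 ≤ L ^ 2 := by nlinarith
  nlinarith [mul_le_mul hsqrt hL2 (by norm_num) (by positivity)]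

lemma self_lt_sqrt_mul_sq {p : ℕ} (hp : 2 ≤ p) (hp' : p ≤ 10) :
    (p : ℝ) < √p * (Real.log p + 1.1) ^ 2 := by
  have h2 : (2 : ℝ) ≤ p := by exact_mod_cast hp
  have h10 : (p : ℝ) ≤ 10 := by exact_mod_cast hp'
  have hlog : Real.log 2 ≤ Real.log p := Real.log_le_log (by norm_num) h2
  have hL : 1.793 ≤ Real.log p + 1.1 := by linarith [Real.log_two_gt_d9]
  have hs0 : 0 < √(p : ℝ) := Real.sqrt_pos.mpr (by linarith)
  have hs : √(p : ℝ) < 3.2 := (Real.sqrt_lt' (by norm_num)).mpr (by linarith)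
  have hL2 : 3.2 < (Real.log p + 1.1) ^ 2 := by nlinarith
  calc (p : ℝ) = √p * √p := (Real.mul_self_sqrt (by linarith)).symm
    _ < _ := mul_lt_mul_of_pos_left (hs.trans hL2) hs0

lemma abs_invCount_prod_sub_lt (p : ℕ) [Fact p.Prime] {S T : Set ℝ} {u v : ℝ}
    (hu0 : 0 ≤ u) (hu : u ≤ p) (hv0 : 0 ≤ v) (hv : v ≤ p)
    (hS : ∃ n₀ n₁ : ℕ, n₀ ≤ n₁ ∧ 1 ≤ n₀ ∧ n₁ ≤ p ∧ |((n₁ - n₀ : ℕ) : ℝ) - u| ≤ 1 ∧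
      ∀ x : ℕ, 0 < x → ((x : ℝ) ∈ S ↔ x ∈ Ico n₀ n₁))
    (hT : ∃ n₀ n₁ : ℕ, n₀ ≤ n₁ ∧ 1 ≤ n₀ ∧ n₁ ≤ p ∧ |((n₁ - n₀ : ℕ) : ℝ) - v| ≤ 1 ∧
      ∀ x : ℕ, 0 < x → ((x : ℝ) ∈ T ↔ x ∈ Ico n₀ n₁)) :
    |(invCount p (S ×ˢ T) : ℝ) - u * v / p| < √p * (Real.log p + 1.1) ^ 2 := by
  have hprime : p.Prime := Fact.out
  have hp : (0 : ℝ) < p := by exact_mod_cast hprime.pos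
  obtain ⟨n₀, n₁, hn, hn₀, hn₁, hSu, hS⟩ := hS
  obtain ⟨m₀, m₁, hm, hm₀, hm₁, hTv, hT⟩ := hT
  rw [invCount_prod_eq_card p hn₀ hn₁ hm₀ hm₁ hS hT]
  set A := (Ico n₀ n₁).image (Nat.cast : ℕ → ZMod p) with hA
  set B := (Ico m₀ m₁).image (Nat.cast : ℕ → ZMod p) with hB
  have hcard : ∀ {k l : ℕ}, l ≤ p → #((Ico k l).image (Nat.cast : ℕ → ZMod p)) = l - k := by
    intro k l hl
    rw [card_image_of_injOn, Nat.card_Ico]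
    intro x hx y hy hxy
    simp only [coe_Ico, Set.mem_Ico] at hx hy
    have := congrArg ZMod.val hxy
    rwa [ZMod.val_cast_of_lt (by omega), ZMod.val_cast_of_lt (by omega)] at this
  rcases le_or_gt p 10 with hp10 | hp10
  · refine lt_of_le_of_lt ?_ (self_lt_sqrt_mul_sq hprime.two_le hp10)
    have h1 : (#{x ∈ A | x⁻¹ ∈ B} : ℝ) ≤ p := by
      exact_mod_cast (card_le_univ _).trans_eq (ZMod.card p)
    have h2 : u * v / p ≤ p := by
      rw [div_le_iff₀ hp]; exact mul_le_mul hu hv hv0 hp.le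
    have h3 : 0 ≤ u * v / p := by positivity
    rw [abs_le]
    constructor <;> linarith [Nat.cast_nonneg (α := ℝ) (#{x ∈ A | x⁻¹ ∈ B})]
  · have hp2 : p ≠ 2 := by omega
    refine lt_of_le_of_lt ?_ (error_lt_of_eleven_le hp10)
    have h1 := abs_card_filter_inv_sub_le p hp2 (ZMod.isPrimitive_stdAddChar p) A B
    have hEA := sum_norm_sum_Ico_addChar_le p hp2 (n₀ := n₀) hn₁
    have hEB := sum_norm_sum_Ico_addChar_le p hp2 (n₀ := m₀) hm₁
    have h2 : |(#A * #B / p : ℝ) - u * v / p| ≤ 2 := by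
      rw [hA, hB, hcard hn₁, hcard hm₁]
      refine abs_mul_div_sub_mul_div_le hp (Nat.cast_nonneg _) ?_ hv0 hv hSu hTv
      exact_mod_cast (Nat.sub_le _ _).trans hn₁
    refine (abs_sub_le _ (#A * #B / p : ℝ) _).trans (add_le_add (h1.trans ?_) h2)
    have hEA0 : 0 ≤ 0.6367 * (Real.log p + 1.1) := le_trans (by positivity) hEA
    gcongr

end Rectangles

theorem stmt_13 (p : ℕ) (hp : p.Prime) (a b c d : ℝ)
    (ha : 0 ≤ a) (hab : a < b) (hbp : b < p)
    (hc : 0 ≤ c) (hcd : c < d) (hdp : d < p) :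
    |(invCount p (Set.Ico a b ×ˢ Set.Ico c d) : ℝ) - (b - a) * (d - c) / p|
        < Real.sqrt p * (Real.log p + 1.1) ^ 2 ∧
    |(invCount p (Set.Ioc a b ×ˢ Set.Ioc c d) : ℝ) - (b - a) * (d - c) / p|
        < Real.sqrt p * (Real.log p + 1.1) ^ 2 := by
  have : Fact p.Prime := ⟨hp⟩
  exact ⟨abs_invCount_prod_sub_lt p (by linarith) (by linarith) (by linarith) (by linarith)
      (exists_nat_Ico_iff_mem_Ico ha hab hbp) (exists_nat_Ico_iff_mem_Ico hc hcd hdp),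
    abs_invCount_prod_sub_lt p (by linarith) (by linarith) (by linarith) (by linarith)
      (exists_nat_Ico_iff_mem_Ioc ha hab hbp) (exists_nat_Ico_iff_mem_Ioc hc hcd hdp)⟩
end
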